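/- Let d ≥ 1, γ ≥ 0, 1 < r < ∞ and 1 < p₁, p₂, q₁, q₂ ≤ ∞ satisfy 1/r = 1/p₁ + 1/q₁ = 1/p₂ + 1/q₂. Then there exists a constant C > 0, depending on d, γ, r, p₁, q₁, p₂, q₂, such that for all Schwartz functions u, v on ℝ^d, ‖Λ^γ(uv)‖_{L^r} ≤ C ( ‖Λ^γ u‖_{L^{p₁}} ‖v‖_{L^{q₁}} + ‖u‖_{L^{p₂}} ‖Λ^γ v‖_{L^{q₂}} ). -/

import Mathlib

open MeasureTheory Real Complex
open scoped FourierTransform ENNReal SchwartzMap RealInnerProductSpace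

/-- The fractional derivative `Λ^γ f(x) = ∫ e^{2πi x·ξ} |ξ|^γ f̂(ξ) dξ`. -/
noncomputable def lamPow {d : ℕ} (γ : ℝ) (f : EuclideanSpace ℝ (Fin d) → ℂ)
    (x : EuclideanSpace ℝ (Fin d)) : ℂ :=
  ∫ ξ : EuclideanSpace ℝ (Fin d),
    Complex.exp (2 * Real.pi * Complex.I * ((⟪x, ξ⟫ : ℝ) : ℂ)) *
      ((‖ξ‖ ^ γ : ℝ) : ℂ) * 𝓕 f ξ

namespace KP

/-- Euclidean space. -/
abbrev KE (d : ℕ) : Type := EuclideanSpace ℝ (Fin d)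

end KP

namespace KP

/-- Uncentred Hardy-Littlewood maximal function. -/
noncomputable def MF {d : ℕ} (g : KE d → ℝ≥0∞) (x : KE d) : ℝ≥0∞ :=
  ⨆ (c : KE d) (r : ℝ) (_ : x ∈ Metric.ball c r),
    (volume (Metric.ball c r))⁻¹ * ∫⁻ y in Metric.ball c r, g y

theorem MF_isOpen {d : ℕ} (g : KE d → ℝ≥0∞) (a : ℝ≥0∞) : IsOpen {x | a < MF g x} := by
  have : {x | a < MF g x} = ⋃ (c : KE d) (r : ℝ)
      (_ : a < (volume (Metric.ball c r))⁻¹ * ∫⁻ y in Metric.ball c r, g y), Metric.ball c r := by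
    ext x
    simp only [MF, Set.mem_ofPred_eq, lt_iSup_iff, Set.mem_iUnion]
    constructor
    · rintro ⟨c, r, h1, h2⟩; exact ⟨c, r, h2, h1⟩
    · rintro ⟨c, r, h1, h2⟩; exact ⟨c, r, h2, h1⟩
  rw [this]
  exact isOpen_iUnion fun c => isOpen_iUnion fun r => isOpen_iUnion fun _ => Metric.isOpen_ball

theorem MF_measurable {d : ℕ} (g : KE d → ℝ≥0∞) : Measurable (MF g) :=
  measurable_of_Ioi fun a => (MF_isOpen g a).measurableSet

theorem lintegral_ball_le_MF {d : ℕ} (g : KE d → ℝ≥0∞) {x c : KE d} {r : ℝ}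
    (hx : x ∈ Metric.ball c r) :
    ∫⁻ y in Metric.ball c r, g y ≤ volume (Metric.ball c r) * MF g x := by
  have hr : 0 < r := Metric.pos_of_mem_ball hx
  have h0 : volume (Metric.ball c r) ≠ 0 := (Metric.measure_ball_pos volume c hr).ne'
  have h1 : volume (Metric.ball c r) ≠ ∞ := measure_ball_lt_top.ne
  have : (volume (Metric.ball c r))⁻¹ * ∫⁻ y in Metric.ball c r, g y ≤ MF g x := by
    unfold MF
    exact le_iSup_of_le c (le_iSup_of_le r (le_iSup_of_le hx le_rfl))
  calc ∫⁻ y in Metric.ball c r, g y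
      = volume (Metric.ball c r) * ((volume (Metric.ball c r))⁻¹ * ∫⁻ y in Metric.ball c r, g y) := by
        rw [← mul_assoc, ENNReal.mul_inv_cancel h0 h1, one_mul]
    _ ≤ _ := by gcongr

theorem MF_mono {d : ℕ} {g h : KE d → ℝ≥0∞} (H : ∀ x, g x ≤ h x) (x : KE d) : MF g x ≤ MF h x := by
  unfold MF
  refine iSup_mono fun c => iSup_mono fun r => iSup_mono fun _ => ?_
  gcongr
  exact H _

theorem MF_le_essSup {d : ℕ} (g : KE d → ℝ≥0∞) (x : KE d) : MF g x ≤ essSup g volume := by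
  unfold MF
  refine iSup_le fun c => iSup_le fun r => iSup_le fun hx => ?_
  have hr : 0 < r := Metric.pos_of_mem_ball hx
  have h0 : volume (Metric.ball c r) ≠ 0 := (Metric.measure_ball_pos volume c hr).ne'
  have h1 : volume (Metric.ball c r) ≠ ∞ := measure_ball_lt_top.ne
  calc (volume (Metric.ball c r))⁻¹ * ∫⁻ y in Metric.ball c r, g y
      ≤ (volume (Metric.ball c r))⁻¹ * ∫⁻ y in Metric.ball c r, essSup g volume := by
        refine mul_le_mul' le_rfl ?_
        exact lintegral_mono_ae (ae_restrict_of_ae (ENNReal.ae_le_essSup g))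
    _ = essSup g volume := by
        rw [setLIntegral_const, mul_comm (essSup _ _), ← mul_assoc, ENNReal.inv_mul_cancel h0 h1,
          one_mul]

theorem MF_weak {d : ℕ} (g : KE d → ℝ≥0∞) (a : ℝ≥0∞) :
    a * volume {x | a < MF g x} ≤ ENNReal.ofReal (4 ^ d) * ∫⁻ y, g y := by
  let T : ℕ → Set (KE d × ℝ) := fun n => {b | 0 < b.2 ∧ b.2 ≤ n ∧
    a * volume (Metric.ball b.1 b.2) ≤ ∫⁻ y in Metric.ball b.1 b.2, g y}
  let U : ℕ → Set (KE d) := fun n => ⋃ b ∈ T n, Metric.ball b.1 b.2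
  have hTmono : Monotone T := by
    intro m n hmn b hb
    exact ⟨hb.1, hb.2.1.trans (by exact_mod_cast hmn), hb.2.2⟩
  have hUmono : Monotone U := by
    intro m n hmn
    exact Set.biUnion_subset_biUnion_left (hTmono hmn)
  have hsub : {x | a < MF g x} ⊆ ⋃ n, U n := by
    intro x hx
    simp only [MF, Set.mem_ofPred_eq, lt_iSup_iff] at hx
    obtain ⟨c, r, h1, h2⟩ := hx
    have hr : 0 < r := Metric.pos_of_mem_ball h1
    have h0 : volume (Metric.ball c r) ≠ 0 := (Metric.measure_ball_pos volume c hr).ne'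
    have h1' : volume (Metric.ball c r) ≠ ∞ := measure_ball_lt_top.ne
    obtain ⟨n, hn⟩ := exists_nat_ge r
    refine Set.mem_iUnion.2 ⟨n, Set.mem_biUnion (x := (c, r)) ⟨hr, hn, ?_⟩ h1⟩
    calc a * volume (Metric.ball c r)
        ≤ ((volume (Metric.ball c r))⁻¹ * ∫⁻ y in Metric.ball c r, g y) * volume (Metric.ball c r) := by
          gcongr
      _ = _ := by
          rw [mul_comm, ← mul_assoc, ENNReal.mul_inv_cancel h0 h1', one_mul]
  have hU : ∀ n, a * volume (U n) ≤ ENNReal.ofReal (4 ^ d) * ∫⁻ y, g y := by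
    intro n
    obtain ⟨u, hut, hdis, hcov⟩ := Vitali.exists_disjoint_subfamily_covering_enlargement_ball
      (T n) (fun b => b.1) (fun b => b.2) n (fun b hb => hb.2.1) 4 (by norm_num)
    have hcount : u.Countable := hdis.countable_of_isOpen (fun b _ => Metric.isOpen_ball)
      (fun b hb => ⟨b.1, Metric.mem_ball_self (hut hb).1⟩)
    have hsub2 : U n ⊆ ⋃ b ∈ u, Metric.ball b.1 (4 * b.2) := by
      intro x hx
      obtain ⟨b, hb, hxb⟩ := Set.mem_iUnion₂.1 hx
      obtain ⟨b', hb', hs⟩ := hcov b hb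
      exact Set.mem_biUnion hb' (hs hxb)
    have : Countable u := hcount.to_subtype
    calc a * volume (U n) ≤ a * ∑' b : u, volume (Metric.ball b.1.1 (4 * b.1.2)) := by
          gcongr
          refine (measure_mono hsub2).trans ?_
          exact measure_biUnion_le volume hcount _
      _ = ∑' b : u, a * volume (Metric.ball b.1.1 (4 * b.1.2)) := ENNReal.tsum_mul_left.symm
      _ ≤ ∑' b : u, ENNReal.ofReal (4 ^ d) * ∫⁻ y in Metric.ball b.1.1 b.1.2, g y := by
          refine ENNReal.tsum_le_tsum fun b => ?_
          have h := (hut b.2).2.2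
          rw [Measure.addHaar_ball_mul_of_pos volume _ (by norm_num : (0:ℝ) < 4)]
          rw [Measure.addHaar_ball_center] at h
          simp only [finrank_euclideanSpace, Fintype.card_fin]
          calc a * (ENNReal.ofReal (4 ^ d) * volume (Metric.ball (0 : KE d) b.1.2))
              = ENNReal.ofReal (4 ^ d) * (a * volume (Metric.ball (0 : KE d) b.1.2)) := by ring
            _ ≤ _ := by gcongr
      _ = ENNReal.ofReal (4 ^ d) * ∑' b : u, ∫⁻ y in Metric.ball b.1.1 b.1.2, g y :=
          ENNReal.tsum_mul_left
      _ = ENNReal.ofReal (4 ^ d) * ∫⁻ y in ⋃ b ∈ u, Metric.ball b.1 b.2, g y := by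
          rw [lintegral_biUnion hcount (fun b _ => measurableSet_ball) hdis]
      _ ≤ _ := by
          gcongr
          exact Measure.restrict_le_self
  calc a * volume {x | a < MF g x} ≤ a * volume (⋃ n, U n) := by gcongr
    _ = a * ⨆ n, volume (U n) := by rw [hUmono.measure_iUnion]
    _ = ⨆ n, a * volume (U n) := ENNReal.mul_iSup _ _
    _ ≤ _ := iSup_le hU

/-- Pointwise layer cake. -/
theorem layer_pt {p : ℝ} (hp : 0 < p) (y : ℝ≥0∞) :
    ∫⁻ l in Set.Ioi (0 : ℝ), (if ENNReal.ofReal l < y then ENNReal.ofReal (p * l ^ (p - 1)) else 0)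
      = y ^ p := by
  have key : ∀ a : ℝ, 0 ≤ a → ∫⁻ l in Set.Ioi (0 : ℝ),
      (if ENNReal.ofReal l < ENNReal.ofReal a then ENNReal.ofReal (p * l ^ (p - 1)) else 0)
      = ENNReal.ofReal a ^ p := by
    intro a ha
    rcases ha.eq_or_lt with rfl | ha'
    · simp [hp]
    have e1 : ∫⁻ l in Set.Ioi (0 : ℝ),
      (if ENNReal.ofReal l < ENNReal.ofReal a then ENNReal.ofReal (p * l ^ (p - 1)) else 0)
      = ∫⁻ l in Set.Ioo 0 a, ENNReal.ofReal (p * l ^ (p - 1)) := by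
      rw [← lintegral_indicator measurableSet_Ioi, ← lintegral_indicator measurableSet_Ioo]
      congr 1
      ext l
      simp only [Set.indicator, Set.mem_Ioi, Set.mem_Ioo, ENNReal.ofReal_lt_ofReal_iff ha']
      by_cases h1 : 0 < l <;> by_cases h2 : l < a <;> simp [h1, h2]
    rw [e1, restrict_Ioo_eq_restrict_Ioc, ← ofReal_integral_eq_lintegral_ofReal]
    · rw [← intervalIntegral.integral_of_le ha, intervalIntegral.integral_const_mul,
        integral_rpow (Or.inl (by linarith)), ENNReal.ofReal_rpow_of_pos ha']
      congr 1
      rw [sub_add_cancel, Real.zero_rpow hp.ne', sub_zero]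
      field_simp
    · have := (intervalIntegral.intervalIntegrable_rpow' (a := 0) (b := a) (r := p - 1)
        (by linarith)).const_mul p
      rwa [intervalIntegrable_iff_integrableOn_Ioc_of_le ha] at this
    · refine (ae_restrict_iff' measurableSet_Ioc).2 (Filter.Eventually.of_forall fun l hl => ?_)
      have := hl.1
      positivity
  induction y with
  | top =>
    rw [ENNReal.top_rpow_of_pos hp]
    refine ENNReal.eq_top_of_forall_nnreal_le fun r => ?_
    have h1 : (r : ℝ≥0∞) ≤ ENNReal.ofReal ((r : ℝ) ^ (1 / p)) ^ p := by
      rw [ENNReal.ofReal_rpow_of_nonneg (by positivity) hp.le, ← Real.rpow_mul (by positivity),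
        one_div_mul_cancel hp.ne', Real.rpow_one, ENNReal.ofReal_coe_nnreal]
    refine h1.trans ?_
    rw [← key _ (by positivity)]
    refine lintegral_mono fun l => ?_
    split_ifs with h1 h2 h2
    · exact le_rfl
    · exact absurd ENNReal.ofReal_lt_top h2
    · exact zero_le
    · exact le_rfl
  | coe r =>
    have := key r r.2
    simpa using this

theorem MF_strong {d : ℕ} {p : ℝ} (hp : 1 < p) {g : KE d → ℝ≥0∞} (hg : Measurable g) :
    ∫⁻ x, MF g x ^ p ≤ ENNReal.ofReal (p * 2 * 4 ^ d * (2 ^ (p - 1) / (p - 1))) * ∫⁻ x, g x ^ p := by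
  have hp0 : 0 < p := by linarith
  have hp1 : 0 < p - 1 := by linarith
  -- level set estimate
  have hlev : ∀ l : ℝ, 0 < l → ENNReal.ofReal l * volume {x | ENNReal.ofReal l < MF g x} ≤
      ENNReal.ofReal (2 * 4 ^ d) * ∫⁻ y, (if ENNReal.ofReal l < 2 * g y then g y else 0) := by
    intro l hl
    set g1 : KE d → ℝ≥0∞ := fun y => if ENNReal.ofReal l < 2 * g y then g y else 0 with hg1
    have hl2 : ENNReal.ofReal l = 2 * ENNReal.ofReal (l / 2) := by
      rw [show (2 : ℝ≥0∞) = ENNReal.ofReal 2 by simp, ← ENNReal.ofReal_mul (by norm_num)]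
      congr 1; ring
    have hle : ∀ y, g y ≤ g1 y + ENNReal.ofReal (l / 2) := by
      intro y
      simp only [hg1]
      split_ifs with h
      · exact le_self_add
      · rw [zero_add]
        rw [not_lt, hl2] at h
        exact (ENNReal.mul_le_mul_iff_right (by norm_num) (by norm_num)).1 h
    have hMF : ∀ x, MF g x ≤ MF g1 x + ENNReal.ofReal (l / 2) := by
      intro x
      conv_lhs => unfold MF
      refine iSup_le fun c => iSup_le fun r => iSup_le fun hx => ?_
      have hr : 0 < r := Metric.pos_of_mem_ball hx
      have h0 : volume (Metric.ball c r) ≠ 0 := (Metric.measure_ball_pos volume c hr).ne'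
      have h1 : volume (Metric.ball c r) ≠ ∞ := measure_ball_lt_top.ne
      calc (volume (Metric.ball c r))⁻¹ * ∫⁻ y in Metric.ball c r, g y
          ≤ (volume (Metric.ball c r))⁻¹ * ∫⁻ y in Metric.ball c r, (g1 y + ENNReal.ofReal (l / 2)) := by
            gcongr; exact hle _
        _ = (volume (Metric.ball c r))⁻¹ * (∫⁻ y in Metric.ball c r, g1 y)
            + ENNReal.ofReal (l / 2) := by
            rw [lintegral_add_right _ measurable_const, setLIntegral_const, mul_add,
              mul_comm (ENNReal.ofReal _), ← mul_assoc,
              ENNReal.inv_mul_cancel h0 h1, one_mul]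
        _ ≤ _ := by
            gcongr
            unfold MF
            exact le_iSup_of_le c (le_iSup_of_le r (le_iSup_of_le hx le_rfl))
    have hsub : {x | ENNReal.ofReal l < MF g x} ⊆ {x | ENNReal.ofReal (l / 2) < MF g1 x} := by
      intro x hx
      have h := lt_of_lt_of_le hx (hMF x)
      rw [hl2, two_mul] at h
      exact (ENNReal.add_lt_add_iff_right ENNReal.ofReal_ne_top).1 h
    calc ENNReal.ofReal l * volume {x | ENNReal.ofReal l < MF g x}
        ≤ 2 * ENNReal.ofReal (l / 2) * volume {x | ENNReal.ofReal (l / 2) < MF g1 x} := by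
          rw [← hl2]; gcongr
      _ = 2 * (ENNReal.ofReal (l / 2) * volume {x | ENNReal.ofReal (l / 2) < MF g1 x}) := by ring
      _ ≤ 2 * (ENNReal.ofReal (4 ^ d) * ∫⁻ y, g1 y) := by
          exact mul_le_mul' le_rfl (MF_weak g1 _)
      _ = _ := by
          rw [ENNReal.ofReal_mul (by norm_num), ← mul_assoc]; simp
  have hmeas1 : Measurable fun q : KE d × ℝ => (if ENNReal.ofReal q.2 < MF g q.1 then
      ENNReal.ofReal (p * q.2 ^ (p - 1)) else 0) := by
    refine Measurable.ite (measurableSet_lt (by fun_prop) ((MF_measurable g).comp measurable_fst))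
      ?_ measurable_const
    fun_prop
  have hmeas2 : Measurable fun q : ℝ × KE d => (if ENNReal.ofReal q.1 < 2 * g q.2 then
      ENNReal.ofReal ((p - 1) * q.1 ^ (p - 1 - 1)) * g q.2 else 0) := by
    refine Measurable.ite (measurableSet_lt (by fun_prop)
      ((hg.comp measurable_snd).const_mul 2)) ?_ measurable_const
    fun_prop
  calc ∫⁻ x, MF g x ^ p
      = ∫⁻ x, ∫⁻ l in Set.Ioi (0 : ℝ), (if ENNReal.ofReal l < MF g x then
          ENNReal.ofReal (p * l ^ (p - 1)) else 0) := by
        simp_rw [layer_pt hp0]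
    _ = ∫⁻ l in Set.Ioi (0 : ℝ), ∫⁻ x, (if ENNReal.ofReal l < MF g x then
          ENNReal.ofReal (p * l ^ (p - 1)) else 0) := by
        exact lintegral_lintegral_swap hmeas1.aemeasurable
    _ = ∫⁻ l in Set.Ioi (0 : ℝ), ENNReal.ofReal (p * l ^ (p - 1)) *
          volume {x | ENNReal.ofReal l < MF g x} := by
        congr 1; ext l
        rw [← lintegral_indicator_const (MF_isOpen g _).measurableSet]
        simp only [Set.indicator, Set.mem_ofPred_eq]
    _ ≤ ∫⁻ l in Set.Ioi (0 : ℝ), ENNReal.ofReal (p * 2 * 4 ^ d / (p - 1)) *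
          ∫⁻ y, (if ENNReal.ofReal l < 2 * g y then
            ENNReal.ofReal ((p - 1) * l ^ (p - 1 - 1)) * g y else 0) := by
        refine setLIntegral_mono' measurableSet_Ioi fun l hl => ?_
        have hl : 0 < l := hl
        have e1 : p * l ^ (p - 1) = p * l ^ (p - 1 - 1) * l := by
          rw [mul_assoc]; congr 1
          rw [← Real.rpow_add_one hl.ne']; congr 1; ring
        have e2 : ∀ y, (if ENNReal.ofReal l < 2 * g y then
            ENNReal.ofReal ((p - 1) * l ^ (p - 1 - 1)) * g y else 0) =
            ENNReal.ofReal ((p - 1) * l ^ (p - 1 - 1)) *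
            (if ENNReal.ofReal l < 2 * g y then g y else 0) := by
          intro y; split_ifs <;> simp
        simp_rw [e2]
        rw [lintegral_const_mul' _ _ ENNReal.ofReal_ne_top, e1, ENNReal.ofReal_mul (by positivity), mul_assoc]
        calc _ ≤ ENNReal.ofReal (p * l ^ (p - 1 - 1)) * (ENNReal.ofReal (2 * 4 ^ d) *
              ∫⁻ y, (if ENNReal.ofReal l < 2 * g y then g y else 0)) := by
              exact mul_le_mul' le_rfl (hlev l hl)
          _ = _ := by
              rw [← mul_assoc, ← mul_assoc, ← ENNReal.ofReal_mul (by positivity),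
                ← ENNReal.ofReal_mul (by positivity)]
              congr 2
              field_simp
    _ = ENNReal.ofReal (p * 2 * 4 ^ d / (p - 1)) * ∫⁻ l in Set.Ioi (0 : ℝ),
          ∫⁻ y, (if ENNReal.ofReal l < 2 * g y then
            ENNReal.ofReal ((p - 1) * l ^ (p - 1 - 1)) * g y else 0) :=
        lintegral_const_mul' _ _ ENNReal.ofReal_ne_top
    _ = ENNReal.ofReal (p * 2 * 4 ^ d / (p - 1)) * ∫⁻ y, ∫⁻ l in Set.Ioi (0 : ℝ),
          (if ENNReal.ofReal l < 2 * g y then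
            ENNReal.ofReal ((p - 1) * l ^ (p - 1 - 1)) * g y else 0) := by
        congr 1
        exact lintegral_lintegral_swap hmeas2.aemeasurable
    _ = ENNReal.ofReal (p * 2 * 4 ^ d / (p - 1)) * ∫⁻ y, (2 * g y) ^ (p - 1) * g y := by
        congr 2
        ext y
        rw [← layer_pt hp1, ← lintegral_mul_const _ ?_]
        · congr 1; ext l; split_ifs <;> simp
        · refine Measurable.ite (measurableSet_lt (by fun_prop) measurable_const) ?_ measurable_const
          fun_prop
    _ = _ := by
        have e3 : ∀ y, (2 * g y) ^ (p - 1) * g y = ENNReal.ofReal (2 ^ (p - 1)) * g y ^ p := by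
          intro y
          rw [ENNReal.mul_rpow_of_nonneg _ _ hp1.le, mul_assoc]
          congr 1
          · rw [← ENNReal.ofReal_rpow_of_pos (by norm_num)]; simp
          · conv_rhs => rw [show p = (p - 1) + 1 by ring, ENNReal.rpow_add_of_nonneg _ _ hp1.le zero_le_one,
              ENNReal.rpow_one]
        simp_rw [e3]
        rw [lintegral_const_mul' _ _ ENNReal.ofReal_ne_top, ← mul_assoc, ← ENNReal.ofReal_mul (by positivity)]
        congr 2
        ring

end KP

namespace KP

theorem MF_eLpNorm {d : ℕ} {p : ℝ≥0∞} (hp : 1 < p) :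
    ∃ C : ℝ, 0 < C ∧ ∀ g : KE d → ℝ≥0∞, Measurable g →
      eLpNorm (MF g) p volume ≤ ENNReal.ofReal C * eLpNorm g p volume := by
  by_cases hpt : p = ∞
  · subst hpt
    refine ⟨1, one_pos, fun g _ => ?_⟩
    rw [eLpNorm_exponent_top, eLpNorm_exponent_top, ENNReal.ofReal_one, one_mul]
    exact essSup_le_of_ae_le _ (Filter.Eventually.of_forall fun x => MF_le_essSup g x)
  have hp0 : p ≠ 0 := (zero_lt_one.trans hp).ne'
  have hP : 1 < p.toReal := by
    rw [← ENNReal.toReal_one]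
    exact (ENNReal.toReal_lt_toReal ENNReal.one_ne_top hpt).2 hp
  set P := p.toReal
  have hP1 : 0 < P - 1 := by linarith
  have hc : 0 < P * 2 * 4 ^ d * (2 ^ (P - 1) / (P - 1)) := by positivity
  refine ⟨(P * 2 * 4 ^ d * (2 ^ (P - 1) / (P - 1))) ^ (1 / P), by positivity, fun g hg => ?_⟩
  rw [eLpNorm_eq_lintegral_rpow_enorm_toReal hp0 hpt, eLpNorm_eq_lintegral_rpow_enorm_toReal hp0 hpt]
  simp only [enorm_eq_self]
  rw [← ENNReal.ofReal_rpow_of_pos hc, ← ENNReal.mul_rpow_of_nonneg _ _ (by positivity)]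
  gcongr
  exact MF_strong hP hg

theorem holder_prod {d : ℕ} {ι : Type*} (s : Finset ι) (a : ι → KE d → ℝ≥0∞)
    (ha : ∀ i, Measurable (a i)) (p : ι → ℝ≥0∞) (hp : ∀ i, p i ≠ 0) (α : ι → ℝ) (hα : ∀ i, 0 ≤ α i)
    (hs : ∑ i ∈ s, α i * (p i)⁻¹.toReal = 1) :
    ∫⁻ x, ∏ i ∈ s, a i x ^ α i ≤ ∏ i ∈ s, eLpNorm (a i) (p i) volume ^ α i := by
  classical
  have hfin : ∀ i, p i ≠ ∞ → eLpNorm (a i) (p i) volume ^ α i =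
      (∫⁻ x, a i x ^ (p i).toReal) ^ (α i * (p i)⁻¹.toReal) := by
    intro i hi
    rw [eLpNorm_eq_lintegral_rpow_enorm_toReal (hp i) hi]
    simp only [enorm_eq_self]
    rw [← ENNReal.rpow_mul, ENNReal.toReal_inv]
    congr 1
    field_simp
  have hpt : ∀ i, p i ≠ ∞ → ∀ x, a i x ^ α i = (a i x ^ (p i).toReal) ^ (α i * (p i)⁻¹.toReal) := by
    intro i hi x
    have : (p i).toReal ≠ 0 := ENNReal.toReal_ne_zero.2 ⟨hp i, hi⟩
    rw [← ENNReal.rpow_mul, ENNReal.toReal_inv]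
    congr 1
    field_simp
  rw [← Finset.prod_filter_mul_prod_filter_not s (fun i => p i = ∞)]
  have h1 : ∀ᵐ x : KE d, ∏ i ∈ s with p i = ∞, a i x ^ α i ≤
      ∏ i ∈ s with p i = ∞, eLpNorm (a i) (p i) volume ^ α i := by
    have : ∀ i ∈ s.filter (fun i => p i = ∞), ∀ᵐ x : KE d, a i x ^ α i ≤
        eLpNorm (a i) (p i) volume ^ α i := by
      intro i hi
      rw [(Finset.mem_filter.1 hi).2, eLpNorm_exponent_top]
      filter_upwards [ENNReal.ae_le_essSup (a i) (μ := volume)] with x hx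
      exact ENNReal.rpow_le_rpow hx (hα i)
    filter_upwards [(Finset.eventually_all _).2 this] with x hx
    exact Finset.prod_le_prod' hx
  calc ∫⁻ x, ∏ i ∈ s, a i x ^ α i
      = ∫⁻ x, (∏ i ∈ s with p i = ∞, a i x ^ α i) * ∏ i ∈ s with ¬ p i = ∞, a i x ^ α i := by
        simp_rw [Finset.prod_filter_mul_prod_filter_not]
    _ ≤ ∫⁻ x, (∏ i ∈ s with p i = ∞, eLpNorm (a i) (p i) volume ^ α i) *
          ∏ i ∈ s with ¬ p i = ∞, a i x ^ α i := by
        refine lintegral_mono_ae ?_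
        filter_upwards [h1] with x hx
        gcongr
    _ = (∏ i ∈ s with p i = ∞, eLpNorm (a i) (p i) volume ^ α i) *
          ∫⁻ x, ∏ i ∈ s with ¬ p i = ∞, a i x ^ α i := by
        rw [lintegral_const_mul]
        exact Finset.measurable_prod _ fun i _ => (ha i).pow_const _
    _ ≤ _ := by
        refine mul_le_mul' le_rfl ?_
        calc ∫⁻ x, ∏ i ∈ s with ¬ p i = ∞, a i x ^ α i
            = ∫⁻ x, ∏ i ∈ s with ¬ p i = ∞, (a i x ^ (p i).toReal) ^ (α i * (p i)⁻¹.toReal) := by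
              congr 1; ext x
              exact Finset.prod_congr rfl fun i hi => hpt i (Finset.mem_filter.1 hi).2 x
          _ ≤ ∏ i ∈ s with ¬ p i = ∞, (∫⁻ x, a i x ^ (p i).toReal) ^ (α i * (p i)⁻¹.toReal) := by
              refine ENNReal.lintegral_prod_norm_pow_le _ (fun i _ => ((ha i).pow_const _).aemeasurable) ?_ ?_
              · rw [← hs, ← Finset.sum_filter_add_sum_filter_not s (fun i => p i = ∞)]
                rw [Finset.sum_eq_zero (s := s.filter (fun i => p i = ∞)), zero_add]
                intro i hi
                rw [(Finset.mem_filter.1 hi).2]; simp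
              · intro i _
                exact mul_nonneg (hα i) ENNReal.toReal_nonneg
          _ = _ := Finset.prod_congr rfl fun i hi => (hfin i (Finset.mem_filter.1 hi).2).symm

theorem holder3 {d : ℕ} {a b c : KE d → ℝ≥0∞} (ha : Measurable a) (hb : Measurable b)
    (hc : Measurable c) {p q s : ℝ≥0∞} (hp : p ≠ 0) (hq : q ≠ 0) (hs : s ≠ 0) {α β κ : ℝ}
    (hα : 0 ≤ α) (hβ : 0 ≤ β) (hκ : 0 ≤ κ)
    (h : α * p⁻¹.toReal + β * q⁻¹.toReal + κ * s⁻¹.toReal = 1) :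
    ∫⁻ x, a x ^ α * b x ^ β * c x ^ κ ≤
      eLpNorm a p volume ^ α * eLpNorm b q volume ^ β * eLpNorm c s volume ^ κ := by
  have := holder_prod (Finset.univ : Finset (Fin 3)) ![a, b, c]
    (by intro i; fin_cases i <;> simp [ha, hb, hc]) ![p, q, s]
    (by intro i; fin_cases i <;> simp [hp, hq, hs]) ![α, β, κ]
    (by intro i; fin_cases i <;> simp [hα, hβ, hκ])
    (by simpa [Fin.sum_univ_three] using h)
  simpa [Fin.prod_univ_three] using this

theorem ae_le_MF {d : ℕ} {g : KE d → ℝ} (hg : Measurable g) (h0 : ∀ x, 0 ≤ g x) {B : ℝ}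
    (hB : ∀ x, g x ≤ B) :
    ∀ᵐ x, ENNReal.ofReal (g x) ≤ MF (fun y => ENNReal.ofReal (g y)) x := by
  have hloc : LocallyIntegrable g volume := by
    refine (locallyIntegrable_const B).mono hg.aestronglyMeasurable (Filter.Eventually.of_forall fun x => ?_)
    rw [Real.norm_of_nonneg (h0 x)]
    exact (hB x).trans (le_abs_self B)
  filter_upwards [(Besicovitch.vitaliFamily (volume : Measure (KE d))).ae_tendsto_average hloc] with x hx
  have h2 := ENNReal.tendsto_ofReal (hx.comp (Besicovitch.tendsto_filterAt volume x))
  refine le_of_tendsto h2 ?_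
  filter_upwards [self_mem_nhdsWithin] with r (hr : 0 < r)
  have hintg : IntegrableOn g (Metric.ball x r) volume :=
    (hloc.integrableOn_isCompact (isCompact_closedBall x r)).mono_set Metric.ball_subset_closedBall
  have e1 : (volume.restrict (Metric.closedBall x r)) = volume.restrict (Metric.ball x r) := by
    refine Measure.restrict_congr_set ?_
    rw [← Metric.ball_union_sphere]
    exact union_ae_eq_left_of_ae_eq_empty (ae_eq_empty.2 (Measure.addHaar_sphere_of_ne_zero _ _ hr.ne'))
  have h0' : volume (Metric.ball x r) ≠ 0 := (Metric.measure_ball_pos volume x hr).ne'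
  have h1' : volume (Metric.ball x r) ≠ ∞ := measure_ball_lt_top.ne
  have h3 := lintegral_ball_le_MF (fun y => ENNReal.ofReal (g y)) (Metric.mem_ball_self (x := x) hr)
  simp only [Function.comp]
  rw [average_eq, e1, smul_eq_mul, Measure.real, Measure.restrict_apply_univ,
    ENNReal.ofReal_mul (by positivity),
    ofReal_integral_eq_lintegral_ofReal hintg (Filter.Eventually.of_forall h0),
    ← ENNReal.toReal_inv, ENNReal.ofReal_toReal (ENNReal.inv_ne_top.2 h0')]
  calc _ ≤ (volume (Metric.ball x r))⁻¹ * (volume (Metric.ball x r) * MF (fun y => ENNReal.ofReal (g y)) x) :=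
        mul_le_mul' le_rfl h3
    _ = _ := by rw [← mul_assoc, ENNReal.inv_mul_cancel h0' h1', one_mul]

/-- The standard decaying kernel at scale `t`. -/
noncomputable def kb {d : ℕ} (t : ℝ) (w : KE d) : ℝ := (t ^ d)⁻¹ * ((1 + ‖w‖ / t) ^ (d + 1))⁻¹

theorem kb_nonneg {d : ℕ} {t : ℝ} (ht : 0 < t) (w : KE d) : 0 ≤ kb t w := by
  unfold kb; positivity

theorem kb_dom {d : ℕ} : ∃ C : ℝ, 0 < C ∧ ∀ (g : KE d → ℝ≥0∞), Measurable g →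
    ∀ (t : ℝ), 0 < t → ∀ x y : KE d, x ∈ Metric.ball y t →
      ∫⁻ z, ENNReal.ofReal (kb t (y - z)) * g z ≤ ENNReal.ofReal C * MF g x := by
  set V := (volume (Metric.ball (0 : KE d) 1)).toReal with hV
  have hVpos : 0 < V := ENNReal.toReal_pos (Metric.measure_ball_pos volume _ one_pos).ne'
    measure_ball_lt_top.ne
  refine ⟨2 ^ (d + 1) * V, by positivity, fun g hg t ht x y hxy => ?_⟩
  have hpt : ∀ z, ENNReal.ofReal (kb t (y - z)) * g z ≤ ∑' n : ℕ,
      ENNReal.ofReal ((t ^ d)⁻¹ * ((2 ^ n) ^ (d + 1))⁻¹) *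
        (Metric.ball y (2 ^ (n + 1) * t)).indicator g z := by
    intro z
    have h1 : 1 ≤ 1 + ‖y - z‖ / t := le_add_of_nonneg_right (by positivity)
    obtain ⟨n, hn1, hn2⟩ := exists_nat_pow_near h1 (one_lt_two : (1 : ℝ) < 2)
    refine le_trans ?_ (ENNReal.le_tsum n)
    have hz : z ∈ Metric.ball y (2 ^ (n + 1) * t) := by
      rw [Metric.mem_ball, dist_eq_norm, norm_sub_rev, ← div_lt_iff₀ ht]
      linarith
    rw [Set.indicator_of_mem hz]
    gcongr
    unfold kb
    gcongr
  calc ∫⁻ z, ENNReal.ofReal (kb t (y - z)) * g z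
      ≤ ∫⁻ z, ∑' n : ℕ, ENNReal.ofReal ((t ^ d)⁻¹ * ((2 ^ n) ^ (d + 1))⁻¹) *
        (Metric.ball y (2 ^ (n + 1) * t)).indicator g z := lintegral_mono hpt
    _ = ∑' n : ℕ, ENNReal.ofReal ((t ^ d)⁻¹ * ((2 ^ n) ^ (d + 1))⁻¹) *
        ∫⁻ z in Metric.ball y (2 ^ (n + 1) * t), g z := by
        rw [lintegral_tsum]
        · congr 1; ext n
          rw [lintegral_const_mul' _ _ ENNReal.ofReal_ne_top, lintegral_indicator measurableSet_ball]
        · intro n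
          exact ((hg.indicator measurableSet_ball).const_mul _).aemeasurable
    _ ≤ ∑' n : ℕ, ENNReal.ofReal (2 ^ d * V * (1 / 2) ^ n) * MF g x := by
        refine ENNReal.tsum_le_tsum fun n => ?_
        have hx : x ∈ Metric.ball y (2 ^ (n + 1) * t) := by
          refine Metric.ball_subset_ball ?_ hxy
          nlinarith [one_le_pow₀ (one_le_two : (1 : ℝ) ≤ 2) (n := n + 1)]
        calc _ ≤ ENNReal.ofReal ((t ^ d)⁻¹ * ((2 ^ n) ^ (d + 1))⁻¹) *
              (volume (Metric.ball y (2 ^ (n + 1) * t)) * MF g x) :=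
              mul_le_mul' le_rfl (lintegral_ball_le_MF g hx)
          _ = _ := by
              rw [Measure.addHaar_ball_of_pos volume _ (by positivity), ← mul_assoc,
                ← ENNReal.ofReal_toReal (measure_ball_lt_top (μ := volume) (x := (0 : KE d)) (r := 1)).ne,
                ← hV, ← ENNReal.ofReal_mul (by positivity), ← ENNReal.ofReal_mul (by positivity)]
              congr 2
              simp only [finrank_euclideanSpace, Fintype.card_fin]
              rw [mul_pow, pow_succ 2 n, mul_pow, pow_succ (2 ^ n), one_div, inv_pow]
              field_simp
    _ = _ := by
        rw [ENNReal.tsum_mul_right, ← ENNReal.ofReal_tsum_of_nonneg (fun n => by positivity)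
          ((summable_geometric_two).mul_left _), tsum_mul_left, tsum_geometric_two]
        congr 2
        ring

/-- nontangential infimum -/
noncomputable def HI {d : ℕ} (h : KE d → ℝ≥0∞) (t : ℝ) (y : KE d) : ℝ≥0∞ :=
  ⨅ x ∈ Metric.ball y t, h x

theorem HI_le {d : ℕ} {h : KE d → ℝ≥0∞} {t : ℝ} {y x : KE d} (hx : x ∈ Metric.ball y t) :
    HI h t y ≤ h x := iInf₂_le x hx

theorem HI_measurable {d : ℕ} (h : KE d → ℝ≥0∞) :
    Measurable (fun q : ℝ × KE d => HI h q.1 q.2) := by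
  refine measurable_of_Iio fun a => ?_
  have : (fun q : ℝ × KE d => HI h q.1 q.2) ⁻¹' Set.Iio a =
      ⋃ (x : KE d) (_ : h x < a), {q : ℝ × KE d | dist x q.2 < q.1} := by
    ext q
    simp only [HI, Set.mem_preimage, Set.mem_Iio, iInf_lt_iff, Set.mem_iUnion, Metric.mem_ball,
      Set.mem_ofPred_eq]
    constructor
    · rintro ⟨x, h1, h2⟩; exact ⟨x, h2, h1⟩
    · rintro ⟨x, h1, h2⟩; exact ⟨x, h2, h1⟩
  rw [this]
  refine IsOpen.measurableSet (isOpen_iUnion fun x => isOpen_iUnion fun _ => ?_)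
  exact isOpen_lt (by fun_prop) (by fun_prop)

end KP

namespace KP

theorem breg1 {a b : ℝ} (ha : 1 < a) (ha2 : a ≤ 2) (hb : 0 ≤ b) :
    (a - 1) ^ 2 * (b - 1) ^ 2 ≤ (b ^ a - 1 - a * (b - 1)) * (1 + (2 - a) * (b - 1)) := by
  have hD : 0 < 1 + (2 - a) * (b - 1) := by nlinarith
  have h1 : b ^ (2 - a) ≤ 1 + (2 - a) * (b - 1) := by
    have := rpow_one_add_le_one_add_mul_self (s := b - 1) (by linarith) (p := 2 - a)
      (by linarith) (by linarith)
    simpa using this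
  have h2 : b ^ 2 ≤ b ^ a * (1 + (2 - a) * (b - 1)) := by
    calc b ^ 2 = b ^ a * b ^ (2 - a) := by
          rcases hb.eq_or_lt with rfl | hb
          · rw [Real.zero_rpow (by linarith : a ≠ 0)]; simp
          · rw [← Real.rpow_add hb]; simp
      _ ≤ _ := mul_le_mul_of_nonneg_left h1 (Real.rpow_nonneg hb a)
  nlinarith

theorem bregm {a b m : ℝ} (ha : 1 < a) (ha2 : a ≤ 2) (hb : 0 ≤ b) (hm : 0 < m) :
    (a - 1) ^ 2 * (b - m) ^ 2 ≤ (b ^ a - m ^ a - a * m ^ (a - 1) * (b - m)) *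
      (m ^ (2 - a) + (2 - a) * m ^ (1 - a) * (b - m)) := by
  have h := breg1 ha ha2 (b := b / m) (by positivity)
  have e1 : m ^ a = m * m ^ (a - 1) := by
    rw [Real.rpow_sub_one hm.ne']; field_simp
  have e2 : m ^ (2 - a) = m * m ^ (1 - a) := by
    rw [show (2 - a) = 1 + (1 - a) by ring, Real.rpow_add hm]; simp
  have e3 : m ^ (a - 1) * m ^ (1 - a) = 1 := by
    rw [← Real.rpow_add hm]; simp
  have e4 : (b / m) ^ a = b ^ a / m ^ a := Real.div_rpow hb hm.le a
  rw [e4] at h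
  have hp : 0 < m ^ (a - 1) := by positivity
  have key : (b ^ a - m ^ a - a * m ^ (a - 1) * (b - m)) *
      (m ^ (2 - a) + (2 - a) * m ^ (1 - a) * (b - m)) =
      m ^ 2 * ((b ^ a / m ^ a - 1 - a * (b / m - 1)) * (1 + (2 - a) * (b / m - 1))) := by
    have f1 : b ^ a - m ^ a - a * m ^ (a - 1) * (b - m) =
        m ^ a * (b ^ a / m ^ a - 1 - a * (b / m - 1)) := by
      have : 0 < m ^ a := by positivity
      have : m ^ a * (b ^ a / m ^ a) = b ^ a := by field_simp
      have h5 : m ^ a * (a * (b / m - 1)) = a * m ^ (a - 1) * (b - m) := by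
        rw [e1]; field_simp
      linear_combination h5 - this
    have f2 : m ^ (2 - a) + (2 - a) * m ^ (1 - a) * (b - m) =
        m ^ (2 - a) * (1 + (2 - a) * (b / m - 1)) := by
      rw [e2]; field_simp
    have f3 : m ^ a * m ^ (2 - a) = m ^ 2 := by
      rw [← Real.rpow_add hm]; simp
    rw [f1, f2, ← f3]; ring
  rw [key]
  have : (b - m) ^ 2 = m ^ 2 * (b / m - 1) ^ 2 := by field_simp
  rw [this]
  nlinarith [sq_nonneg m]

theorem bregD {a b m : ℝ} (ha : 1 < a) (ha2 : a ≤ 2) (hb : 0 ≤ b) (hm : 0 < m) :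
    0 < m ^ (2 - a) + (2 - a) * m ^ (1 - a) * (b - m) := by
  have e2 : m ^ (2 - a) = m * m ^ (1 - a) := by
    rw [show (2 - a) = 1 + (1 - a) by ring, Real.rpow_add hm]; simp
  have hp : 0 < m ^ (1 - a) := by positivity
  rw [e2]
  have : 0 < m + (2 - a) * (b - m) := by nlinarith
  nlinarith

theorem amgm {T X Y : ℝ} (hX : 0 ≤ X) (hY : 0 < Y)
    (h : ∀ l : ℝ, 0 < l → 2 * T ≤ l * X + l⁻¹ * Y) (hT : 0 ≤ T) : T ^ 2 ≤ X * Y := by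
  rcases hX.eq_or_lt with rfl | hX
  · by_contra hc
    have hTp : 0 < T := by
      rcases hT.eq_or_lt with rfl | h'
      · simp at hc
      · exact h'
    have := h (Y / T) (by positivity)
    have e : (Y / T)⁻¹ * Y = T := by field_simp
    rw [e] at this; linarith
  · have h1 := h (√Y / √X) (by positivity)
    have hx := Real.sq_sqrt hX.le
    have hy := Real.sq_sqrt hY.le
    have hxp : 0 < √X := by positivity
    have hyp : 0 < √Y := by positivity
    have e1 : √Y / √X * X = √X * √Y := by
      rw [div_mul_eq_mul_div, div_eq_iff hxp.ne']; nlinarith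
    have e2 : (√Y / √X)⁻¹ * Y = √X * √Y := by
      rw [inv_div, div_mul_eq_mul_div, div_eq_iff hyp.ne']; nlinarith
    rw [e1, e2] at h1
    have : T ≤ √X * √Y := by linarith
    calc T ^ 2 ≤ (√X * √Y) ^ 2 := by gcongr
      _ = X * Y := by rw [mul_pow, hx, hy]

theorem jens {d : ℕ} {ρ b : KE d → ℝ} (hρ : Integrable ρ) (h0 : ∀ x, 0 ≤ ρ x) (h1 : ∫ x, ρ x = 1)
    (hb : Measurable b) (hb0 : ∀ x, 0 ≤ b x) {B : ℝ} (hB : ∀ x, b x ≤ B) {a : ℝ} (ha : 1 < a)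
    (ha2 : a ≤ 2) :
    0 ≤ (∫ x, ρ x * b x ^ a) - (∫ x, ρ x * b x) ^ a ∧
    (a - 1) ^ 2 * (∫ x, ρ x * |b x - ∫ x, ρ x * b x|) ^ 2 ≤
      ((∫ x, ρ x * b x ^ a) - (∫ x, ρ x * b x) ^ a) * (∫ x, ρ x * b x) ^ (2 - a) := by
  set m := ∫ x, ρ x * b x with hm
  have hBn : ∀ x, ‖b x‖ ≤ B := fun x => by rw [Real.norm_of_nonneg (hb0 x)]; exact hB x
  have hib : Integrable (fun x => ρ x * b x) :=
    hρ.mul_bdd hb.aestronglyMeasurable (Filter.Eventually.of_forall hBn)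
  have hia : Integrable (fun x => ρ x * b x ^ a) := by
    refine hρ.mul_bdd (c := B ^ a) (hb.pow_const a).aestronglyMeasurable
      (Filter.Eventually.of_forall fun x => ?_)
    rw [Real.norm_of_nonneg (Real.rpow_nonneg (hb0 x) a)]
    exact Real.rpow_le_rpow (hb0 x) (hB x) (by linarith)
  have hm0 : 0 ≤ m := integral_nonneg fun x => mul_nonneg (h0 x) (hb0 x)
  have hid : Integrable (fun x => ρ x * |b x - m|) := by
    refine hρ.mul_bdd (c := B + m) (hb.sub_const m).abs.aestronglyMeasurable
      (Filter.Eventually.of_forall fun x => ?_)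
    rw [Real.norm_of_nonneg (abs_nonneg _)]
    have := hb0 x; have := hB x
    rw [abs_le]; constructor <;> linarith
  rcases hm0.eq_or_lt with hm0 | hm0
  · have hz : ∫ x, ρ x * |b x - m| = 0 := by
      rw [← hm0]
      have : ∀ x, ρ x * |b x - 0| = ρ x * b x := fun x => by rw [sub_zero, abs_of_nonneg (hb0 x)]
      simp_rw [this]; rw [← hm, ← hm0]
    have hp : 0 ≤ (∫ x, ρ x * b x ^ a) - m ^ a := by
      rw [← hm0, Real.zero_rpow (by linarith), sub_zero]
      exact integral_nonneg fun x => mul_nonneg (h0 x) (Real.rpow_nonneg (hb0 x) a)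
    refine ⟨hp, ?_⟩
    rw [hz]
    have : 0 ≤ m ^ (2 - a) := Real.rpow_nonneg hm0.le _
    simpa using mul_nonneg hp this
  · have hilin : ∀ c e : ℝ, Integrable (fun x => ρ x * (c + e * (b x - m))) := by
      intro c e
      have : (fun x => ρ x * (c + e * (b x - m))) = fun x => (c - e * m) * ρ x + e * (ρ x * b x) := by
        ext x; ring
      rw [this]; exact (hρ.const_mul _).add (hib.const_mul _)
    have hlin : ∀ c e : ℝ, ∫ x, ρ x * (c + e * (b x - m)) = c := by
      intro c e
      have : (fun x => ρ x * (c + e * (b x - m))) = fun x => (c - e * m) * ρ x + e * (ρ x * b x) := by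
        ext x; ring
      rw [this, integral_add (hρ.const_mul _) (hib.const_mul _), integral_const_mul,
        integral_const_mul, h1, ← hm]; ring
    have hF : ∀ x, 0 ≤ b x ^ a - m ^ a - a * m ^ (a - 1) * (b x - m) := by
      intro x
      have k1 := bregm ha ha2 (hb0 x) hm0
      have k2 := bregD ha ha2 (hb0 x) hm0
      by_contra hc
      push Not at hc
      have : 0 ≤ (a - 1) ^ 2 * (b x - m) ^ 2 := by positivity
      nlinarith
    have hFi : ∫ x, ρ x * (b x ^ a - m ^ a - a * m ^ (a - 1) * (b x - m)) =
        (∫ x, ρ x * b x ^ a) - m ^ a := by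
      have : (fun x => ρ x * (b x ^ a - m ^ a - a * m ^ (a - 1) * (b x - m))) =
          fun x => ρ x * b x ^ a - ρ x * (m ^ a + a * m ^ (a - 1) * (b x - m)) := by
        ext x; ring
      rw [this, integral_sub hia (hilin _ _), hlin]
    have hFint : Integrable fun x => ρ x * (b x ^ a - m ^ a - a * m ^ (a - 1) * (b x - m)) := by
      have : (fun x => ρ x * (b x ^ a - m ^ a - a * m ^ (a - 1) * (b x - m))) =
          fun x => ρ x * b x ^ a - ρ x * (m ^ a + a * m ^ (a - 1) * (b x - m)) := by
        ext x; ring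
      rw [this]; exact hia.sub (hilin _ _)
    have hX : 0 ≤ (∫ x, ρ x * b x ^ a) - m ^ a := by
      rw [← hFi]; exact integral_nonneg fun x => mul_nonneg (h0 x) (hF x)
    refine ⟨hX, ?_⟩
    rw [← mul_pow]
    refine amgm hX (by positivity) (fun l hl => ?_) ?_
    · have hpt : ∀ x, 2 * (a - 1) * (ρ x * |b x - m|) ≤
          l * (ρ x * (b x ^ a - m ^ a - a * m ^ (a - 1) * (b x - m))) +
          l⁻¹ * (ρ x * (m ^ (2 - a) + (2 - a) * m ^ (1 - a) * (b x - m))) := by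
        intro x
        have k1 := bregm ha ha2 (hb0 x) hm0
        have k2 := bregD ha ha2 (hb0 x) hm0
        have k3 := hF x
        set F := b x ^ a - m ^ a - a * m ^ (a - 1) * (b x - m)
        set D := m ^ (2 - a) + (2 - a) * m ^ (1 - a) * (b x - m)
        have : 2 * ((a - 1) * |b x - m|) ≤ l * F + l⁻¹ * D := by
          have hll : l * l⁻¹ = 1 := by field_simp
          refine abs_le_of_sq_le_sq' (a := 2 * ((a - 1) * |b x - m|)) ?_ (by positivity) |>.2
          have : (2 * ((a - 1) * |b x - m|)) ^ 2 = 4 * ((a - 1) ^ 2 * (b x - m) ^ 2) := by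
            rw [mul_pow, mul_pow, sq_abs]; ring
          rw [this]
          have : 4 * (F * D) = 4 * ((l * F) * (l⁻¹ * D)) := by
            rw [show (l * F) * (l⁻¹ * D) = (l * l⁻¹) * (F * D) by ring, hll, one_mul]
          nlinarith [sq_nonneg (l * F - l⁻¹ * D)]
        nlinarith [mul_le_mul_of_nonneg_left this (h0 x)]
      have := integral_mono (hid.const_mul (2 * (a - 1))) ((hFint.const_mul l).add
        ((hilin _ _).const_mul l⁻¹)) hpt
      simp only [Pi.add_apply] at this
      rw [integral_const_mul, integral_add (hFint.const_mul l) ((hilin _ _).const_mul l⁻¹),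
        integral_const_mul, integral_const_mul, hFi, hlin] at this
      linarith
    · have : 0 ≤ ∫ x, ρ x * |b x - m| := integral_nonneg fun x => mul_nonneg (h0 x) (abs_nonneg _)
      have : 0 ≤ a - 1 := by linarith
      positivity

/-- Gaussian density. -/
noncomputable def eg {d : ℕ} (τ : ℝ) (x : KE d) : ℝ :=
  (τ ^ ((d : ℝ) / 2))⁻¹ * Real.exp (-(π / τ) * ‖x‖ ^ 2)

theorem eg_pos {d : ℕ} {τ : ℝ} (hτ : 0 < τ) (x : KE d) : 0 < eg τ x := by unfold eg; positivity

theorem eg_measurable2 {d : ℕ} : Measurable (fun q : ℝ × KE d => eg q.1 q.2) := by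
  unfold eg; fun_prop

theorem eg_continuous {d : ℕ} (τ : ℝ) : Continuous (eg τ : KE d → ℝ) := by
  unfold eg; fun_prop

theorem eg_integral {d : ℕ} {τ : ℝ} (hτ : 0 < τ) : ∫ x : KE d, eg τ x = 1 := by
  unfold eg
  rw [integral_const_mul, GaussianFourier.integral_rexp_neg_mul_sq_norm (by positivity)]
  have : π / (π / τ) = τ := by field_simp
  rw [this]; simp
  field_simp

theorem eg_integrable {d : ℕ} {τ : ℝ} (hτ : 0 < τ) : Integrable (eg τ : KE d → ℝ) := by
  by_contra h
  have := eg_integral (d := d) hτ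
  rw [integral_undef h] at this
  norm_num at this

theorem eg_neg {d : ℕ} (τ : ℝ) (x : KE d) : eg τ (-x) = eg τ x := by simp [eg]

theorem eg_lintegral {d : ℕ} {τ : ℝ} (hτ : 0 < τ) : ∫⁻ x : KE d, ENNReal.ofReal (eg τ x) = 1 := by
  rw [← ofReal_integral_eq_lintegral_ofReal (eg_integrable hτ)
    (Filter.Eventually.of_forall fun x => (eg_pos hτ x).le), eg_integral hτ, ENNReal.ofReal_one]

theorem eg_mul {d : ℕ} {τ σ : ℝ} (hτ : 0 < τ) (hσ : 0 < σ) (x z : KE d) :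
    eg τ (x - z) * eg σ z = eg (τ + σ) x * eg (τ * σ / (τ + σ)) (z - (σ / (τ + σ)) • x) := by
  have hs : 0 < τ + σ := by positivity
  have e1 : ‖x - z‖ ^ 2 = ‖x‖ ^ 2 - 2 * inner ℝ x z + ‖z‖ ^ 2 := norm_sub_sq_real x z
  have e2 : ‖z - (σ / (τ + σ)) • x‖ ^ 2 =
      ‖z‖ ^ 2 - 2 * ((σ / (τ + σ)) * inner ℝ x z) + (σ / (τ + σ)) ^ 2 * ‖x‖ ^ 2 := by
    rw [norm_sub_sq_real, inner_smul_right, real_inner_comm, norm_smul, mul_pow, Real.norm_eq_abs,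
      sq_abs]
  unfold eg
  have hc : (τ ^ ((d : ℝ) / 2))⁻¹ * (σ ^ ((d : ℝ) / 2))⁻¹ =
      ((τ + σ) ^ ((d : ℝ) / 2))⁻¹ * ((τ * σ / (τ + σ)) ^ ((d : ℝ) / 2))⁻¹ := by
    rw [← mul_inv, ← mul_inv, ← Real.mul_rpow hτ.le hσ.le, ← Real.mul_rpow hs.le (by positivity)]
    have : τ * σ = (τ + σ) * (τ * σ / (τ + σ)) := by field_simp
    rw [← this]
  have he : Real.exp (-(π / τ) * ‖x - z‖ ^ 2) * Real.exp (-(π / σ) * ‖z‖ ^ 2) =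
      Real.exp (-(π / (τ + σ)) * ‖x‖ ^ 2) *
      Real.exp (-(π / (τ * σ / (τ + σ))) * ‖z - (σ / (τ + σ)) • x‖ ^ 2) := by
    rw [← Real.exp_add, ← Real.exp_add, e1, e2]
    congr 1
    field_simp
    ring
  calc _ = ((τ ^ ((d : ℝ) / 2))⁻¹ * (σ ^ ((d : ℝ) / 2))⁻¹) *
        (Real.exp (-(π / τ) * ‖x - z‖ ^ 2) * Real.exp (-(π / σ) * ‖z‖ ^ 2)) := by ring
    _ = _ := by rw [hc, he]; ring

theorem eg_conv {d : ℕ} {τ σ : ℝ} (hτ : 0 < τ) (hσ : 0 < σ) (x : KE d) :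
    ∫⁻ z, ENNReal.ofReal (eg τ (x - z)) * ENNReal.ofReal (eg σ z) = ENNReal.ofReal (eg (τ + σ) x) := by
  have hs : 0 < τ + σ := by positivity
  simp_rw [← ENNReal.ofReal_mul (eg_pos hτ _).le, eg_mul hτ hσ,
    ENNReal.ofReal_mul (eg_pos hs _).le]
  rw [lintegral_const_mul' _ _ ENNReal.ofReal_ne_top,
    lintegral_sub_right_eq_self (fun z => ENNReal.ofReal (eg (τ * σ / (τ + σ)) z)),
    eg_lintegral (by positivity), mul_one]

theorem eg_double {d : ℕ} {τ : ℝ} (hτ : 0 < τ) (x : KE d) :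
    eg τ x ≤ 2 ^ ((d : ℝ) / 2) * eg (2 * τ) x := by
  unfold eg
  rw [Real.mul_rpow (by norm_num) hτ.le, mul_inv, ← mul_assoc, ← mul_assoc,
    mul_inv_cancel₀ (by positivity), one_mul]
  gcongr
  linarith

theorem eg_scale {d : ℕ} {τ σ : ℝ} (hτ : 0 < τ) (hσ : 0 < σ) (x : KE d) :
    eg (τ * σ ^ 2) x = (σ ^ d)⁻¹ * eg τ (σ⁻¹ • x) := by
  unfold eg
  rw [Real.mul_rpow hτ.le (by positivity), ← Real.rpow_natCast_mul hσ.le, norm_smul, mul_pow]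
  have : ((2 : ℕ) : ℝ) * ((d : ℝ) / 2) = d := by push_cast; ring
  rw [this, Real.rpow_natCast, mul_inv, Real.norm_of_nonneg (by positivity)]
  have : -(π / (τ * σ ^ 2)) * ‖x‖ ^ 2 = -(π / τ) * (σ⁻¹ ^ 2 * ‖x‖ ^ 2) := by
    field_simp
  rw [this]; ring

theorem eg_decay {d : ℕ} {τ : ℝ} (hτ : 0 < τ) (N : ℕ) :
    ∃ C : ℝ, 0 < C ∧ ∀ x : KE d, eg τ x ≤ C * ((1 + ‖x‖) ^ N)⁻¹ := by
  have h : Filter.Tendsto (fun r : ℝ => (1 + r) ^ N * Real.exp (-r)) Filter.atTop (nhds 0) := by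
    have := (Real.tendsto_pow_mul_exp_neg_atTop_nhds_zero N).comp
      (Filter.tendsto_atTop_add_const_left Filter.atTop (1 : ℝ) Filter.tendsto_id)
    have h2 := this.mul_const (Real.exp 1)
    rw [zero_mul] at h2
    refine h2.congr fun r => ?_
    simp only [Function.comp, id]
    rw [mul_assoc, ← Real.exp_add]; congr 2; ring
  -- bound on (1+r)^N exp(-(π/τ) r^2)
  have hcont : Continuous fun r : ℝ => (1 + r) ^ N * Real.exp (-r) := by fun_prop
  obtain ⟨C0, hC0⟩ : ∃ C0, ∀ r : ℝ, 0 ≤ r → (1 + r) ^ N * Real.exp (-r) ≤ C0 := by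
    obtain ⟨R, hR⟩ := Filter.eventually_atTop.1 (h.eventually (gt_mem_nhds one_pos))
    obtain ⟨C1, hC1⟩ := (isCompact_Icc (a := 0) (b := R)).bddAbove_image hcont.continuousOn
    refine ⟨max C1 1, fun r hr => ?_⟩
    by_cases hrR : r ≤ R
    · exact (hC1 ⟨r, ⟨hr, hrR⟩, rfl⟩).trans (le_max_left _ _)
    · exact (hR r (by linarith)).le.trans (le_max_right _ _)
  have hC0p : 0 < C0 := by
    have := hC0 0 le_rfl; simp at this; linarith
  refine ⟨(τ ^ ((d : ℝ) / 2))⁻¹ * (C0 * Real.exp (τ / (4 * π))), by positivity, fun x => ?_⟩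
  unfold eg
  rw [mul_assoc]
  gcongr
  have h1 := hC0 ‖x‖ (norm_nonneg x)
  have h2 : Real.exp (-(π / τ) * ‖x‖ ^ 2) ≤ Real.exp (-‖x‖) * Real.exp (τ / (4 * π)) := by
    rw [← Real.exp_add]
    apply Real.exp_le_exp.2
    have : π / τ * ‖x‖ ^ 2 - ‖x‖ + τ / (4 * π) = π / τ * (‖x‖ - τ / (2 * π)) ^ 2 := by
      field_simp; ring
    have h3 : 0 ≤ π / τ * (‖x‖ - τ / (2 * π)) ^ 2 := by positivity
    linarith
  have hp : 0 < (1 + ‖x‖) ^ N := by positivity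
  rw [← div_eq_mul_inv, le_div_iff₀ hp]
  calc Real.exp (-(π / τ) * ‖x‖ ^ 2) * (1 + ‖x‖) ^ N
      ≤ (Real.exp (-‖x‖) * Real.exp (τ / (4 * π))) * (1 + ‖x‖) ^ N := by gcongr
    _ = ((1 + ‖x‖) ^ N * Real.exp (-‖x‖)) * Real.exp (τ / (4 * π)) := by ring
    _ ≤ _ := by gcongr

end KP

namespace KP

/-- If all sums over translates by multiples of `L` are at most `S`, then so is the mean integral. -/
theorem lintegral_le_of_shift {F : ℝ → ℝ≥0∞} (hF : Measurable F) {L : ℝ} (hL : 0 < L) {S : ℝ≥0∞}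
    (h : ∀ (n : ℕ) (θ : ℝ), ∑ j ∈ Finset.range n, F (θ + j * L) ≤ S) :
    ∫⁻ θ, F θ ≤ ENNReal.ofReal L * S := by
  have h1 : ∀ (n : ℕ) (c : ℝ), ∫⁻ θ in Set.Ioc c (c + n * L), F θ =
      ∫⁻ θ in Set.Ioc 0 L, ∑ j ∈ Finset.range n, F ((θ + c) + j * L) := by
    intro n c
    induction n with
    | zero => simp
    | succ n ih =>
      have hu : Set.Ioc c (c + (n + 1 : ℕ) * L) =
          Set.Ioc c (c + n * L) ∪ Set.Ioc (c + n * L) (c + (n + 1 : ℕ) * L) := by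
        rw [Set.Ioc_union_Ioc_eq_Ioc]
        · have : 0 ≤ (n : ℝ) * L := by positivity
          linarith
        · push_cast; linarith
      rw [hu, lintegral_union measurableSet_Ioc (by
        rw [Set.disjoint_left]; rintro x ⟨_, h1⟩ ⟨h2, _⟩; linarith), ih]
      simp_rw [Finset.sum_range_succ]
      rw [lintegral_add_right _ (by fun_prop)]
      congr 1
      rw [← lintegral_indicator measurableSet_Ioc, ← lintegral_indicator measurableSet_Ioc,
        ← lintegral_add_right_eq_self _ (c + n * L)]
      refine lintegral_congr fun θ => ?_
      unfold Set.indicator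
      have : (θ + (c + n * L) ∈ Set.Ioc (c + n * L) (c + (n + 1 : ℕ) * L)) ↔ θ ∈ Set.Ioc 0 L := by
        simp only [Set.mem_Ioc]; push_cast
        constructor <;> rintro ⟨a, b⟩ <;> constructor <;> linarith
      simp only [this, add_assoc]
  have h2 : ∀ N : ℕ, ∫⁻ θ in Set.Ioc (-(N * L)) (N * L), F θ ≤ ENNReal.ofReal L * S := by
    intro N
    have := h1 (2 * N) (-(N * L))
    rw [show -(N * L) + ((2 * N : ℕ) : ℝ) * L = N * L by push_cast; ring] at this
    rw [this]
    calc _ ≤ ∫⁻ θ in Set.Ioc 0 L, S := by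
          exact lintegral_mono fun θ => h _ _
      _ = _ := by rw [setLIntegral_const, Real.volume_Ioc, sub_zero, mul_comm]
  have hmono : Monotone fun N : ℕ => Set.Ioc (-((N : ℝ) * L)) (N * L) := by
    intro m n hmn
    have : (m : ℝ) * L ≤ n * L := by gcongr
    exact Set.Ioc_subset_Ioc (by linarith) this
  have hU : ⋃ N : ℕ, Set.Ioc (-((N : ℝ) * L)) (N * L) = Set.univ := by
    ext x
    simp only [Set.mem_iUnion, Set.mem_univ, iff_true, Set.mem_Ioc]
    obtain ⟨n, hn⟩ := exists_nat_gt (|x| / L)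
    rw [div_lt_iff₀ hL] at hn
    exact ⟨n, by linarith [neg_abs_le x], by linarith [le_abs_self x]⟩
  rw [← setLIntegral_univ, ← hU, setLIntegral_iUnion_of_directed _ hmono.directed_le]
  exact iSup_le h2

/-- Heat extension. -/
noncomputable def hR {d : ℕ} (g : KE d → ℝ) (τ : ℝ) (x : KE d) : ℝ := ∫ z, eg τ z * g (x - z)

section
variable {d : ℕ} {g : KE d → ℝ} (hg : Measurable g) (h0 : ∀ x, 0 ≤ g x) {B : ℝ} (hB : ∀ x, g x ≤ B)

theorem hR_meas (hg : Measurable g) : Measurable fun q : ℝ × KE d => hR g q.1 q.2 := by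
  refine StronglyMeasurable.measurable ?_
  refine StronglyMeasurable.integral_prod_right (f := fun (q : ℝ × KE d) z => eg q.1 z * g (q.2 - z)) ?_
  refine Measurable.stronglyMeasurable ?_
  refine Measurable.mul ?_ ?_
  · exact eg_measurable2.comp (f := fun q : (ℝ × KE d) × KE d => (q.1.1, q.2)) (by fun_prop)
  · exact hg.comp (by fun_prop)

theorem hR_int (hg : Measurable g) (h0 : ∀ x, 0 ≤ g x) (hB : ∀ x, g x ≤ B) {τ : ℝ} (hτ : 0 < τ)
    (x : KE d) : Integrable fun z => eg τ z * g (x - z) :=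
  (eg_integrable hτ).mul_bdd (c := B) (hg.comp (by fun_prop)).aestronglyMeasurable
    (Filter.Eventually.of_forall fun z => by rw [Real.norm_of_nonneg (h0 _)]; exact hB _)

theorem hR_nonneg (h0 : ∀ x, 0 ≤ g x) {τ : ℝ} (hτ : 0 < τ) (x : KE d) : 0 ≤ hR g τ x :=
  integral_nonneg fun z => mul_nonneg (eg_pos hτ z).le (h0 _)

theorem hR_le (hg : Measurable g) (h0 : ∀ x, 0 ≤ g x) (hB : ∀ x, g x ≤ B) {τ : ℝ} (hτ : 0 < τ)
    (x : KE d) : hR g τ x ≤ B := by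
  calc hR g τ x ≤ ∫ z : KE d, eg τ z * B :=
        integral_mono (hR_int hg h0 hB hτ x) ((eg_integrable hτ).mul_const B) fun z =>
          mul_le_mul_of_nonneg_left (hB _) (eg_pos hτ z).le
    _ = B := by rw [integral_mul_const, eg_integral hτ, one_mul]

theorem hR_ofReal (hg : Measurable g) (h0 : ∀ x, 0 ≤ g x) (hB : ∀ x, g x ≤ B) {τ : ℝ} (hτ : 0 < τ)
    (x : KE d) : ENNReal.ofReal (hR g τ x) =
      ∫⁻ z, ENNReal.ofReal (eg τ z) * ENNReal.ofReal (g (x - z)) := by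
  unfold hR
  rw [ofReal_integral_eq_lintegral_ofReal (hR_int hg h0 hB hτ x)
    (Filter.Eventually.of_forall fun z => mul_nonneg (eg_pos hτ z).le (h0 _))]
  simp_rw [ENNReal.ofReal_mul (eg_pos hτ _).le]

theorem hR_ofReal' (hg : Measurable g) (h0 : ∀ x, 0 ≤ g x) (hB : ∀ x, g x ≤ B) {τ : ℝ} (hτ : 0 < τ)
    (x : KE d) : ENNReal.ofReal (hR g τ x) =
      ∫⁻ z, ENNReal.ofReal (eg τ (x - z)) * ENNReal.ofReal (g z) := by
  rw [hR_ofReal hg h0 hB hτ]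
  rw [← lintegral_sub_left_eq_self _ x]
  simp

theorem hR_x_meas (hg : Measurable g) (τ : ℝ) : Measurable (hR g τ) :=
  (hR_meas hg).comp (f := fun x : KE d => (τ, x)) (by fun_prop)

theorem hR_semi (hg : Measurable g) (h0 : ∀ x, 0 ≤ g x) (hB : ∀ x, g x ≤ B) {τ σ : ℝ} (hτ : 0 < τ)
    (hσ : 0 < σ) (x : KE d) : hR (hR g τ) σ x = hR g (τ + σ) x := by
  have hm := hR_x_meas hg τ
  have n0 := fun x => hR_nonneg h0 hτ x
  have nB := fun x => hR_le hg h0 hB hτ x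
  have hs : 0 < τ + σ := by positivity
  have em : ∀ τ, Measurable (fun z : KE d => eg τ z) := fun τ => (eg_continuous τ).measurable
  rw [← ENNReal.ofReal_eq_ofReal_iff (hR_nonneg n0 hσ x) (hR_nonneg h0 hs x)]
  rw [hR_ofReal hm n0 nB hσ, hR_ofReal' hg h0 hB hs]
  simp_rw [hR_ofReal' hg h0 hB hτ]
  calc _ = ∫⁻ z, ∫⁻ w, ENNReal.ofReal (eg σ z) *
        (ENNReal.ofReal (eg τ (x - z - w)) * ENNReal.ofReal (g w)) := by
        refine lintegral_congr fun z => ?_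
        rw [lintegral_const_mul' _ _ ENNReal.ofReal_ne_top]
    _ = ∫⁻ w, ∫⁻ z, ENNReal.ofReal (eg σ z) *
        (ENNReal.ofReal (eg τ (x - z - w)) * ENNReal.ofReal (g w)) := by
        refine lintegral_lintegral_swap (Measurable.aemeasurable ?_)
        have m1 : Measurable fun q : KE d × KE d => ENNReal.ofReal (eg σ q.1) :=
          ((em σ).comp measurable_fst).ennreal_ofReal
        have m2 : Measurable fun q : KE d × KE d => ENNReal.ofReal (eg τ (x - q.1 - q.2)) :=
          ((em τ).comp (by fun_prop)).ennreal_ofReal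
        have m3 : Measurable fun q : KE d × KE d => ENNReal.ofReal (g q.2) :=
          (hg.comp measurable_snd).ennreal_ofReal
        exact m1.mul (m2.mul m3)
    _ = _ := by
        refine lintegral_congr fun w => ?_
        rw [← eg_conv hτ hσ (x - w), ← lintegral_mul_const' _ _ ENNReal.ofReal_ne_top]
        refine lintegral_congr fun z => ?_
        rw [show x - z - w = x - w - z by abel]; ring

theorem pow_bd (h0 : ∀ x, 0 ≤ g x) (hB : ∀ x, g x ≤ B) {a : ℝ} (ha : 1 < a) (x : KE d) :
    g x ^ a ≤ B ^ a := Real.rpow_le_rpow (h0 x) (hB x) (by linarith)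

theorem hR_mass (hg : Measurable g) (h0 : ∀ x, 0 ≤ g x) (hB : ∀ x, g x ≤ B) {τ : ℝ} (hτ : 0 < τ) :
    ∫⁻ x, ENNReal.ofReal (hR g τ x) = ∫⁻ x, ENNReal.ofReal (g x) := by
  simp_rw [hR_ofReal hg h0 hB hτ]
  have em : ∀ τ, Measurable (fun z : KE d => eg τ z) := fun τ => (eg_continuous τ).measurable
  rw [lintegral_lintegral_swap (Measurable.aemeasurable (by
    have m1 : Measurable fun q : KE d × KE d => ENNReal.ofReal (eg τ q.2) :=
      ((em τ).comp measurable_snd).ennreal_ofReal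
    have m3 : Measurable fun q : KE d × KE d => ENNReal.ofReal (g (q.1 - q.2)) :=
      (hg.comp (by fun_prop)).ennreal_ofReal
    exact m1.mul m3))]
  have : ∀ z : KE d, ∫⁻ x, ENNReal.ofReal (eg τ z) * ENNReal.ofReal (g (x - z)) =
      ENNReal.ofReal (eg τ z) * ∫⁻ x, ENNReal.ofReal (g x) := by
    intro z
    rw [lintegral_const_mul' _ _ ENNReal.ofReal_ne_top,
      lintegral_sub_right_eq_self (fun x => ENNReal.ofReal (g x))]
  simp_rw [this]
  rw [lintegral_mul_const _ (em τ).ennreal_ofReal, eg_lintegral hτ, one_mul]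

/-- the energy density -/
noncomputable def En (g : KE d → ℝ) (a : ℝ) (τ : ℝ) (x : KE d) : ℝ :=
  hR (fun y => hR g τ y ^ a) (2 * τ) x - hR g (3 * τ) x ^ a

theorem En_meas (hg : Measurable g) (a : ℝ) : Measurable fun q : ℝ × KE d => En g a q.1 q.2 := by
  unfold En
  refine Measurable.sub ?_ ?_
  · refine StronglyMeasurable.measurable ?_
    refine StronglyMeasurable.integral_prod_right
      (f := fun (q : ℝ × KE d) z => eg (2 * q.1) z * hR g q.1 (q.2 - z) ^ a) ?_
    refine Measurable.stronglyMeasurable ?_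
    refine Measurable.mul ?_ (Measurable.pow_const ?_ _)
    · exact eg_measurable2.comp (f := fun q : (ℝ × KE d) × KE d => (2 * q.1.1, q.2)) (by fun_prop)
    · exact (hR_meas hg).comp (f := fun q : (ℝ × KE d) × KE d => (q.1.1, q.1.2 - q.2)) (by fun_prop)
  · refine Measurable.pow_const ?_ _
    exact (hR_meas hg).comp (f := fun q : ℝ × KE d => (3 * q.1, q.2)) (by fun_prop)

theorem En_bd (hg : Measurable g) (h0 : ∀ x, 0 ≤ g x) (hB : ∀ x, g x ≤ B) {a : ℝ} (ha : 1 < a)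
    (ha2 : a ≤ 2) {τ : ℝ} (hτ : 0 < τ) (x : KE d) :
    0 ≤ En g a τ x ∧ (a - 1) ^ 2 * (hR g (2 * τ) x - hR g (3 * τ) x) ^ 2 ≤
      2 ^ (d : ℝ) * (En g a τ x * hR g (3 * τ) x ^ (2 - a)) := by
  have h2τ : 0 < 2 * τ := by positivity
  have hm := hR_x_meas hg τ
  have n0 := fun x => hR_nonneg h0 hτ x
  have nB := fun x => hR_le hg h0 hB hτ x
  have hb : Measurable fun z => hR g τ (x - z) := hm.comp (by fun_prop)
  have key := jens (eg_integrable h2τ) (fun z => (eg_pos h2τ z).le) (eg_integral h2τ)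
    hb (fun z => n0 (x - z)) (fun z => nB (x - z)) ha ha2
  have e3 : ∫ z, eg (2 * τ) z * hR g τ (x - z) = hR g (3 * τ) x := by
    rw [show 3 * τ = τ + 2 * τ by ring, ← hR_semi hg h0 hB hτ h2τ]; rfl
  rw [e3] at key
  refine ⟨key.1, ?_⟩
  have hd : |hR g (2 * τ) x - hR g (3 * τ) x| ≤
      2 ^ ((d : ℝ) / 2) * ∫ z, eg (2 * τ) z * |hR g τ (x - z) - hR g (3 * τ) x| := by
    have e2 : hR g (2 * τ) x - hR g (3 * τ) x =
        ∫ z, eg τ z * (hR g τ (x - z) - hR g (3 * τ) x) := by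
      simp_rw [mul_sub]
      rw [integral_sub (hR_int hm n0 nB hτ x) ((eg_integrable hτ).mul_const _),
        integral_mul_const, eg_integral hτ, one_mul,
        show 2 * τ = τ + τ by ring, ← hR_semi hg h0 hB hτ hτ]; rfl
    rw [e2, ← integral_const_mul]
    refine (abs_integral_le_integral_abs).trans ?_
    have hi : ∀ σ : ℝ, 0 < σ → Integrable fun z => eg σ z * |hR g τ (x - z) - hR g (3 * τ) x| := by
      intro σ hσ
      refine (eg_integrable hσ).mul_bdd (c := B + hR g (3 * τ) x)
        (hb.sub_const _).abs.aestronglyMeasurable (Filter.Eventually.of_forall fun z => ?_)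
      have h3 := hR_nonneg h0 (by positivity : 0 < 3 * τ) x
      have := n0 (x - z); have := nB (x - z)
      rw [Real.norm_of_nonneg (abs_nonneg _), abs_le]; constructor <;> linarith
    refine integral_mono ?_ ((hi _ h2τ).const_mul _) fun z => ?_
    · refine (hi _ hτ).congr (Filter.Eventually.of_forall fun z => ?_)
      simp only [abs_mul, abs_of_pos (eg_pos hτ z)]
    · simp only [abs_mul, abs_of_pos (eg_pos hτ z)]
      rw [← mul_assoc]
      exact mul_le_mul_of_nonneg_right (eg_double hτ z) (abs_nonneg _)
  have hE : En g a τ x = (∫ z, eg (2 * τ) z * hR g τ (x - z) ^ a) - hR g (3 * τ) x ^ a := rfl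
  rw [← hE] at key
  set T := ∫ z, eg (2 * τ) z * |hR g τ (x - z) - hR g (3 * τ) x|
  calc (a - 1) ^ 2 * (hR g (2 * τ) x - hR g (3 * τ) x) ^ 2
      = (a - 1) ^ 2 * |hR g (2 * τ) x - hR g (3 * τ) x| ^ 2 := by rw [sq_abs]
    _ ≤ (a - 1) ^ 2 * (2 ^ ((d : ℝ) / 2) * T) ^ 2 := by gcongr
    _ = 2 ^ (d : ℝ) * ((a - 1) ^ 2 * T ^ 2) := by
        have : (2 : ℝ) ^ (d : ℝ) = (2 ^ ((d : ℝ) / 2)) ^ 2 := by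
          rw [← Real.rpow_mul_natCast (by norm_num)]; congr 1; push_cast; ring
        rw [this]; ring
    _ ≤ _ := by
        refine mul_le_mul_of_nonneg_left key.2 (by positivity)

theorem hR_jens (hg : Measurable g) (h0 : ∀ x, 0 ≤ g x) (hB : ∀ x, g x ≤ B) {a : ℝ} (ha : 1 < a)
    (ha2 : a ≤ 2) {τ : ℝ} (hτ : 0 < τ) :
    ∫⁻ x, ENNReal.ofReal (hR g τ x ^ a) ≤ ∫⁻ x, ENNReal.ofReal (g x ^ a) := by
  rw [← hR_mass (hg.pow_const a) (fun x => Real.rpow_nonneg (h0 x) a)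
    (fun x => pow_bd h0 hB ha x) hτ]
  refine lintegral_mono fun x => ENNReal.ofReal_le_ofReal ?_
  have key := (jens (eg_integrable hτ) (fun z => (eg_pos hτ z).le) (eg_integral hτ)
    (b := fun z => g (x - z)) (hg.comp (by fun_prop)) (fun z => h0 (x - z)) (fun z => hB (x - z)) ha ha2).1
  exact sub_nonneg.1 key

theorem En_step (hg : Measurable g) (h0 : ∀ x, 0 ≤ g x) (hB : ∀ x, g x ≤ B) {a : ℝ} (ha : 1 < a)
    (ha2 : a ≤ 2) {τ : ℝ} (hτ : 0 < τ) :
    (∫⁻ x, ENNReal.ofReal (En g a τ x)) + ∫⁻ x, ENNReal.ofReal (hR g (3 * τ) x ^ a) =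
      ∫⁻ x, ENNReal.ofReal (hR g τ x ^ a) := by
  have h2τ : 0 < 2 * τ := by positivity
  have hm := hR_x_meas hg τ
  have n0 := fun x => hR_nonneg h0 hτ x
  have nB := fun x => hR_le hg h0 hB hτ x
  rw [← hR_mass (hm.pow_const a) (fun x => Real.rpow_nonneg (n0 x) a)
    (fun x => pow_bd n0 nB ha x) h2τ]
  rw [← lintegral_add_right _ ((hR_x_meas hg (3 * τ)).pow_const a).ennreal_ofReal]
  refine lintegral_congr fun x => ?_
  rw [← ENNReal.ofReal_add (En_bd hg h0 hB ha ha2 hτ x).1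
    (Real.rpow_nonneg (hR_nonneg h0 (by positivity) x) a)]
  unfold En; congr 1; ring

theorem En_total (hg : Measurable g) (h0 : ∀ x, 0 ≤ g x) (hB : ∀ x, g x ≤ B) {a : ℝ} (ha : 1 < a)
    (ha2 : a ≤ 2) :
    ∫⁻ θ : ℝ, ∫⁻ x, ENNReal.ofReal (En g a (Real.exp θ ^ 2) x) ≤
      ENNReal.ofReal (Real.log 3 / 2) * ∫⁻ x, ENNReal.ofReal (g x ^ a) := by
  have hl3 : 0 < Real.log 3 := Real.log_pos (by norm_num)
  refine lintegral_le_of_shift ?_ (by positivity) ?_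
  · refine Measurable.lintegral_prod_right' (f := fun q : ℝ × KE d => ENNReal.ofReal (En g a (Real.exp q.1 ^ 2) q.2)) ?_
    exact ((En_meas hg a).comp (f := fun q : ℝ × KE d => (Real.exp q.1 ^ 2, q.2)) (by fun_prop)).ennreal_ofReal
  · have hs : ∀ (θ : ℝ) (n : ℕ), Real.exp (θ + n * (Real.log 3 / 2)) ^ 2 = 3 ^ n * Real.exp θ ^ 2 := by
      intro θ n
      have h3 : (3 : ℝ) ^ n = Real.exp (n * Real.log 3) := by
        rw [Real.exp_nat_mul, Real.exp_log (by norm_num)]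
      rw [h3, ← Real.exp_nat_mul, ← Real.exp_nat_mul, ← Real.exp_add]
      congr 1; push_cast; ring
    intro n θ
    suffices h : ∑ j ∈ Finset.range n, (∫⁻ x, ENNReal.ofReal
        (En g a (Real.exp (θ + j * (Real.log 3 / 2)) ^ 2) x)) +
        ∫⁻ x, ENNReal.ofReal (hR g (3 ^ n * Real.exp θ ^ 2) x ^ a) ≤
        ∫⁻ x, ENNReal.ofReal (g x ^ a) from le_self_add.trans h
    induction n with
    | zero => simpa using hR_jens hg h0 hB ha ha2 (by positivity : 0 < Real.exp θ ^ 2)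
    | succ n ih =>
      rw [Finset.sum_range_succ, add_assoc, hs θ n, pow_succ' (3 : ℝ) n, mul_assoc (3 : ℝ),
        En_step hg h0 hB ha ha2 (by positivity)]
      exact ih
end

end KP

namespace KP

theorem cs {α : Type*} [MeasurableSpace α] {μ : Measure α} {f g : α → ℝ≥0∞} (hf : AEMeasurable f μ)
    (hg : AEMeasurable g μ) :
    (∫⁻ x, f x * g x ∂μ) ^ 2 ≤ (∫⁻ x, f x ^ 2 ∂μ) * ∫⁻ x, g x ^ 2 ∂μ := by
  have h := ENNReal.lintegral_mul_le_Lp_mul_Lq μ (p := 2) (q := 2)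
    (by constructor <;> norm_num) hf hg
  simp only [Pi.mul_apply] at h
  have e : ∀ x : ℝ≥0∞, (x ^ (1 / 2 : ℝ)) ^ 2 = x := fun x => by
    rw [← ENNReal.rpow_natCast, ← ENNReal.rpow_mul]; norm_num
  have e2 : ∀ x : ℝ≥0∞, x ^ (2 : ℝ) = x ^ 2 := fun x => by
    rw [← ENNReal.rpow_natCast]; norm_num
  calc _ ≤ _ := pow_le_pow_left' h 2
    _ = _ := by rw [mul_pow, e, e]; simp_rw [e2]

theorem le_mul_HI {d : ℕ} {h : KE d → ℝ≥0∞} {t : ℝ} {y : KE d} {X c : ℝ≥0∞} (ht : 0 < t) (hc : c ≠ ∞)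
    (H : ∀ x ∈ Metric.ball y t, X ≤ c * h x) : X ≤ c * HI h t y := by
  rcases eq_or_ne c 0 with rfl | hc0
  · simpa using H y (Metric.mem_ball_self ht)
  · rw [mul_comm, ← ENNReal.div_le_iff_le_mul (Or.inl hc0) (Or.inl hc)]
    refine le_iInf₂ fun x hx => ?_
    rw [ENNReal.div_le_iff_le_mul (Or.inl hc0) (Or.inl hc), mul_comm]
    exact H x hx

/-- Rapidly decaying kernels. -/
def Decay {d : ℕ} (k : KE d → ℂ) : Prop :=
  Continuous k ∧ ∃ C : ℝ, 0 < C ∧ ∀ x, ‖k x‖ ≤ C * ((1 + ‖x‖) ^ (2 * d + 2))⁻¹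

/-- Kernels with cancellation. -/
def Canc {d : ℕ} (k : KE d → ℂ) : Prop :=
  Decay k ∧ ∃ k' : KE d → ℂ, Decay k' ∧
    ∀ x, k x = ∫ z, k' (x - z) * ((eg 2 z - eg 3 z : ℝ) : ℂ)

/-- Rescaled kernel. -/
noncomputable def ks {d : ℕ} (k : KE d → ℂ) (t : ℝ) (x : KE d) : ℂ :=
  (((t ^ d)⁻¹ : ℝ) : ℂ) * k (t⁻¹ • x)

/-- The operator with kernel `k` at scale `t`. -/
noncomputable def opK {d : ℕ} (k : KE d → ℂ) (t : ℝ) (g : KE d → ℂ) (y : KE d) : ℂ :=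
  ∫ x, ks k t (y - x) * g x

section
variable {d : ℕ} {k : KE d → ℂ}

theorem ks_meas (hk : Continuous k) : Measurable fun q : ℝ × KE d => ks k q.1 q.2 := by
  unfold ks
  have h1 : Measurable fun q : ℝ × KE d => k (q.1⁻¹ • q.2) := hk.measurable.comp (by fun_prop)
  have h2 : Measurable fun q : ℝ × KE d => (((q.1 ^ d)⁻¹ : ℝ) : ℂ) := by fun_prop
  exact h2.mul h1

theorem ks_meas1 (hk : Continuous k) (t : ℝ) : Measurable fun x => ks k t x :=
  (ks_meas hk).comp (f := fun x : KE d => (t, x)) (by fun_prop)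

theorem kb_meas : Measurable fun q : ℝ × KE d => kb q.1 q.2 := by
  unfold kb; fun_prop

theorem kb_meas1 (t : ℝ) : Measurable fun x : KE d => kb t x := by
  unfold kb; fun_prop

theorem kb_mass : ∃ C : ℝ, 0 < C ∧ ∀ t : ℝ, 0 < t → ∀ y : KE d,
    ∫⁻ z, ENNReal.ofReal (kb t (y - z)) ≤ ENNReal.ofReal C := by
  obtain ⟨C, hC, h⟩ := kb_dom (d := d)
  refine ⟨C, hC, fun t ht y => ?_⟩
  have := h (fun _ => 1) measurable_const t ht y y (Metric.mem_ball_self ht)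
  simp only [mul_one] at this
  refine this.trans ?_
  have h1 : MF (fun _ : KE d => (1 : ℝ≥0∞)) y ≤ 1 := by
    refine (MF_le_essSup _ _).trans ?_
    rw [essSup_const']
  calc _ ≤ ENNReal.ofReal C * 1 := mul_le_mul' le_rfl h1
    _ = _ := mul_one _

theorem ks_bd (hk : Decay k) : ∃ C : ℝ, 0 < C ∧ ∀ t : ℝ, 0 < t → ∀ x : KE d,
    ‖ks k t x‖ ≤ C * (kb t x * ((1 + ‖x‖ / t) ^ (d + 1))⁻¹) := by
  obtain ⟨hc, C, hC, h⟩ := hk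
  refine ⟨C, hC, fun t ht x => ?_⟩
  unfold ks kb
  rw [norm_mul, Complex.norm_real, Real.norm_of_nonneg (by positivity)]
  have := h (t⁻¹ • x)
  rw [norm_smul, Real.norm_of_nonneg (by positivity)] at this
  calc _ ≤ (t ^ d)⁻¹ * (C * ((1 + t⁻¹ * ‖x‖) ^ (2 * d + 2))⁻¹) := by gcongr
    _ = _ := by
      rw [show 2 * d + 2 = (d + 1) + (d + 1) by ring, pow_add, mul_inv, inv_mul_eq_div]; ring

theorem ks_bd1 (hk : Decay k) : ∃ C : ℝ, 0 < C ∧ ∀ t : ℝ, 0 < t → ∀ x : KE d,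
    ‖ks k t x‖ ≤ C * kb t x := by
  obtain ⟨C, hC, h⟩ := ks_bd hk
  refine ⟨C, hC, fun t ht x => (h t ht x).trans ?_⟩
  gcongr
  refine mul_le_of_le_one_right (kb_nonneg ht x) (inv_le_one_of_one_le₀ (one_le_pow₀ ?_))
  have : 0 ≤ ‖x‖ / t := by positivity
  linarith

theorem ks_mass (hk : Decay k) : ∃ C : ℝ, 0 < C ∧ ∀ t : ℝ, 0 < t → ∀ y : KE d,
    ∫⁻ z, ‖ks k t (y - z)‖ₑ ≤ ENNReal.ofReal C := by
  obtain ⟨C, hC, h⟩ := ks_bd1 hk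
  obtain ⟨C', hC', h'⟩ := kb_mass (d := d)
  refine ⟨C * C', by positivity, fun t ht y => ?_⟩
  calc ∫⁻ z, ‖ks k t (y - z)‖ₑ ≤ ∫⁻ z, ENNReal.ofReal C * ENNReal.ofReal (kb t (y - z)) := by
        refine lintegral_mono fun z => ?_
        rw [← ofReal_norm, ← ENNReal.ofReal_mul hC.le]
        exact ENNReal.ofReal_le_ofReal (h t ht _)
    _ ≤ _ := by
        rw [lintegral_const_mul' _ _ ENNReal.ofReal_ne_top, ENNReal.ofReal_mul hC.le]
        exact mul_le_mul' le_rfl (h' t ht y)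

theorem ks_mass' (hk : Decay k) : ∃ C : ℝ, 0 < C ∧ ∀ t : ℝ, 0 < t → ∀ x : KE d,
    ∫⁻ y, ‖ks k t (y - x)‖ₑ ≤ ENNReal.ofReal C := by
  obtain ⟨C, hC, h⟩ := ks_mass hk
  refine ⟨C, hC, fun t ht x => ?_⟩
  rw [lintegral_sub_right_eq_self (fun y => ‖ks k t y‖ₑ)]
  have := h t ht 0
  rw [lintegral_sub_left_eq_self (fun y => ‖ks k t y‖ₑ) 0] at this
  exact this

theorem ks_integrable (hk : Decay k) {t : ℝ} (ht : 0 < t) : Integrable (ks k t) := by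
  refine ⟨(ks_meas1 hk.1 t).aestronglyMeasurable, ?_⟩
  obtain ⟨C, hC, h⟩ := ks_mass' hk
  have := h t ht 0
  simp only [sub_zero] at this
  exact this.trans_lt ENNReal.ofReal_lt_top

theorem ks_canc (hk : Continuous k) {k' : KE d → ℂ}
    (h : ∀ x, k x = ∫ z, k' (x - z) * ((eg 2 z - eg 3 z : ℝ) : ℂ)) {t : ℝ} (ht : 0 < t) (x : KE d) :
    ks k t x = ∫ z, ks k' t (x - z) * ((eg (2 * t ^ 2) z - eg (3 * t ^ 2) z : ℝ) : ℂ) := by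
  unfold ks
  rw [h, eq_comm]
  have e := Measure.integral_comp_inv_smul_of_nonneg (volume : Measure (KE d))
    (fun z => k' (t⁻¹ • x - z) * ((eg 2 z - eg 3 z : ℝ) : ℂ)) ht.le
  simp only [finrank_euclideanSpace, Fintype.card_fin] at e
  rw [← integral_const_mul]
  rw [Complex.real_smul] at e
  have htd : ((t : ℂ) ^ d) ≠ 0 := by
    exact_mod_cast (pow_pos ht d).ne'
  have : (fun z => (((t ^ d)⁻¹ : ℝ) : ℂ) * k' (t⁻¹ • (x - z)) *
      ((eg (2 * t ^ 2) z - eg (3 * t ^ 2) z : ℝ) : ℂ)) =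
      fun z => ((((t ^ d)⁻¹ : ℝ) : ℂ) * (((t ^ d)⁻¹ : ℝ) : ℂ)) *
      (k' (t⁻¹ • x - t⁻¹ • z) * ((eg 2 (t⁻¹ • z) - eg 3 (t⁻¹ • z) : ℝ) : ℂ)) := by
    ext z
    rw [eg_scale (by norm_num) ht, eg_scale (by norm_num) ht, ← mul_sub, smul_sub]
    push_cast; ring
  rw [this, integral_const_mul, e, integral_const_mul]
  push_cast
  field_simp

theorem opK_canc (hk : Canc k) : ∃ k' : KE d → ℂ, Decay k' ∧ ∀ (g : KE d → ℝ), Measurable g →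
    (∀ x, 0 ≤ g x) → ∀ B, (∀ x, g x ≤ B) → ∀ t : ℝ, 0 < t → ∀ y,
    opK k t (fun x => (g x : ℂ)) y =
      ∫ x, ks k' t (y - x) * ((hR g (2 * t ^ 2) x - hR g (3 * t ^ 2) x : ℝ) : ℂ) := by
  obtain ⟨hd, k', hd', h⟩ := hk
  refine ⟨k', hd', fun g hg h0 B hB t ht y => ?_⟩
  set D : KE d → ℝ := fun z => eg (2 * t ^ 2) z - eg (3 * t ^ 2) z with hD
  have hDi : Integrable D := (eg_integrable (by positivity)).sub (eg_integrable (by positivity))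
  set F : KE d × KE d → ℂ := fun p => ks k' t (y - p.2) * (D p.1 : ℂ) * (g (p.2 - p.1) : ℂ) with hF
  have hFi : Integrable F (volume.prod volume) := by
    have h1 : Integrable (fun x => ks k' t (y - x)) := (ks_integrable hd' ht).comp_sub_left y
    have h2 : Integrable (fun p : KE d × KE d => (D p.1 : ℂ) * ks k' t (y - p.2))
        (volume.prod volume) := hDi.ofReal.mul_prod h1
    have h3 : Integrable (fun p : KE d × KE d => ks k' t (y - p.2) * (D p.1 : ℂ))
        (volume.prod volume) := by
      refine h2.congr (Filter.Eventually.of_forall fun p => mul_comm _ _)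
    refine h3.mul_bdd (c := B) ?_ (Filter.Eventually.of_forall fun p => ?_)
    · have : Measurable fun p : KE d × KE d => (g (p.2 - p.1) : ℂ) :=
        Complex.measurable_ofReal.comp (hg.comp (by fun_prop))
      exact this.aestronglyMeasurable
    · rw [Complex.norm_real, Real.norm_of_nonneg (h0 _)]; exact hB _
  have hF2 : Integrable (fun p : KE d × KE d => F (p.1, p.1 + p.2)) (volume.prod volume) :=
    (measurePreserving_prod_add volume volume).integrable_comp_of_integrable hFi
  have eL : opK k t (fun x => (g x : ℂ)) y = ∫ x, ∫ z, F (z, z + x) := by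
    unfold opK
    refine integral_congr_ae (Filter.Eventually.of_forall fun x => ?_)
    simp only
    rw [ks_canc hd.1 h ht, ← integral_mul_const]
    refine integral_congr_ae (Filter.Eventually.of_forall fun z => ?_)
    simp only [hF, hD]
    rw [show y - (z + x) = y - x - z by abel, show z + x - z = x by abel]
  have eR : ∫ x, ks k' t (y - x) * ((hR g (2 * t ^ 2) x - hR g (3 * t ^ 2) x : ℝ) : ℂ) =
      ∫ x, ∫ z, F (z, x) := by
    refine integral_congr_ae (Filter.Eventually.of_forall fun x => ?_)
    simp only [hF]
    unfold hR
    rw [← integral_sub (hR_int hg h0 hB (by positivity) x) (hR_int hg h0 hB (by positivity) x),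
      ← integral_complex_ofReal, ← integral_const_mul]
    refine integral_congr_ae (Filter.Eventually.of_forall fun z => ?_)
    simp only [hD]; push_cast; ring
  rw [eL, eR, integral_integral_swap (f := fun x z => F (z, z + x)) hF2.swap,
    integral_integral_swap (f := fun x z => F (z, x)) hFi.swap]
  refine integral_congr_ae (Filter.Eventually.of_forall fun z => ?_)
  simp only
  rw [← integral_add_left_eq_self (fun x => F (z, x)) z]
end

end KP

namespace KP

section
variable {d : ℕ} {k : KE d → ℂ}

theorem hR3_le_MF : ∃ C : ℝ, 0 < C ∧ ∀ (g : KE d → ℝ), Measurable g →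
    (∀ x, 0 ≤ g x) → ∀ B, (∀ x, g x ≤ B) → ∀ t : ℝ, 0 < t → ∀ x y x0 : KE d,
    x0 ∈ Metric.ball y t →
    ENNReal.ofReal (hR g (3 * t ^ 2) x) ≤ ENNReal.ofReal (C * (1 + ‖y - x‖ / t) ^ (d + 1)) *
      MF (fun z => ENNReal.ofReal (g z)) x0 := by
  obtain ⟨C, hC, h⟩ := kb_dom (d := d)
  obtain ⟨C2, hC2, h2⟩ := eg_decay (d := d) (τ := 3) (by norm_num) (d + 1)
  refine ⟨C2 * C, by positivity, fun g hg h0 B hB t ht x y x0 hx0 => ?_⟩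
  rw [hR_ofReal' hg h0 hB (by positivity)]
  have hpt : ∀ w : KE d, eg (3 * t ^ 2) (x - w) ≤
      (C2 * (1 + ‖y - x‖ / t) ^ (d + 1)) * kb t (y - w) := by
    intro w
    rw [eg_scale (by norm_num) ht]
    have h3 := h2 (t⁻¹ • (x - w))
    rw [norm_smul, Real.norm_of_nonneg (by positivity), inv_mul_eq_div] at h3
    unfold kb
    have htri : 1 + ‖y - w‖ / t ≤ (1 + ‖y - x‖ / t) * (1 + ‖x - w‖ / t) := by
      have : ‖y - w‖ ≤ ‖y - x‖ + ‖x - w‖ := norm_sub_le_norm_sub_add_norm_sub y x w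
      have h5 : ‖y - w‖ / t ≤ ‖y - x‖ / t + ‖x - w‖ / t := by rw [← add_div]; gcongr
      have : 0 ≤ (‖y - x‖ / t) * (‖x - w‖ / t) := by positivity
      nlinarith
    have h4 : ((1 + ‖x - w‖ / t) ^ (d + 1))⁻¹ ≤
        (1 + ‖y - x‖ / t) ^ (d + 1) * ((1 + ‖y - w‖ / t) ^ (d + 1))⁻¹ := by
      rw [← div_eq_mul_inv, inv_le_iff_one_le_mul₀ (by positivity), div_mul_eq_mul_div, le_div_iff₀ (by positivity),
        one_mul, ← mul_pow]
      gcongr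
    calc (t ^ d)⁻¹ * eg 3 (t⁻¹ • (x - w)) ≤ (t ^ d)⁻¹ * (C2 * ((1 + ‖x - w‖ / t) ^ (d + 1))⁻¹) := by
          gcongr
      _ ≤ (t ^ d)⁻¹ * (C2 * ((1 + ‖y - x‖ / t) ^ (d + 1) * ((1 + ‖y - w‖ / t) ^ (d + 1))⁻¹)) := by
          gcongr
      _ = _ := by ring
  calc _ ≤ ∫⁻ w, ENNReal.ofReal (C2 * (1 + ‖y - x‖ / t) ^ (d + 1)) *
        (ENNReal.ofReal (kb t (y - w)) * ENNReal.ofReal (g w)) := by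
        refine lintegral_mono fun w => ?_
        rw [← mul_assoc, ← ENNReal.ofReal_mul (p := C2 * (1 + ‖y - x‖ / t) ^ (d + 1)) (by positivity)]
        exact mul_le_mul' (ENNReal.ofReal_le_ofReal (hpt w)) le_rfl
    _ ≤ _ := by
        rw [lintegral_const_mul' _ _ ENNReal.ofReal_ne_top]
        refine (mul_le_mul' le_rfl (h _ hg.ennreal_ofReal t ht x0 y hx0)).trans ?_
        rw [← mul_assoc, ← ENNReal.ofReal_mul (by positivity)]
        refine mul_le_mul' (ENNReal.ofReal_le_ofReal (le_of_eq ?_)) le_rfl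
        ring

theorem Aest (hk : Canc k) {a : ℝ} (ha : 1 < a) (ha2 : a ≤ 2) :
    ∃ C : ℝ, 0 < C ∧ ∀ (g : KE d → ℝ), Measurable g → (∀ x, 0 ≤ g x) → ∀ B, (∀ x, g x ≤ B) →
    ∃ E : ℝ → KE d → ℝ≥0∞, Measurable (fun q : ℝ × KE d => E q.1 q.2) ∧ (∀ θ y, E θ y ≠ ∞) ∧
      ∫⁻ θ, ∫⁻ y, E θ y ≤ ENNReal.ofReal C * ∫⁻ x, ENNReal.ofReal (g x) ^ a ∧
      ∀ θ y, ∀ x ∈ Metric.ball y (Real.exp θ), ‖opK k (Real.exp θ) (fun x => (g x : ℂ)) y‖ₑ ^ 2 ≤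
        E θ y * MF (fun z => ENNReal.ofReal (g z)) x ^ (2 - a) := by
  obtain ⟨k', hk', hop⟩ := opK_canc hk
  obtain ⟨C1, hC1, h1⟩ := ks_bd hk'
  obtain ⟨C2, hC2, h2⟩ := hR3_le_MF (d := d)
  obtain ⟨C3, hC3, h3⟩ := kb_mass (d := d)
  obtain ⟨C4, hC4, h4⟩ := ks_mass hk'
  obtain ⟨C5, hC5, h5⟩ := ks_mass' hk'
  set A : ℝ := ((a - 1) ^ 2)⁻¹ * 2 ^ (d : ℝ) * C2 ^ (2 - a) * (C1 * C3) with hA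
  have ha1 : 0 < a - 1 := by linarith
  have hApos : 0 < A := by positivity
  have hl3 : 0 < Real.log 3 := Real.log_pos (by norm_num)
  refine ⟨A * (C5 * (Real.log 3 / 2)), by positivity, fun g hg h0 B hB => ?_⟩
  set E : ℝ → KE d → ℝ≥0∞ := fun θ y => ENNReal.ofReal A *
    ∫⁻ x, ‖ks k' (Real.exp θ) (y - x)‖ₑ * ENNReal.ofReal (En g a (Real.exp θ ^ 2) x) with hE
  have hKm : Measurable fun q : ℝ × KE d => ‖ks k' q.1 q.2‖ₑ := (ks_meas hk'.1).enorm
  have hEnm : Measurable fun q : ℝ × KE d => ENNReal.ofReal (En g a (Real.exp q.1 ^ 2) q.2) :=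
    ((En_meas hg a).comp (f := fun q : ℝ × KE d => (Real.exp q.1 ^ 2, q.2)) (by fun_prop)).ennreal_ofReal
  have hm3 : Measurable fun q : (ℝ × KE d) × KE d => ‖ks k' (Real.exp q.1.1) (q.1.2 - q.2)‖ₑ *
      ENNReal.ofReal (En g a (Real.exp q.1.1 ^ 2) q.2) :=
    (hKm.comp (f := fun q : (ℝ × KE d) × KE d => (Real.exp q.1.1, q.1.2 - q.2)) (by fun_prop)).mul
      (hEnm.comp (f := fun q : (ℝ × KE d) × KE d => (q.1.1, q.2)) (by fun_prop))
  have hEm : Measurable (fun q : ℝ × KE d => E q.1 q.2) :=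
    (Measurable.lintegral_prod_right' hm3).const_mul _
  refine ⟨E, hEm, fun θ y => ?_, ?_, ?_⟩
  · -- finiteness
    refine ENNReal.mul_ne_top ENNReal.ofReal_ne_top ?_
    have ht := Real.exp_pos θ
    have hb : ∀ x, ENNReal.ofReal (En g a (Real.exp θ ^ 2) x) ≤ ENNReal.ofReal (B ^ a) := by
      intro x
      refine ENNReal.ofReal_le_ofReal ?_
      have n0 := fun x => hR_nonneg h0 (pow_pos ht 2) x
      have nB := fun x => hR_le hg h0 hB (pow_pos ht 2) x
      have := hR_le ((hR_x_meas hg (Real.exp θ ^ 2)).pow_const a)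
        (fun x => Real.rpow_nonneg (n0 x) a) (fun x => pow_bd n0 nB ha x)
        (by positivity : 0 < 2 * Real.exp θ ^ 2) x
      have h6 : 0 ≤ hR g (3 * Real.exp θ ^ 2) x ^ a :=
        Real.rpow_nonneg (hR_nonneg h0 (by positivity) x) a
      unfold En; linarith
    refine ne_of_lt ?_
    calc _ ≤ ∫⁻ x, ‖ks k' (Real.exp θ) (y - x)‖ₑ * ENNReal.ofReal (B ^ a) :=
          lintegral_mono fun x => mul_le_mul' le_rfl (hb x)
      _ = (∫⁻ x, ‖ks k' (Real.exp θ) (y - x)‖ₑ) * ENNReal.ofReal (B ^ a) :=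
          lintegral_mul_const' _ _ ENNReal.ofReal_ne_top
      _ ≤ ENNReal.ofReal C4 * ENNReal.ofReal (B ^ a) := mul_le_mul' (h4 _ ht y) le_rfl
      _ < ∞ := ENNReal.mul_lt_top ENNReal.ofReal_lt_top ENNReal.ofReal_lt_top
  · -- total
    have hin : ∀ θ, ∫⁻ y, E θ y ≤ ENNReal.ofReal A * (ENNReal.ofReal C5 *
        ∫⁻ x, ENNReal.ofReal (En g a (Real.exp θ ^ 2) x)) := by
      intro θ
      simp only [hE]
      rw [lintegral_const_mul' _ _ ENNReal.ofReal_ne_top]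
      refine mul_le_mul' le_rfl ?_
      have hmm : Measurable fun q : KE d × KE d => ‖ks k' (Real.exp θ) (q.1 - q.2)‖ₑ *
          ENNReal.ofReal (En g a (Real.exp θ ^ 2) q.2) :=
        hm3.comp (f := fun q : KE d × KE d => ((θ, q.1), q.2)) (by fun_prop)
      rw [lintegral_lintegral_swap hmm.aemeasurable]
      have hme : Measurable fun x => ENNReal.ofReal (En g a (Real.exp θ ^ 2) x) :=
        hEnm.comp (f := fun x : KE d => (θ, x)) (by fun_prop)
      rw [← lintegral_const_mul _ hme]
      refine lintegral_mono fun x => ?_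
      rw [lintegral_mul_const' _ _ ENNReal.ofReal_ne_top]
      exact mul_le_mul' (h5 _ (Real.exp_pos θ) x) le_rfl
    calc _ ≤ ∫⁻ θ : ℝ, ENNReal.ofReal A * (ENNReal.ofReal C5 *
        ∫⁻ x, ENNReal.ofReal (En g a (Real.exp θ ^ 2) x)) := lintegral_mono hin
      _ = ENNReal.ofReal A * (ENNReal.ofReal C5 *
        ∫⁻ θ : ℝ, ∫⁻ x, ENNReal.ofReal (En g a (Real.exp θ ^ 2) x)) := by
          rw [lintegral_const_mul' _ _ ENNReal.ofReal_ne_top,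
            lintegral_const_mul' _ _ ENNReal.ofReal_ne_top]
      _ ≤ ENNReal.ofReal A * (ENNReal.ofReal C5 * (ENNReal.ofReal (Real.log 3 / 2) *
          ∫⁻ x, ENNReal.ofReal (g x ^ a))) :=
          mul_le_mul' le_rfl (mul_le_mul' le_rfl (En_total hg h0 hB ha ha2))
      _ = _ := by
          simp_rw [← ENNReal.ofReal_rpow_of_nonneg (h0 _) (by linarith : 0 ≤ a)]
          rw [ENNReal.ofReal_mul hApos.le, ENNReal.ofReal_mul hC5.le]
          ring
  · intro θ y x0 hx0
    have ht := Real.exp_pos θ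
    set t := Real.exp θ with htdef
    set M := MF (fun z => ENNReal.ofReal (g z)) x0 with hM
    rw [hop g hg h0 B hB t ht y]
    -- pointwise bound
    set w : KE d → ℝ≥0∞ := fun x => ENNReal.ofReal ((1 + ‖y - x‖ / t) ^ (d + 1)) with hw
    have hpt : ∀ x, ENNReal.ofReal |hR g (2 * t ^ 2) x - hR g (3 * t ^ 2) x| ^ 2 ≤
        ENNReal.ofReal (((a - 1) ^ 2)⁻¹ * 2 ^ (d : ℝ) * C2 ^ (2 - a)) * M ^ (2 - a) *
        (ENNReal.ofReal (En g a (t ^ 2) x) * w x) := by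
      intro x
      have hb := En_bd hg h0 hB ha ha2 (pow_pos ht 2) x
      have h3n := hR_nonneg h0 (by positivity : 0 < 3 * t ^ 2) x
      have hb2 : |hR g (2 * t ^ 2) x - hR g (3 * t ^ 2) x| ^ 2 ≤
          ((a - 1) ^ 2)⁻¹ * 2 ^ (d : ℝ) * (En g a (t ^ 2) x * hR g (3 * t ^ 2) x ^ (2 - a)) := by
        rw [sq_abs, mul_assoc, inv_mul_eq_div, le_div_iff₀ (by positivity), mul_comm]
        exact hb.2
      have hww : w x ^ (2 - a) ≤ w x := by
        have h1w : 1 ≤ w x := by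
          rw [hw, ENNReal.one_le_ofReal]
          refine one_le_pow₀ ?_
          have : 0 ≤ ‖y - x‖ / t := by positivity
          linarith
        calc w x ^ (2 - a) ≤ w x ^ (1 : ℝ) := ENNReal.rpow_le_rpow_of_exponent_le h1w (by linarith)
          _ = w x := ENNReal.rpow_one _
      have h6 : ENNReal.ofReal (hR g (3 * t ^ 2) x ^ (2 - a)) ≤
          ENNReal.ofReal (C2 ^ (2 - a)) * w x * M ^ (2 - a) := by
        rw [← ENNReal.ofReal_rpow_of_nonneg h3n (by linarith),
          ← ENNReal.ofReal_rpow_of_nonneg hC2.le (by linarith)]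
        calc _ ≤ (ENNReal.ofReal (C2 * (1 + ‖y - x‖ / t) ^ (d + 1)) * M) ^ (2 - a) :=
              ENNReal.rpow_le_rpow (h2 g hg h0 B hB t ht x y x0 hx0) (by linarith)
          _ = (ENNReal.ofReal C2) ^ (2 - a) * w x ^ (2 - a) * M ^ (2 - a) := by
              rw [ENNReal.ofReal_mul hC2.le, ENNReal.mul_rpow_of_nonneg _ _ (by linarith),
                ENNReal.mul_rpow_of_nonneg _ _ (by linarith)]
          _ ≤ _ := mul_le_mul' (mul_le_mul' le_rfl hww) le_rfl
      rw [← ENNReal.ofReal_pow (abs_nonneg _)]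
      calc _ ≤ _ := ENNReal.ofReal_le_ofReal hb2
        _ = ENNReal.ofReal (((a - 1) ^ 2)⁻¹ * 2 ^ (d : ℝ)) * (ENNReal.ofReal (En g a (t ^ 2) x) *
            ENNReal.ofReal (hR g (3 * t ^ 2) x ^ (2 - a))) := by
            rw [ENNReal.ofReal_mul (by positivity), ENNReal.ofReal_mul hb.1]
        _ ≤ ENNReal.ofReal (((a - 1) ^ 2)⁻¹ * 2 ^ (d : ℝ)) * (ENNReal.ofReal (En g a (t ^ 2) x) *
            (ENNReal.ofReal (C2 ^ (2 - a)) * w x * M ^ (2 - a))) :=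
            mul_le_mul' le_rfl (mul_le_mul' le_rfl h6)
        _ = _ := by
            rw [ENNReal.ofReal_mul (p := ((a - 1) ^ 2)⁻¹ * 2 ^ (d : ℝ)) (by positivity)]
            ring
    -- square root form
    have e2 : ∀ x : ℝ≥0∞, (x ^ (1 / 2 : ℝ)) ^ 2 = x := fun x => by
      rw [← ENNReal.rpow_natCast, ← ENNReal.rpow_mul]; norm_num
    set P := ENNReal.ofReal (((a - 1) ^ 2)⁻¹ * 2 ^ (d : ℝ) * C2 ^ (2 - a)) * M ^ (2 - a) with hP
    set κ : KE d → ℝ≥0∞ := fun x => ‖ks k' t (y - x)‖ₑ with hκ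
    have hκm : Measurable κ := hKm.comp (f := fun x : KE d => (t, y - x)) (by fun_prop)
    have hme : Measurable fun x => ENNReal.ofReal (En g a (t ^ 2) x) :=
      hEnm.comp (f := fun x : KE d => (θ, x)) (by fun_prop)
    have hwm : Measurable w := by
      have : Measurable fun x : KE d => (1 + ‖y - x‖ / t) ^ (d + 1) := by fun_prop
      exact this.ennreal_ofReal
    have hpt2 : ∀ x, ENNReal.ofReal |hR g (2 * t ^ 2) x - hR g (3 * t ^ 2) x| ≤
        P ^ (1 / 2 : ℝ) * (ENNReal.ofReal (En g a (t ^ 2) x) ^ (1 / 2 : ℝ) * w x ^ (1 / 2 : ℝ)) := by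
      intro x
      rw [← ENNReal.mul_rpow_of_nonneg _ _ (by norm_num), ← ENNReal.mul_rpow_of_nonneg _ _ (by norm_num)]
      rw [← (ENNReal.pow_le_pow_left_iff (two_ne_zero)), e2]
      exact hpt x
    have hκw : ∫⁻ x, κ x * w x ≤ ENNReal.ofReal (C1 * C3) := by
      calc _ ≤ ∫⁻ x, ENNReal.ofReal C1 * ENNReal.ofReal (kb t (y - x)) := by
            refine lintegral_mono fun x => ?_
            simp only [hκ, hw]
            rw [← ofReal_norm, ← ENNReal.ofReal_mul (norm_nonneg _), ← ENNReal.ofReal_mul hC1.le]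
            refine ENNReal.ofReal_le_ofReal ?_
            calc _ ≤ C1 * (kb t (y - x) * ((1 + ‖y - x‖ / t) ^ (d + 1))⁻¹) * (1 + ‖y - x‖ / t) ^ (d + 1) := by
                  gcongr; exact h1 t ht _
              _ = _ := by field_simp
        _ ≤ _ := by
            rw [lintegral_const_mul' _ _ ENNReal.ofReal_ne_top, ENNReal.ofReal_mul hC1.le]
            exact mul_le_mul' le_rfl (h3 t ht y)
    have hn : ‖∫ x, ks k' t (y - x) * ((hR g (2 * t ^ 2) x - hR g (3 * t ^ 2) x : ℝ) : ℂ)‖ₑ ≤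
        ∫⁻ x, P ^ (1 / 2 : ℝ) * ((κ x * ENNReal.ofReal (En g a (t ^ 2) x)) ^ (1 / 2 : ℝ) *
          (κ x * w x) ^ (1 / 2 : ℝ)) := by
      refine (enorm_integral_le_lintegral_enorm _).trans (lintegral_mono fun x => ?_)
      rw [enorm_mul]
      have : ‖((hR g (2 * t ^ 2) x - hR g (3 * t ^ 2) x : ℝ) : ℂ)‖ₑ =
          ENNReal.ofReal |hR g (2 * t ^ 2) x - hR g (3 * t ^ 2) x| := by
        rw [← ofReal_norm, Complex.norm_real, Real.norm_eq_abs]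
      rw [this]
      refine (mul_le_mul' le_rfl (hpt2 x)).trans (le_of_eq ?_)
      rw [ENNReal.mul_rpow_of_nonneg (κ x) (ENNReal.ofReal _) (by norm_num : (0 : ℝ) ≤ 1 / 2),
        ENNReal.mul_rpow_of_nonneg (κ x) (w x) (by norm_num : (0 : ℝ) ≤ 1 / 2)]
      have : ‖ks k' t (y - x)‖ₑ = (κ x ^ (1 / 2 : ℝ)) ^ 2 := by rw [e2]
      rw [this]; ring
    calc _ ≤ _ := pow_le_pow_left' hn 2
      _ ≤ (P ^ (1 / 2 : ℝ)) ^ 2 * ((∫⁻ x, κ x * ENNReal.ofReal (En g a (t ^ 2) x)) *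
          ∫⁻ x, κ x * w x) := by
          rw [lintegral_const_mul _ (by fun_prop), mul_pow]
          refine mul_le_mul' le_rfl ?_
          refine (cs (by fun_prop) (by fun_prop)).trans ?_
          simp_rw [e2]; exact le_rfl
      _ ≤ P * ((∫⁻ x, κ x * ENNReal.ofReal (En g a (t ^ 2) x)) * ENNReal.ofReal (C1 * C3)) := by
          rw [e2]
          exact mul_le_mul' le_rfl (mul_le_mul' le_rfl hκw)
      _ = _ := by
          simp only [hE, hP, hA]
          rw [ENNReal.ofReal_mul (p := ((a - 1) ^ 2)⁻¹ * 2 ^ (d : ℝ) * C2 ^ (2 - a)) (by positivity)]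
          simp only [hκ]
          ring
end

end KP

namespace KP

section
variable {d : ℕ} {k : KE d → ℂ}

theorem opK_meas (hk : Continuous k) {g : KE d → ℂ} (hg : Measurable g) :
    Measurable fun q : ℝ × KE d => opK k q.1 g q.2 := by
  refine StronglyMeasurable.measurable ?_
  refine StronglyMeasurable.integral_prod_right
    (f := fun (q : ℝ × KE d) x => ks k q.1 (q.2 - x) * g x) ?_
  refine Measurable.stronglyMeasurable ?_
  have h1 : Measurable fun q : (ℝ × KE d) × KE d => ks k q.1.1 (q.1.2 - q.2) :=
    (ks_meas hk).comp (f := fun q : (ℝ × KE d) × KE d => (q.1.1, q.1.2 - q.2)) (by fun_prop)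
  exact h1.mul (hg.comp measurable_snd)

theorem opK_int (hk : Decay k) {g : KE d → ℂ} (hg : Measurable g) {B : ℝ} (hB : ∀ x, ‖g x‖ ≤ B)
    {t : ℝ} (ht : 0 < t) (y : KE d) : Integrable fun x => ks k t (y - x) * g x :=
  ((ks_integrable hk ht).comp_sub_left y).mul_bdd hg.aestronglyMeasurable
    (Filter.Eventually.of_forall hB)

theorem L2est (hk : Canc k) : ∃ C : ℝ, 0 < C ∧ ∀ (g : KE d → ℝ), Measurable g →
    (∀ x, 0 ≤ g x) → ∀ B, (∀ x, g x ≤ B) → ∀ τ : ℝ, 0 < τ →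
    ∫⁻ θ : ℝ, ∫⁻ y, ‖opK k (τ * Real.exp θ) (fun x => (g x : ℂ)) y‖ₑ ^ 2 ≤
      ENNReal.ofReal C * ∫⁻ x, ENNReal.ofReal (g x) ^ 2 := by
  obtain ⟨C, hC, h⟩ := Aest hk one_lt_two le_rfl
  refine ⟨C, hC, fun g hg h0 B hB τ hτ => ?_⟩
  obtain ⟨E, hEm, _, hEt, hE⟩ := h g hg h0 B hB
  have e2 : ∀ x : ℝ≥0∞, x ^ (2 : ℝ) = x ^ 2 := fun x => by
    rw [← ENNReal.rpow_natCast]; norm_num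
  simp_rw [e2] at hEt
  refine le_trans ?_ hEt
  have e1 : ∀ θ : ℝ, τ * Real.exp θ = Real.exp (θ + Real.log τ) := fun θ => by
    rw [Real.exp_add, Real.exp_log hτ, mul_comm]
  simp_rw [e1]
  rw [lintegral_add_right_eq_self
    (fun θ => ∫⁻ y, ‖opK k (Real.exp θ) (fun x => (g x : ℂ)) y‖ₑ ^ 2) (Real.log τ)]
  refine lintegral_mono fun θ => lintegral_mono fun y => ?_
  have := hE θ y y (Metric.mem_ball_self (Real.exp_pos θ))
  simpa using this

theorem opK_far (hk : Decay k) : ∃ C : ℝ, 0 < C ∧ ∀ (g : KE d → ℝ), Measurable g →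
    (∀ x, 0 ≤ g x) → ∀ O : Set (KE d), ∀ t : ℝ, 0 < t → ∀ y : KE d, ∀ δ : ℝ, 0 ≤ δ →
    (∀ x, x ∉ O → δ ≤ ‖y - x‖) →
    ‖opK k t (fun x => ((Oᶜ.indicator g x : ℝ) : ℂ)) y‖ₑ ≤
      ENNReal.ofReal (C * (1 + δ / t)⁻¹) * MF (fun z => ENNReal.ofReal (g z)) y := by
  obtain ⟨C1, hC1, h1⟩ := ks_bd hk
  obtain ⟨C, hC, h⟩ := kb_dom (d := d)
  refine ⟨C1 * C, by positivity, fun g hg h0 O t ht y δ hδ hO => ?_⟩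
  unfold opK
  calc _ ≤ ∫⁻ x, ‖ks k t (y - x) * ((Oᶜ.indicator g x : ℝ) : ℂ)‖ₑ :=
        enorm_integral_le_lintegral_enorm _
    _ ≤ ∫⁻ x, ENNReal.ofReal (C1 * (1 + δ / t)⁻¹) *
        (ENNReal.ofReal (kb t (y - x)) * ENNReal.ofReal (g x)) := by
        refine lintegral_mono fun x => ?_
        by_cases hx : x ∈ O
        · have : Oᶜ.indicator g x = 0 := Set.indicator_of_notMem (by simpa using hx) _
          simp [this]
        · rw [Set.indicator_of_mem (by simpa using hx)]
          have hkb := kb_nonneg ht (y - x)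
          rw [← ofReal_norm, norm_mul, Complex.norm_real, Real.norm_of_nonneg (h0 x),
            ← ENNReal.ofReal_mul hkb, ← ENNReal.ofReal_mul (by positivity)]
          refine ENNReal.ofReal_le_ofReal ?_
          have hle : ((1 + ‖y - x‖ / t) ^ (d + 1))⁻¹ ≤ (1 + δ / t)⁻¹ := by
            have h3 : 1 + δ / t ≤ 1 + ‖y - x‖ / t := by
              have := hO x hx; gcongr
            have h4 : (1 : ℝ) ≤ 1 + ‖y - x‖ / t := by
              have : 0 ≤ ‖y - x‖ / t := by positivity
              linarith
            have h5 : 1 + ‖y - x‖ / t ≤ (1 + ‖y - x‖ / t) ^ (d + 1) := le_self_pow₀ h4 (by omega)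
            have : 0 ≤ δ / t := by positivity
            gcongr
            exact h3.trans h5
          calc _ ≤ C1 * (kb t (y - x) * ((1 + ‖y - x‖ / t) ^ (d + 1))⁻¹) * g x := by
                have := h0 x
                gcongr; exact h1 t ht _
            _ ≤ C1 * (kb t (y - x) * (1 + δ / t)⁻¹) * g x := by
                have := h0 x
                gcongr
            _ = _ := by ring
    _ ≤ _ := by
        rw [lintegral_const_mul' _ _ ENNReal.ofReal_ne_top]
        refine (mul_le_mul' le_rfl (h _ hg.ennreal_ofReal t ht y y (Metric.mem_ball_self ht))).trans ?_
        rw [← mul_assoc, ← ENNReal.ofReal_mul (by positivity)]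
        refine mul_le_mul' (ENNReal.ofReal_le_ofReal (le_of_eq ?_)) le_rfl
        ring

theorem lint_exp {c b : ℝ} (hc : 0 < c) :
    ∫⁻ θ : ℝ, (Set.Iic b).indicator (fun θ => ENNReal.ofReal (Real.exp (c * (θ - b)))) θ =
      ENNReal.ofReal c⁻¹ := by
  rw [lintegral_indicator measurableSet_Iic]
  have e : ∀ θ, Real.exp (c * (θ - b)) = Real.exp (c * θ) * Real.exp (-(c * b)) := fun θ => by
    rw [← Real.exp_add]; congr 1; ring
  simp_rw [e]
  rw [← ofReal_integral_eq_lintegral_ofReal ((integrableOn_exp_mul_Iic hc b).mul_const _)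
    (Filter.Eventually.of_forall fun x => by positivity), integral_mul_const, integral_exp_mul_Iic hc]
  congr 1
  rw [div_mul_eq_mul_div, ← Real.exp_add]; simp

theorem carl_set (hk : Canc k) {ε : ℝ} (hε : 0 < ε) (hε1 : ε ≤ 1) :
    ∃ C : ℝ, 0 < C ∧ ∀ (g : KE d → ℝ), Measurable g →
    (∀ x, 0 ≤ g x) → ∀ B, (∀ x, g x ≤ B) → ∀ τ : ℝ, 1 ≤ τ → ∀ O : Set (KE d), MeasurableSet O →
    ∀ S : Set (ℝ × KE d), (∀ q ∈ S, Metric.ball q.2 (Real.exp q.1) ⊆ O) →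
    ∫⁻ θ : ℝ, ∫⁻ y, S.indicator
      (fun q => ‖opK k (τ * Real.exp q.1) (fun x => (g x : ℂ)) q.2‖ₑ ^ 2) (θ, y) ≤
      ENNReal.ofReal (C * τ ^ (2 * ε)) * ∫⁻ x in O, MF (fun z => ENNReal.ofReal (g z)) x ^ 2 := by
  obtain ⟨C1, hC1, h1⟩ := L2est hk
  obtain ⟨C2, hC2, h2⟩ := opK_far hk.1
  refine ⟨2 * C1 + 2 * (C2 ^ 2 * (2 * ε)⁻¹), by positivity, fun g hg h0 B hB τ hτ O hO S hS => ?_⟩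
  have hτ0 : 0 < τ := by linarith
  have hB0 : 0 ≤ B := (h0 0).trans (hB 0)
  set M := MF (fun z => ENNReal.ofReal (g z)) with hM
  set g1 : KE d → ℝ := O.indicator g with hg1
  set g2 : KE d → ℝ := Oᶜ.indicator g with hg2
  have i0 : ∀ U : Set (KE d), ∀ x, 0 ≤ U.indicator g x := fun U x =>
    Set.indicator_nonneg (fun x _ => h0 x) x
  have iB : ∀ U : Set (KE d), ∀ x, U.indicator g x ≤ B := fun U x => by
    unfold Set.indicator; split_ifs
    · exact hB x
    · exact hB0
  have hg1m : Measurable g1 := hg.indicator hO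
  have hg2m : Measurable g2 := hg.indicator hO.compl
  set δ : KE d → ℝ := fun y => Metric.infDist y Oᶜ with hδ
  set Ψ : ℝ → KE d → ℝ≥0∞ := fun θ y => ENNReal.ofReal (C2 ^ 2 * τ ^ (2 * ε)) *
    (O.indicator (fun y => M y ^ 2) y * (Set.Iic (Real.log (δ y))).indicator
      (fun θ => ENNReal.ofReal (Real.exp (2 * ε * (θ - Real.log (δ y))))) θ) with hΨ
  -- pointwise
  have hpt : ∀ θ y, S.indicator
      (fun q => ‖opK k (τ * Real.exp q.1) (fun x => (g x : ℂ)) q.2‖ₑ ^ 2) (θ, y) ≤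
      2 * ‖opK k (τ * Real.exp θ) (fun x => (g1 x : ℂ)) y‖ₑ ^ 2 + 2 * Ψ θ y := by
    intro θ y
    by_cases hq : (θ, y) ∈ S
    swap
    · rw [Set.indicator_of_notMem hq]; exact zero_le
    rw [Set.indicator_of_mem hq]
    have hball := hS _ hq
    simp only at hball
    have ht : 0 < τ * Real.exp θ := by positivity
    have hsum : opK k (τ * Real.exp θ) (fun x => (g x : ℂ)) y =
        opK k (τ * Real.exp θ) (fun x => (g1 x : ℂ)) y +
        opK k (τ * Real.exp θ) (fun x => (g2 x : ℂ)) y := by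
      have i1 : Integrable fun x => ks k (τ * Real.exp θ) (y - x) * ((g1 x : ℝ) : ℂ) :=
        opK_int hk.1 (B := B) (Complex.measurable_ofReal.comp hg1m) (fun x => by
          simp only [Function.comp]
          rw [Complex.norm_real, Real.norm_of_nonneg (i0 _ x)]; exact iB _ x) ht y
      have i2 : Integrable fun x => ks k (τ * Real.exp θ) (y - x) * ((g2 x : ℝ) : ℂ) :=
        opK_int hk.1 (B := B) (Complex.measurable_ofReal.comp hg2m) (fun x => by
          simp only [Function.comp]
          rw [Complex.norm_real, Real.norm_of_nonneg (i0 _ x)]; exact iB _ x) ht y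
      unfold opK
      beta_reduce
      rw [← integral_add i1 i2]
      refine integral_congr_ae (Filter.Eventually.of_forall fun x => ?_)
      beta_reduce
      rw [← mul_add, ← Complex.ofReal_add]
      congr 2
      exact (Set.indicator_self_add_compl_apply O g x).symm
    have hfar : ‖opK k (τ * Real.exp θ) (fun x => (g2 x : ℂ)) y‖ₑ ^ 2 ≤ Ψ θ y := by
      by_cases hne : (Oᶜ).Nonempty
      swap
      · have : Oᶜ = ∅ := Set.not_nonempty_iff_eq_empty.1 hne
        have : g2 = 0 := by rw [hg2, this]; ext x; simp
        simp [this, opK]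
      have hyO : y ∈ O := hball (Metric.mem_ball_self (Real.exp_pos θ))
      have hδt : Real.exp θ ≤ δ y := by
        refine (Metric.le_infDist hne).2 fun z hz => ?_
        by_contra hc
        push Not at hc
        exact hz (hball (by rw [Metric.mem_ball, dist_comm]; exact hc))
      have hδ0 : 0 < δ y := (Real.exp_pos θ).trans_le hδt
      have hlog : θ ≤ Real.log (δ y) := (Real.le_log_iff_exp_le hδ0).2 hδt
      have := h2 g hg h0 O _ ht y (δ y) hδ0.le (fun x hx => by
        rw [← dist_eq_norm]; exact Metric.infDist_le_dist_of_mem hx)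
      simp only [hΨ]
      rw [Set.indicator_of_mem hyO, Set.indicator_of_mem (Set.mem_Iic.2 hlog)]
      have hr : (C2 * (1 + δ y / (τ * Real.exp θ))⁻¹) ^ 2 ≤
          C2 ^ 2 * τ ^ (2 * ε) * Real.exp (2 * ε * (θ - Real.log (δ y))) := by
        set r := δ y / (τ * Real.exp θ) with hr
        have hr0 : 0 < r := by positivity
        have e1 : τ ^ (2 * ε) * Real.exp (2 * ε * (θ - Real.log (δ y))) = (r ^ ε)⁻¹ ^ 2 := by
          rw [Real.rpow_def_of_pos hτ0, Real.rpow_def_of_pos hr0, ← Real.exp_neg, ← Real.exp_nat_mul,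
            ← Real.exp_add, hr, Real.log_div hδ0.ne' ht.ne', Real.log_mul hτ0.ne' (Real.exp_pos θ).ne',
            Real.log_exp]
          congr 1; push_cast; ring
        rw [mul_assoc, e1, mul_pow]
        have e3 : r ^ ε ≤ 1 + r := by
          calc r ^ ε ≤ (1 + r) ^ ε := Real.rpow_le_rpow hr0.le (by linarith) hε.le
            _ ≤ (1 + r) ^ (1 : ℝ) := Real.rpow_le_rpow_of_exponent_le (by linarith) hε1
            _ = 1 + r := Real.rpow_one _
        gcongr
      calc _ ≤ (ENNReal.ofReal (C2 * (1 + δ y / (τ * Real.exp θ))⁻¹) * M y) ^ 2 :=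
            pow_le_pow_left' this 2
        _ = ENNReal.ofReal ((C2 * (1 + δ y / (τ * Real.exp θ))⁻¹) ^ 2) * M y ^ 2 := by
            rw [mul_pow, ENNReal.ofReal_pow (by positivity)]
        _ ≤ ENNReal.ofReal (C2 ^ 2 * τ ^ (2 * ε) * Real.exp (2 * ε * (θ - Real.log (δ y)))) * M y ^ 2 :=
            mul_le_mul' (ENNReal.ofReal_le_ofReal hr) le_rfl
        _ = _ := by
            rw [ENNReal.ofReal_mul (by positivity)]; ring
    simp only
    rw [hsum]
    have hab : ∀ a b : ℝ≥0∞, (a + b) ^ 2 ≤ 2 * a ^ 2 + 2 * b ^ 2 := by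
      intro a b
      have := ENNReal.rpow_add_le_mul_rpow_add_rpow a b (p := 2) (by norm_num)
      simp only [ENNReal.rpow_two] at this
      norm_num at this
      rwa [mul_add] at this
    calc _ ≤ (‖opK k (τ * Real.exp θ) (fun x => (g1 x : ℂ)) y‖ₑ +
          ‖opK k (τ * Real.exp θ) (fun x => (g2 x : ℂ)) y‖ₑ) ^ 2 :=
          pow_le_pow_left' (enorm_add_le _ _) 2
      _ ≤ _ := hab _ _
      _ ≤ _ := by gcongr
  have hMm : Measurable M := MF_measurable _
  have hMO : Measurable (O.indicator fun y => M y ^ 2) := (hMm.pow_const 2).indicator hO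
  have hδm : Measurable δ := measurable_infDist
  have hΨm : Measurable fun q : ℝ × KE d => Ψ q.1 q.2 := by
    refine Measurable.const_mul ?_ _
    have m1 : Measurable fun q : ℝ × KE d => O.indicator (fun y => M y ^ 2) q.2 :=
      hMO.comp measurable_snd
    have m2 : Measurable fun q : ℝ × KE d => (Set.Iic (Real.log (δ q.2))).indicator
      (fun θ => ENNReal.ofReal (Real.exp (2 * ε * (θ - Real.log (δ q.2))))) q.1 := by
      have : (fun q : ℝ × KE d => (Set.Iic (Real.log (δ q.2))).indicator
        (fun θ => ENNReal.ofReal (Real.exp (2 * ε * (θ - Real.log (δ q.2))))) q.1) =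
        ({q : ℝ × KE d | q.1 ≤ Real.log (δ q.2)}).indicator
          (fun q => ENNReal.ofReal (Real.exp (2 * ε * (q.1 - Real.log (δ q.2))))) := by
        ext q; simp [Set.indicator]
      rw [this]
      have hl : Measurable fun q : ℝ × KE d => Real.log (δ q.2) := by fun_prop
      refine Measurable.indicator (by fun_prop) (measurableSet_le measurable_fst hl)
    exact m1.mul m2
  have hopm : Measurable fun q : ℝ × KE d =>
      ‖opK k (τ * Real.exp q.1) (fun x => (g1 x : ℂ)) q.2‖ₑ ^ 2 := by
    have := (opK_meas hk.1.1 (Complex.measurable_ofReal.comp hg1m)).comp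
      (f := fun q : ℝ × KE d => (τ * Real.exp q.1, q.2)) (by fun_prop)
    exact this.enorm.pow_const 2
  -- integrate the far part
  have hfarI : ∫⁻ θ, ∫⁻ y, Ψ θ y ≤ ENNReal.ofReal (C2 ^ 2 * τ ^ (2 * ε) * (2 * ε)⁻¹) *
      ∫⁻ x in O, M x ^ 2 := by
    rw [lintegral_lintegral_swap hΨm.aemeasurable, ← lintegral_indicator hO,
      ← lintegral_const_mul _ hMO]
    refine lintegral_mono fun y => ?_
    simp only [hΨ]
    rw [lintegral_const_mul' _ _ ENNReal.ofReal_ne_top, lintegral_const_mul _ (by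
      exact Measurable.indicator (by fun_prop) measurableSet_Iic), lint_exp (by positivity),
      ENNReal.ofReal_mul (p := C2 ^ 2 * τ ^ (2 * ε)) (by positivity)]
    apply le_of_eq; ring
  have hnearI : ∫⁻ θ, ∫⁻ y, ‖opK k (τ * Real.exp θ) (fun x => (g1 x : ℂ)) y‖ₑ ^ 2 ≤
      ENNReal.ofReal C1 * ∫⁻ x in O, M x ^ 2 := by
    refine (h1 g1 hg1m (i0 O) B (iB O) τ hτ0).trans (mul_le_mul' le_rfl ?_)
    rw [← lintegral_indicator hO]
    refine lintegral_mono_ae ?_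
    filter_upwards [ae_le_MF hg h0 hB] with x hx
    by_cases hxO : x ∈ O
    · rw [Set.indicator_of_mem hxO, hg1, Set.indicator_of_mem hxO]
      exact pow_le_pow_left' hx 2
    · rw [hg1, Set.indicator_of_notMem hxO]; simp
  calc _ ≤ ∫⁻ θ, ∫⁻ y, (2 * ‖opK k (τ * Real.exp θ) (fun x => (g1 x : ℂ)) y‖ₑ ^ 2 + 2 * Ψ θ y) :=
        lintegral_mono fun θ => lintegral_mono fun y => hpt θ y
    _ = 2 * (∫⁻ θ, ∫⁻ y, ‖opK k (τ * Real.exp θ) (fun x => (g1 x : ℂ)) y‖ₑ ^ 2) +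
        2 * ∫⁻ θ, ∫⁻ y, Ψ θ y := by
        have hΨ1 : ∀ θ, Measurable fun y => Ψ θ y := fun θ =>
          hΨm.comp (f := fun y : KE d => (θ, y)) (by fun_prop)
        have hin : ∀ θ : ℝ, ∫⁻ y, (2 * ‖opK k (τ * Real.exp θ) (fun x => (g1 x : ℂ)) y‖ₑ ^ 2 + 2 * Ψ θ y)
            = 2 * (∫⁻ y, ‖opK k (τ * Real.exp θ) (fun x => (g1 x : ℂ)) y‖ₑ ^ 2) + 2 * ∫⁻ y, Ψ θ y := by
          intro θ
          rw [lintegral_add_right _ ((hΨ1 θ).const_mul 2), lintegral_const_mul' _ _ (by norm_num),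
            lintegral_const_mul' _ _ (by norm_num)]
        simp_rw [hin]
        rw [lintegral_add_right _ ((Measurable.lintegral_prod_right' hΨm).const_mul 2),
          lintegral_const_mul' _ _ (by norm_num), lintegral_const_mul' _ _ (by norm_num)]
    _ ≤ 2 * (ENNReal.ofReal C1 * ∫⁻ x in O, M x ^ 2) +
        2 * (ENNReal.ofReal (C2 ^ 2 * τ ^ (2 * ε) * (2 * ε)⁻¹) * ∫⁻ x in O, M x ^ 2) := by gcongr
    _ = ENNReal.ofReal (2 * C1 + 2 * (C2 ^ 2 * τ ^ (2 * ε) * (2 * ε)⁻¹)) * ∫⁻ x in O, M x ^ 2 := by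
        rw [ENNReal.ofReal_add (by positivity) (by positivity), ENNReal.ofReal_mul (p := 2) (by norm_num),
          ENNReal.ofReal_mul (p := 2) (by norm_num)]
        rw [ENNReal.ofReal_ofNat]; ring
    _ ≤ _ := by
        refine mul_le_mul' (ENNReal.ofReal_le_ofReal ?_) le_rfl
        have : 1 ≤ τ ^ (2 * ε) := Real.one_le_rpow hτ (by positivity)
        have : C1 ≤ C1 * τ ^ (2 * ε) := by nlinarith
        nlinarith
end

end KP

namespace KP

lemma lay1 (y : ℝ≥0∞) :
    ∫⁻ l in Set.Ioi (0 : ℝ), (if ENNReal.ofReal l < y then (1 : ℝ≥0∞) else 0) = y := by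
  have := layer_pt (p := 1) one_pos y
  simpa using this

lemma lay2 (c y : ℝ≥0∞) :
    ∫⁻ l in Set.Ioi (0 : ℝ), c * (if ENNReal.ofReal l < y then (1 : ℝ≥0∞) else 0) = c * y := by
  rw [lintegral_const_mul, lay1]
  exact Measurable.ite (measurableSet_lt ENNReal.measurable_ofReal measurable_const)
    measurable_const measurable_const

lemma opK_meas2 {d : ℕ} {k : KE d → ℂ} (hk : Continuous k) {g : KE d → ℂ} (hg : Measurable g)
    (φ : ℝ → ℝ) (hφ : Measurable φ) :
    Measurable fun q : ℝ × KE d => opK k (φ q.1) g q.2 :=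
  (opK_meas hk hg).comp (f := fun q : ℝ × KE d => (φ q.1, q.2))
    ((hφ.comp measurable_fst).prodMk measurable_snd)

lemma HI_meas2 {d : ℕ} (h : KE d → ℝ≥0∞) :
    Measurable fun q : ℝ × KE d => HI h (Real.exp q.1) q.2 :=
  (HI_measurable h).comp (f := fun q : ℝ × KE d => (Real.exp q.1, q.2))
    ((Real.measurable_exp.comp measurable_fst).prodMk measurable_snd)

lemma Best {d : ℕ} {k : KE d → ℂ} (hk : Canc k) {ε : ℝ} (hε : 0 < ε) (hε1 : ε ≤ 1) :
    ∃ C > (0 : ℝ), ∀ g : KE d → ℝ, Measurable g → (∀ x, 0 ≤ g x) → ∀ B : ℝ, (∀ x, g x ≤ B) →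
    ∀ τ : ℝ, 1 ≤ τ → ∀ h : KE d → ℝ≥0∞, Measurable h →
    ∫⁻ θ : ℝ, ∫⁻ y, ‖opK k (τ * Real.exp θ) (fun x => (g x : ℂ)) y‖ₑ ^ 2 * HI h (Real.exp θ) y ≤
      ENNReal.ofReal (C * τ ^ (2 * ε)) * ∫⁻ x, MF (fun z => ENNReal.ofReal (g z)) x ^ 2 * h x := by
  obtain ⟨C, hC, hh⟩ := carl_set hk hε hε1
  refine ⟨C, hC, fun g hg h0 B hB τ hτ h hm => ?_⟩
  set M := MF (fun z => ENNReal.ofReal (g z)) with hM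
  have mM : Measurable M := MF_measurable _
  set F : ℝ × KE d → ℝ≥0∞ := fun q =>
    ‖opK k (τ * Real.exp q.1) (fun x => (g x : ℂ)) q.2‖ₑ ^ 2 with hF
  have mF : Measurable F := by
    exact (opK_meas2 hk.1.1 (g := fun x => (g x : ℂ)) (Complex.measurable_ofReal.comp hg)
      (fun θ => τ * Real.exp θ) (by fun_prop)).enorm.pow_const 2
  set Hq : ℝ × KE d → ℝ≥0∞ := fun q => HI h (Real.exp q.1) q.2 with hHq
  have mH : Measurable Hq := by
    exact HI_meas2 h
  have mK : ∀ {α : Type} [MeasurableSpace α] (f : α → ℝ≥0∞), Measurable f →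
      Measurable fun z : α × ℝ => if ENNReal.ofReal z.2 < f z.1 then (1 : ℝ≥0∞) else 0 := by
    intro α _ f hf
    refine Measurable.ite ?_ measurable_const measurable_const
    exact measurableSet_lt (ENNReal.measurable_ofReal.comp measurable_snd) (hf.comp measurable_fst)
  have e1 : ∫⁻ θ : ℝ, ∫⁻ y, F (θ, y) * Hq (θ, y) =
      ∫⁻ l in Set.Ioi (0:ℝ), ∫⁻ θ : ℝ, ∫⁻ y, {q | ENNReal.ofReal l < Hq q}.indicator F (θ, y) := by
    rw [← lintegral_prod (fun q => F q * Hq q) (mF.mul mH).aemeasurable]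
    have : ∀ q, F q * Hq q = ∫⁻ l in Set.Ioi (0:ℝ), F q *
        (if ENNReal.ofReal l < Hq q then (1 : ℝ≥0∞) else 0) := fun q => by
      exact (lay2 _ _).symm
    simp_rw [this]
    rw [lintegral_lintegral_swap]
    · refine lintegral_congr fun l => ?_
      rw [← lintegral_prod]
      · refine lintegral_congr fun q => ?_
        by_cases hq : ENNReal.ofReal l < Hq q <;> simp [Set.indicator, hq]
      · exact (mF.indicator (measurableSet_lt measurable_const mH)).aemeasurable
    · exact ((mF.comp measurable_fst).mul (mK Hq mH)).aemeasurable
  have e2 : ∫⁻ x, M x ^ 2 * h x =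
      ∫⁻ l in Set.Ioi (0:ℝ), ∫⁻ x in {x | ENNReal.ofReal l < h x}, M x ^ 2 := by
    have : ∀ q, M q ^ 2 * h q = ∫⁻ l in Set.Ioi (0:ℝ), M q ^ 2 *
        (if ENNReal.ofReal l < h q then (1 : ℝ≥0∞) else 0) := fun q => by
      exact (lay2 _ _).symm
    simp_rw [this]
    rw [lintegral_lintegral_swap]
    · refine lintegral_congr fun l => ?_
      rw [← lintegral_indicator (measurableSet_lt measurable_const hm)]
      refine lintegral_congr fun q => ?_
      by_cases hq : ENNReal.ofReal l < h q <;> simp [Set.indicator, hq]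
    · exact (((mM.pow_const 2).comp measurable_fst).mul (mK h hm)).aemeasurable
  change ∫⁻ θ : ℝ, ∫⁻ y, F (θ, y) * Hq (θ, y) ≤ _
  rw [e1, e2, ← lintegral_const_mul' _ _ ENNReal.ofReal_ne_top]
  refine lintegral_mono fun l => ?_
  refine hh g hg h0 B hB τ hτ _ (measurableSet_lt measurable_const hm) _ fun q hq x hx => ?_
  exact lt_of_lt_of_le hq (HI_le hx)

end KP

namespace KP

lemma sqrt_sq (x : ℝ≥0∞) : (x ^ (1 / 2 : ℝ)) ^ 2 = x := by
  rw [← ENNReal.rpow_natCast, ← ENNReal.rpow_mul]; norm_num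

lemma cs2 {d : ℕ} {X P Q : ℝ × KE d → ℝ≥0∞} (hP : Measurable P) (hQ : Measurable Q)
    (h : ∀ q, X q ^ 2 ≤ P q * Q q) :
    (∫⁻ θ : ℝ, ∫⁻ y, X (θ, y)) ^ 2 ≤
      (∫⁻ θ : ℝ, ∫⁻ y, P (θ, y)) * ∫⁻ θ : ℝ, ∫⁻ y, Q (θ, y) := by
  have hX : ∀ q, X q ≤ P q ^ (1 / 2 : ℝ) * Q q ^ (1 / 2 : ℝ) := fun q => by
    rw [← ENNReal.mul_rpow_of_nonneg _ _ (by norm_num : (0:ℝ) ≤ 1 / 2)]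
    calc X q = (X q ^ 2) ^ (1 / 2 : ℝ) := by
          rw [← ENNReal.rpow_natCast, ← ENNReal.rpow_mul]; norm_num
      _ ≤ _ := ENNReal.rpow_le_rpow (h q) (by norm_num)
  have mP : Measurable fun q => P q ^ (1 / 2 : ℝ) := hP.pow_const _
  have mQ : Measurable fun q => Q q ^ (1 / 2 : ℝ) := hQ.pow_const _
  have h1 : ∫⁻ θ : ℝ, ∫⁻ y, X (θ, y) ≤
      ∫⁻ q : ℝ × KE d, P q ^ (1 / 2 : ℝ) * Q q ^ (1 / 2 : ℝ) := by
    rw [show (volume : Measure (ℝ × KE d)) = volume.prod volume from rfl,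
      lintegral_prod (fun q => P q ^ (1 / 2 : ℝ) * Q q ^ (1 / 2 : ℝ)) (mP.mul mQ).aemeasurable]
    exact lintegral_mono fun θ => lintegral_mono fun y => hX _
  calc _ ≤ _ := pow_le_pow_left' h1 2
    _ ≤ _ := cs mP.aemeasurable mQ.aemeasurable
    _ = _ := by
      simp_rw [sqrt_sq]
      rw [show (volume : Measure (ℝ × KE d)) = volume.prod volume from rfl,
        lintegral_prod _ hP.aemeasurable, lintegral_prod _ hQ.aemeasurable]

lemma eLp_pow {d : ℕ} {g : KE d → ℝ≥0∞} {s : ℝ≥0∞} (h0 : s ≠ 0) (hs : s ≠ ∞) :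
    ∫⁻ x, g x ^ s.toReal = eLpNorm g s volume ^ s.toReal := by
  have : 0 < s.toReal := ENNReal.toReal_pos h0 hs
  rw [eLpNorm_eq_lintegral_rpow_enorm_toReal h0 hs]
  simp only [enorm_eq_self]
  rw [← ENNReal.rpow_mul, one_div, inv_mul_cancel₀ this.ne', ENNReal.rpow_one]

lemma sq_split (x : ℝ≥0∞) {a : ℝ} (h0 : 0 ≤ a) (h2 : a ≤ 2) : x ^ a * x ^ (2 - a) = x ^ 2 := by
  rw [← ENNReal.rpow_add_of_nonneg _ _ h0 (by linarith), ← ENNReal.rpow_natCast]; norm_num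

/-- one function of Lebesgue exponent at most two (handled by `Aest`), the other by `Best`. -/
lemma tri_low {d : ℕ} {p q s : ℝ≥0∞} (hp : 1 < p) (hq : 1 < q) (hs : 1 < s)
    (hs2 : s ≤ 2) (h : p⁻¹ + q⁻¹ + s⁻¹ = 1) {k1 k2 : KE d → ℂ} (hk1 : Canc k1) (hk2 : Canc k2)
    {ε : ℝ} (hε : 0 < ε) (hε1 : ε ≤ 1) :
    ∃ K : ℝ≥0∞, K ≠ ∞ ∧ ∀ f w : KE d → ℝ, Measurable f → Measurable w →
      (∀ x, 0 ≤ f x) → (∀ x, 0 ≤ w x) → ∀ B, (∀ x, f x ≤ B) → (∀ x, w x ≤ B) →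
      ∀ V : ℝ × KE d → ℝ≥0∞, Measurable V → ∀ N : KE d → ℝ≥0∞, Measurable N →
      (∀ θ y, ∀ x ∈ Metric.ball y (Real.exp θ), V (θ, y) ≤ N x) → ∀ τ1 τ2 : ℝ, 1 ≤ τ1 → 1 ≤ τ2 →
      (∫⁻ θ : ℝ, ∫⁻ y, ‖opK k1 (τ1 * Real.exp θ) (fun x => (f x : ℂ)) y‖ₑ * V (θ, y) *
        ‖opK k2 (τ2 * Real.exp θ) (fun x => (w x : ℂ)) y‖ₑ) ^ 2 ≤
      K * ENNReal.ofReal (τ1 ^ (2 * ε)) *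
        (eLpNorm (fun x => ENNReal.ofReal (f x)) p volume * eLpNorm N q volume *
          eLpNorm (fun x => ENNReal.ofReal (w x)) s volume) ^ 2 := by
  have hst : s ≠ ∞ := ne_top_of_le_ne_top (by simp) hs2
  have hs0 : s ≠ 0 := (zero_lt_one.trans hs).ne'
  set a := s.toReal with ha
  have ha1 : 1 < a := by
    rw [ha, ← ENNReal.toReal_one]; exact (ENNReal.toReal_lt_toReal (by simp) hst).2 hs
  have ha2 : a ≤ 2 := by
    rw [ha]; exact ENNReal.toReal_le_of_le_ofReal (by norm_num) (by simpa using hs2)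
  obtain ⟨CA, hCA, hA⟩ := Aest hk2 ha1 ha2
  obtain ⟨CB, hCB, hBe⟩ := Best hk1 hε hε1
  obtain ⟨Cf, hCf, hMf⟩ := MF_eLpNorm (d := d) hp
  obtain ⟨Cw, hCw, hMw⟩ := MF_eLpNorm (d := d) hs
  have hexp : 2 * p⁻¹.toReal + 2 * q⁻¹.toReal + (2 - a) * s⁻¹.toReal = 1 := by
    have h' := congrArg ENNReal.toReal h
    have hpf : p⁻¹ ≠ ∞ := by simp [(zero_lt_one.trans hp).ne']
    have hqf : q⁻¹ ≠ ∞ := by simp [(zero_lt_one.trans hq).ne']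
    have hsf : s⁻¹ ≠ ∞ := by simp [hs0]
    rw [ENNReal.toReal_add (by simp [hpf, hqf]) hsf, ENNReal.toReal_add hpf hqf,
      ENNReal.toReal_one] at h'
    have : a * s⁻¹.toReal = 1 := by
      rw [ENNReal.toReal_inv]; exact mul_inv_cancel₀ (by linarith)
    linarith
  refine ⟨ENNReal.ofReal CA * ENNReal.ofReal CB * ENNReal.ofReal Cf ^ 2 *
    ENNReal.ofReal Cw ^ (2 - a), ?_, ?_⟩
  · refine ENNReal.mul_ne_top (by finiteness) ?_
    exact ENNReal.rpow_ne_top_of_nonneg (by linarith) ENNReal.ofReal_ne_top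
  intro f w hf hw hf0 hw0 B hfB hwB V hV N hN hVN τ1 τ2 hτ1 hτ2
  obtain ⟨E, mE, Efin, Eint, Ept⟩ := hA w hw hw0 B hwB
  set Mf := MF (fun z => ENNReal.ofReal (f z)) with hMfd
  set Mw := MF (fun z => ENNReal.ofReal (w z)) with hMwd
  have mMf : Measurable Mf := MF_measurable _
  have mMw : Measurable Mw := MF_measurable _
  have hτ20 : 0 < τ2 := by linarith
  set h0 : KE d → ℝ≥0∞ := fun x => N x ^ (2:ℝ) * Mw x ^ (2 - a) with hh0
  have mh : Measurable h0 := (hN.pow_const _).mul (mMw.pow_const _)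
  have mF : Measurable fun q : ℝ × KE d => ‖opK k1 (τ1 * Real.exp q.1) (fun x => (f x : ℂ)) q.2‖ₑ :=
    (opK_meas2 hk1.1.1 (g := fun x => (f x : ℂ)) (Complex.measurable_ofReal.comp hf)
      (fun θ => τ1 * Real.exp θ) (by fun_prop)).enorm
  have mP : Measurable fun q : ℝ × KE d => E (q.1 + Real.log τ2) q.2 :=
    mE.comp (f := fun q : ℝ × KE d => (q.1 + Real.log τ2, q.2)) (by fun_prop)
  have mQ : Measurable fun q : ℝ × KE d =>
      ‖opK k1 (τ1 * Real.exp q.1) (fun x => (f x : ℂ)) q.2‖ₑ ^ 2 * HI h0 (Real.exp q.1) q.2 :=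
    (mF.pow_const 2).mul (HI_meas2 h0)
  have key := cs2 (X := fun q : ℝ × KE d =>
    ‖opK k1 (τ1 * Real.exp q.1) (fun x => (f x : ℂ)) q.2‖ₑ * V q *
        ‖opK k2 (τ2 * Real.exp q.1) (fun x => (w x : ℂ)) q.2‖ₑ) mP mQ (by
    rintro ⟨θ, y⟩
    simp only
    rw [← mul_assoc]
    refine le_mul_HI (Real.exp_pos θ) (ENNReal.mul_ne_top (Efin _ _) (by finiteness)) fun x hx => ?_
    have e : Real.exp (θ + Real.log τ2) = τ2 * Real.exp θ := by
      rw [Real.exp_add, Real.exp_log hτ20, mul_comm]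
    have h1 := Ept (θ + Real.log τ2) y x (by
      rw [e]; refine Metric.ball_subset_ball ?_ hx
      nlinarith [Real.exp_pos θ])
    rw [e] at h1
    have h2 := pow_le_pow_left' (hVN θ y x hx) 2
    calc _ = ‖opK k1 (τ1 * Real.exp θ) (fun x => (f x : ℂ)) y‖ₑ ^ 2 * V (θ, y) ^ 2 *
          ‖opK k2 (τ2 * Real.exp θ) (fun x => (w x : ℂ)) y‖ₑ ^ 2 := by ring
      _ ≤ ‖opK k1 (τ1 * Real.exp θ) (fun x => (f x : ℂ)) y‖ₑ ^ 2 * N x ^ 2 *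
          (E (θ + Real.log τ2) y * Mw x ^ (2 - a)) := by gcongr
      _ = _ := by
        rw [hh0]; simp only
        rw [show N x ^ (2:ℝ) = N x ^ 2 by rw [← ENNReal.rpow_natCast]; norm_num]; ring)
  refine key.trans ?_
  have hP : ∫⁻ θ : ℝ, ∫⁻ y, E (θ + Real.log τ2) y ≤ ENNReal.ofReal CA *
      eLpNorm (fun x => ENNReal.ofReal (w x)) s volume ^ a := by
    rw [lintegral_add_right_eq_self (fun θ => ∫⁻ y, E θ y)]
    refine Eint.trans (le_of_eq ?_)
    rw [ha, ← eLp_pow hs0 hst]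
  have hQ : ∫⁻ θ : ℝ, ∫⁻ y, ‖opK k1 (τ1 * Real.exp θ) (fun x => (f x : ℂ)) y‖ₑ ^ 2 *
      HI h0 (Real.exp θ) y ≤ ENNReal.ofReal CB * ENNReal.ofReal (τ1 ^ (2 * ε)) *
        ((ENNReal.ofReal Cf * eLpNorm (fun x => ENNReal.ofReal (f x)) p volume) ^ 2 *
        eLpNorm N q volume ^ 2 *
        (ENNReal.ofReal Cw * eLpNorm (fun x => ENNReal.ofReal (w x)) s volume) ^ (2 - a)) := by
    refine (hBe f hf hf0 B hfB τ1 hτ1 h0 mh).trans ?_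
    rw [ENNReal.ofReal_mul hCB.le]
    refine mul_le_mul' le_rfl ?_
    have hol := holder3 mMf hN mMw (zero_lt_one.trans hp).ne' (zero_lt_one.trans hq).ne' hs0
      (by norm_num : (0:ℝ) ≤ 2) (by norm_num : (0:ℝ) ≤ 2) (by linarith : (0:ℝ) ≤ 2 - a) hexp
    have e2 : ∀ x : ℝ≥0∞, x ^ (2 : ℝ) = x ^ 2 := fun x => by
      rw [← ENNReal.rpow_natCast]; norm_num
    simp only [e2] at hol
    calc _ = ∫⁻ x, Mf x ^ 2 * N x ^ 2 * Mw x ^ (2 - a) := by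
          refine lintegral_congr fun x => ?_
          rw [hh0]; simp only [e2]; ring
      _ ≤ _ := hol
      _ ≤ _ := by
        have i1 := hMf (fun z => ENNReal.ofReal (f z)) (ENNReal.measurable_ofReal.comp hf)
        have i2 := hMw (fun z => ENNReal.ofReal (w z)) (ENNReal.measurable_ofReal.comp hw)
        have i3 := ENNReal.rpow_le_rpow i2 (by linarith : (0:ℝ) ≤ 2 - a)
        gcongr
  refine (mul_le_mul' hP hQ).trans (le_of_eq ?_)
  have := sq_split (eLpNorm (fun x => ENNReal.ofReal (w x)) s volume) (by linarith) ha2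
  rw [ENNReal.mul_rpow_of_nonneg _ _ (by linarith : (0:ℝ) ≤ 2 - a), mul_pow _ _ 2,
    mul_pow _ (eLpNorm (fun x => ENNReal.ofReal (w x)) s volume) 2, ← this]
  ring

/-- both exponents larger than two -/
lemma tri_high {d : ℕ} {p q s : ℝ≥0∞} (hp : 1 < p) (hq : 1 < q) (hs : 1 < s)
    (hp2 : 2 < p) (hs2 : 2 < s) (h : p⁻¹ + q⁻¹ + s⁻¹ = 1) {k1 k2 : KE d → ℂ} (hk1 : Canc k1)
    (hk2 : Canc k2) {ε : ℝ} (hε : 0 < ε) (hε1 : ε ≤ 1) :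
    ∃ K : ℝ≥0∞, K ≠ ∞ ∧ ∀ f w : KE d → ℝ, Measurable f → Measurable w →
      (∀ x, 0 ≤ f x) → (∀ x, 0 ≤ w x) → ∀ B, (∀ x, f x ≤ B) → (∀ x, w x ≤ B) →
      ∀ V : ℝ × KE d → ℝ≥0∞, Measurable V → ∀ N : KE d → ℝ≥0∞, Measurable N →
      (∀ θ y, ∀ x ∈ Metric.ball y (Real.exp θ), V (θ, y) ≤ N x) → ∀ τ1 τ2 : ℝ, 1 ≤ τ1 → 1 ≤ τ2 →
      (∫⁻ θ : ℝ, ∫⁻ y, ‖opK k1 (τ1 * Real.exp θ) (fun x => (f x : ℂ)) y‖ₑ * V (θ, y) *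
        ‖opK k2 (τ2 * Real.exp θ) (fun x => (w x : ℂ)) y‖ₑ) ^ 2 ≤
      K * (ENNReal.ofReal (τ1 ^ (2 * ε)) * ENNReal.ofReal (τ2 ^ (2 * ε))) *
        (eLpNorm (fun x => ENNReal.ofReal (f x)) p volume * eLpNorm N q volume *
          eLpNorm (fun x => ENNReal.ofReal (w x)) s volume) ^ 2 := by
  have hp0 : p ≠ 0 := (zero_lt_one.trans hp).ne'
  have hq0 : q ≠ 0 := (zero_lt_one.trans hq).ne'
  have hs0 : s ≠ 0 := (zero_lt_one.trans hs).ne'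
  have hpf : p⁻¹ ≠ ∞ := by simp [hp0]
  have hqf : q⁻¹ ≠ ∞ := by simp [hq0]
  have hsf : s⁻¹ ≠ ∞ := by simp [hs0]
  have hsum : p⁻¹.toReal + q⁻¹.toReal + s⁻¹.toReal = 1 := by
    have h' := congrArg ENNReal.toReal h
    rwa [ENNReal.toReal_add (by simp [hpf, hqf]) hsf, ENNReal.toReal_add hpf hqf,
      ENNReal.toReal_one] at h'
  have half : ∀ z : ℝ≥0∞, 2 < z → z⁻¹.toReal < 1 / 2 := fun z hz => by
    have : z⁻¹ < 2⁻¹ := ENNReal.inv_lt_inv.2 hz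
    have := (ENNReal.toReal_lt_toReal (by simp [(zero_lt_two.trans hz).ne']) (by simp)).2 this
    rw [show (2⁻¹ : ℝ≥0∞).toReal = 1 / 2 by rw [ENNReal.toReal_inv]; norm_num] at this
    exact this
  have hP2 := half p hp2
  have hS2 := half s hs2
  set P := p⁻¹.toReal
  set Q := q⁻¹.toReal
  set S := s⁻¹.toReal
  have hQ0 : 0 < Q := by linarith
  set α := (1 - 2 * P) / Q with hα
  have hα0 : 0 ≤ α := div_nonneg (by linarith) hQ0.le
  have hα2 : α ≤ 2 := by rw [hα, div_le_iff₀ hQ0]; linarith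
  have hαQ : α * Q = 1 - 2 * P := div_mul_cancel₀ _ hQ0.ne'
  obtain ⟨C1, hC1, hB1⟩ := Best hk1 hε hε1
  obtain ⟨C2, hC2, hB2⟩ := Best hk2 hε hε1
  obtain ⟨Cf, hCf, hMf⟩ := MF_eLpNorm (d := d) hp
  obtain ⟨Cw, hCw, hMw⟩ := MF_eLpNorm (d := d) hs
  refine ⟨ENNReal.ofReal C1 * ENNReal.ofReal C2 * ENNReal.ofReal Cf ^ 2 *
    ENNReal.ofReal Cw ^ 2, by finiteness, ?_⟩
  intro f w hf hw hf0 hw0 B hfB hwB V hV N hN hVN τ1 τ2 hτ1 hτ2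
  have e2 : ∀ x : ℝ≥0∞, x ^ (2 : ℝ) = x ^ 2 := fun x => by
    rw [← ENNReal.rpow_natCast]; norm_num
  have gen : ∀ (k : KE d → ℂ), Canc k → ∀ g : KE d → ℝ, Measurable g → ∀ τ : ℝ, ∀ β : ℝ,
      Measurable fun q : ℝ × KE d => ‖opK k (τ * Real.exp q.1) (fun x => (g x : ℂ)) q.2‖ₑ ^ 2 *
        HI (fun x => N x ^ β) (Real.exp q.1) q.2 := by
    intro k hk g hg τ β
    exact ((opK_meas2 hk.1.1 (g := fun x => (g x : ℂ)) (Complex.measurable_ofReal.comp hg)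
      (fun θ => τ * Real.exp θ) (by fun_prop)).enorm.pow_const 2).mul (HI_meas2 _)
  have vh : ∀ θ y (β : ℝ), 0 ≤ β → V (θ, y) ^ β ≤ HI (fun x => N x ^ β) (Real.exp θ) y := by
    intro θ y β hβ
    exact le_iInf₂ fun x hx => ENNReal.rpow_le_rpow (hVN θ y x hx) hβ
  have key := cs2 (X := fun q : ℝ × KE d =>
    ‖opK k1 (τ1 * Real.exp q.1) (fun x => (f x : ℂ)) q.2‖ₑ * V q *
        ‖opK k2 (τ2 * Real.exp q.1) (fun x => (w x : ℂ)) q.2‖ₑ) (gen k1 hk1 f hf τ1 α)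
        (gen k2 hk2 w hw τ2 (2 - α)) (by
    rintro ⟨θ, y⟩
    simp only
    have v1 := vh θ y α hα0
    have v2 := vh θ y (2 - α) (by linarith)
    rw [mul_pow, mul_pow, ← sq_split (V (θ, y)) hα0 hα2]
    calc _ = (‖opK k1 (τ1 * Real.exp θ) (fun x => (f x : ℂ)) y‖ₑ ^ 2 * V (θ, y) ^ α) *
          (‖opK k2 (τ2 * Real.exp θ) (fun x => (w x : ℂ)) y‖ₑ ^ 2 * V (θ, y) ^ (2 - α)) := by ring
      _ ≤ _ := by gcongr)
  refine key.trans ?_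
  have fin : ∀ (k : KE d → ℂ) (C : ℝ) (g : KE d → ℝ) (τ β C' : ℝ) (p' : ℝ≥0∞), Measurable g →
      0 ≤ C → 0 ≤ β → p' ≠ 0 → 2 * p'⁻¹.toReal + β * Q = 1 →
      ∫⁻ θ : ℝ, ∫⁻ y, ‖opK k (τ * Real.exp θ) (fun x => (g x : ℂ)) y‖ₑ ^ 2 *
        HI (fun x => N x ^ β) (Real.exp θ) y ≤
      ENNReal.ofReal (C * τ ^ (2 * ε)) *
        ∫⁻ x, MF (fun z => ENNReal.ofReal (g z)) x ^ 2 * (fun x => N x ^ β) x →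
      eLpNorm (MF fun x => ENNReal.ofReal (g x)) p' volume ≤
        ENNReal.ofReal C' * eLpNorm (fun x => ENNReal.ofReal (g x)) p' volume →
      ∫⁻ θ : ℝ, ∫⁻ y, ‖opK k (τ * Real.exp θ) (fun x => (g x : ℂ)) y‖ₑ ^ 2 *
        HI (fun x => N x ^ β) (Real.exp θ) y ≤ ENNReal.ofReal C * ENNReal.ofReal (τ ^ (2 * ε)) *
        ((ENNReal.ofReal C' * eLpNorm (fun x => ENNReal.ofReal (g x)) p' volume) ^ 2 *
        eLpNorm N q volume ^ β) := by
    intro k C g τ β C' p' hg hC hβ hp' hsum' hb hM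
    refine hb.trans ?_
    rw [ENNReal.ofReal_mul hC]
    refine mul_le_mul' le_rfl ?_
    have hol := holder3 (MF_measurable fun z => ENNReal.ofReal (g z)) hN hN hp' hq0 hq0
      (by norm_num : (0:ℝ) ≤ 2) hβ le_rfl (κ := 0) (by rw [zero_mul, add_zero]; exact hsum')
    simp only [e2, ENNReal.rpow_zero, mul_one] at hol
    refine hol.trans ?_
    gcongr
  have r1 := fin k1 C1 f τ1 α Cf p hf hC1.le hα0 hp0 (by linarith)
    (hB1 f hf hf0 B hfB τ1 hτ1 _ (hN.pow_const _)) (hMf _ (ENNReal.measurable_ofReal.comp hf))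
  have r2 := fin k2 C2 w τ2 (2 - α) Cw s hw hC2.le (by linarith) hs0 (by linarith)
    (hB2 w hw hw0 B hwB τ2 hτ2 _ (hN.pow_const _)) (hMw _ (ENNReal.measurable_ofReal.comp hw))
  refine (mul_le_mul' r1 r2).trans (le_of_eq ?_)
  have := sq_split (eLpNorm N q volume) hα0 hα2
  rw [mul_pow (eLpNorm (fun x => ENNReal.ofReal (f x)) p volume * eLpNorm N q volume), mul_pow _ (eLpNorm N q volume) 2, ← this]
  ring

end KP

namespace KP

lemma le_of_sq {X K c Y : ℝ≥0∞} (h : X ^ 2 ≤ K * c ^ 2 * Y ^ 2) :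
    X ≤ K ^ (1 / 2 : ℝ) * c * Y := by
  have h2 := ENNReal.rpow_le_rpow h (by norm_num : (0 : ℝ) ≤ 1 / 2)
  have e : ∀ z : ℝ≥0∞, (z ^ 2) ^ (1 / 2 : ℝ) = z := fun z => by
    rw [← ENNReal.rpow_natCast, ← ENNReal.rpow_mul]; norm_num
  rwa [ENNReal.mul_rpow_of_nonneg _ _ (by norm_num), ENNReal.mul_rpow_of_nonneg _ _ (by norm_num),
    e, e, e] at h2

lemma tri_real {d : ℕ} {p q s : ℝ≥0∞} (hp : 1 < p) (hq : 1 < q) (hs : 1 < s)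
    (h : p⁻¹ + q⁻¹ + s⁻¹ = 1) {k1 k2 : KE d → ℂ} (hk1 : Canc k1) (hk2 : Canc k2)
    {ε : ℝ} (hε : 0 < ε) (hε1 : ε ≤ 1) :
    ∃ K : ℝ≥0∞, K ≠ ∞ ∧ ∀ f w : KE d → ℝ, Measurable f → Measurable w →
      (∀ x, 0 ≤ f x) → (∀ x, 0 ≤ w x) → ∀ B, (∀ x, f x ≤ B) → (∀ x, w x ≤ B) →
      ∀ V : ℝ × KE d → ℝ≥0∞, Measurable V → ∀ N : KE d → ℝ≥0∞, Measurable N →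
      (∀ θ y, ∀ x ∈ Metric.ball y (Real.exp θ), V (θ, y) ≤ N x) → ∀ τ : ℝ, 1 ≤ τ →
      ∫⁻ θ : ℝ, ∫⁻ y, ‖opK k1 (Real.exp θ) (fun x => (f x : ℂ)) y‖ₑ * V (θ, y) *
        ‖opK k2 (τ * Real.exp θ) (fun x => (w x : ℂ)) y‖ₑ ≤
      K * ENNReal.ofReal (τ ^ ε) *
        (eLpNorm (fun x => ENNReal.ofReal (f x)) p volume * eLpNorm N q volume *
          eLpNorm (fun x => ENNReal.ofReal (w x)) s volume) := by
  have esq : ∀ τ : ℝ, 1 ≤ τ → ENNReal.ofReal (τ ^ (2 * ε)) = ENNReal.ofReal (τ ^ ε) ^ 2 := by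
    intro τ hτ
    rw [← ENNReal.ofReal_pow (by positivity), mul_comm, Real.rpow_mul (by linarith)]
    norm_num
  have ge1 : ∀ τ : ℝ, 1 ≤ τ → 1 ≤ ENNReal.ofReal (τ ^ ε) ^ 2 := by
    intro τ hτ
    have : (1 : ℝ≥0∞) ≤ ENNReal.ofReal (τ ^ ε) := by
      rw [← ENNReal.ofReal_one]; exact ENNReal.ofReal_le_ofReal (Real.one_le_rpow hτ hε.le)
    exact one_le_pow₀ this
  have sfin : ∀ K : ℝ≥0∞, K ≠ ∞ → K ^ (1 / 2 : ℝ) ≠ ∞ := fun K hK =>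
    ENNReal.rpow_ne_top_of_nonneg (by norm_num) hK
  by_cases hs2 : s ≤ 2
  · obtain ⟨K, hK, H⟩ := tri_low hp hq hs hs2 h hk1 hk2 hε hε1
    refine ⟨_, sfin K hK, ?_⟩
    intro f w hf hw hf0 hw0 B hfB hwB V hV N hN hVN τ hτ
    refine le_of_sq ?_
    have := H f w hf hw hf0 hw0 B hfB hwB V hV N hN hVN 1 τ le_rfl hτ
    simp only [one_mul, Real.one_rpow, ENNReal.ofReal_one, mul_one] at this
    refine this.trans (mul_le_mul' ?_ le_rfl)
    exact le_mul_of_one_le_right' (ge1 τ hτ)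
  by_cases hp2 : p ≤ 2
  · obtain ⟨K, hK, H⟩ := tri_low hs hq hp hp2 (by rw [← h]; ring) hk2 hk1 hε hε1
    refine ⟨_, sfin K hK, ?_⟩
    intro f w hf hw hf0 hw0 B hfB hwB V hV N hN hVN τ hτ
    refine le_of_sq ?_
    have := H w f hw hf hw0 hf0 B hwB hfB V hV N hN hVN τ 1 hτ le_rfl
    simp only [one_mul] at this
    rw [esq τ hτ] at this
    convert this using 2
    · refine lintegral_congr fun θ => lintegral_congr fun y => ?_
      ring
    · ring
  · push Not at hs2 hp2
    obtain ⟨K, hK, H⟩ := tri_high hp hq hs hp2 hs2 h hk1 hk2 hε hε1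
    refine ⟨_, sfin K hK, ?_⟩
    intro f w hf hw hf0 hw0 B hfB hwB V hV N hN hVN τ hτ
    refine le_of_sq ?_
    have := H f w hf hw hf0 hw0 B hfB hwB V hV N hN hVN 1 τ le_rfl hτ
    simp only [one_mul, Real.one_rpow, ENNReal.ofReal_one] at this
    rw [esq τ hτ] at this
    exact this

lemma int4 {d : ℕ} {a b c e : KE d → ℂ} (ha : Integrable a) (hb : Integrable b)
    (hc : Integrable c) (he : Integrable e) :
    ∫ x, (a x - b x + Complex.I * c x - Complex.I * e x) =
      (∫ x, a x) - (∫ x, b x) + Complex.I * (∫ x, c x) - Complex.I * ∫ x, e x := by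
  have h1 : Integrable fun x => a x - b x := ha.sub hb
  have h2 : Integrable fun x => Complex.I * c x := hc.const_mul _
  have h3 : Integrable fun x => Complex.I * e x := he.const_mul _
  have h4 : Integrable fun x => a x - b x + Complex.I * c x := h1.add h2
  rw [integral_sub h4 h3, integral_add h1 h2, integral_sub ha hb, integral_const_mul,
    integral_const_mul]

lemma sum_swap {d : ℕ} {ι : Type} [Fintype ι] {G : ι → ℝ × KE d → ℝ≥0∞}
    (hG : ∀ i, Measurable (G i)) :
    ∫⁻ θ : ℝ, ∫⁻ y, ∑ i, G i (θ, y) = ∑ i, ∫⁻ θ : ℝ, ∫⁻ y, G i (θ, y) := by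
  rw [← lintegral_finsetSum _ fun z _ => (hG z).lintegral_prod_right']
  refine lintegral_congr fun θ => ?_
  have : ∀ i, Measurable fun y => G i (θ, y) := fun i => (hG i).comp measurable_prodMk_left
  rw [← lintegral_finsetSum _ fun z _ => this z]

lemma four_parts {d : ℕ} {f : KE d → ℂ} (hf : Measurable f) {B : ℝ} (hB : ∀ x, ‖f x‖ ≤ B) :
    ∃ g : Fin 4 → KE d → ℝ, (∀ i, Measurable (g i)) ∧ (∀ i x, 0 ≤ g i x) ∧
      (∀ i x, g i x ≤ ‖f x‖) ∧ ∀ k : KE d → ℂ, Decay k → ∀ t : ℝ, 0 < t → ∀ y,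
      ‖opK k t f y‖ₑ ≤ ∑ i, ‖opK k t (fun x => (g i x : ℂ)) y‖ₑ := by
  refine ⟨![fun x => max (f x).re 0, fun x => max (-(f x).re) 0, fun x => max (f x).im 0,
    fun x => max (-(f x).im) 0], ?_, ?_, ?_, ?_⟩
  · intro i; fin_cases i <;> simp <;> fun_prop
  · intro i x; fin_cases i <;> simp
  · intro i x
    have h1 := Complex.abs_re_le_norm (f x)
    have h2 := Complex.abs_im_le_norm (f x)
    rw [abs_le] at h1 h2
    fin_cases i <;> simp <;> linarith [norm_nonneg (f x)]
  · intro k hk t ht y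
    have I : ∀ g : KE d → ℝ, Measurable g → (∀ x, |g x| ≤ ‖f x‖) →
        Integrable fun x => ks k t (y - x) * ((g x : ℝ) : ℂ) := fun g hg hgB =>
      opK_int hk (g := fun x => (g x : ℂ)) (Complex.measurable_ofReal.comp hg) (B := B)
        (fun x => by rw [Complex.norm_real]; exact (hgB x).trans (hB x)) ht y
    have hre := fun x => Complex.abs_re_le_norm (f x)
    have him := fun x => Complex.abs_im_le_norm (f x)
    have b1 : ∀ a c : ℝ, |a| ≤ c → |max a 0| ≤ c := fun a c h => by
      rw [abs_of_nonneg (le_max_right _ _)]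
      exact max_le ((le_abs_self a).trans h) ((abs_nonneg a).trans h)
    have J1 := I (fun x => max (f x).re 0) (by fun_prop) (fun x => b1 _ _ (hre x))
    have J2 := I (fun x => max (-(f x).re) 0) (by fun_prop) (fun x => b1 _ _ (by rw [abs_neg]; exact hre x))
    have J3 := I (fun x => max (f x).im 0) (by fun_prop) (fun x => b1 _ _ (him x))
    have J4 := I (fun x => max (-(f x).im) 0) (by fun_prop) (fun x => b1 _ _ (by rw [abs_neg]; exact him x))
    have e : opK k t f y = opK k t (fun x => ((max (f x).re 0 : ℝ) : ℂ)) y -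
        opK k t (fun x => ((max (-(f x).re) 0 : ℝ) : ℂ)) y +
        Complex.I * opK k t (fun x => ((max (f x).im 0 : ℝ) : ℂ)) y -
        Complex.I * opK k t (fun x => ((max (-(f x).im) 0 : ℝ) : ℂ)) y := by
      unfold opK
      beta_reduce
      rw [← int4 J1 J2 J3 J4]
      refine integral_congr_ae (Filter.Eventually.of_forall fun x => ?_)
      have m : ∀ a : ℝ, max a 0 - max (-a) 0 = a := fun a => by
        rcases le_total a 0 with h | h
        · rw [max_eq_right h, max_eq_left (by linarith)]; ring
        · rw [max_eq_left h, max_eq_right (by linarith)]; ring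
      have hfx : f x = ((max (f x).re 0 - max (-(f x).re) 0 : ℝ) : ℂ) +
          Complex.I * ((max (f x).im 0 - max (-(f x).im) 0 : ℝ) : ℂ) := by
        rw [m, m, mul_comm]; exact (Complex.re_add_im (f x)).symm
      beta_reduce
      conv_lhs => rw [hfx]
      push_cast; ring
    rw [e, Fin.sum_univ_four]
    simp only [Matrix.cons_val]
    have nI : ∀ z : ℂ, ‖Complex.I * z‖ₑ = ‖z‖ₑ := fun z => by
      rw [enorm_mul]; simp [← ofReal_norm]
    refine (enorm_sub_le).trans ?_
    rw [nI]
    refine add_le_add ((enorm_add_le _ _).trans ?_) le_rfl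
    rw [nI]
    refine add_le_add enorm_sub_le le_rfl

lemma tri_cplx {d : ℕ} {p q s : ℝ≥0∞} (hp : 1 < p) (hq : 1 < q) (hs : 1 < s)
    (h : p⁻¹ + q⁻¹ + s⁻¹ = 1) {k1 k2 : KE d → ℂ} (hk1 : Canc k1) (hk2 : Canc k2)
    {ε : ℝ} (hε : 0 < ε) (hε1 : ε ≤ 1) :
    ∃ K : ℝ≥0∞, K ≠ ∞ ∧ ∀ f w : KE d → ℂ, Measurable f → Measurable w →
      ∀ B, (∀ x, ‖f x‖ ≤ B) → (∀ x, ‖w x‖ ≤ B) →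
      ∀ V : ℝ × KE d → ℝ≥0∞, Measurable V → ∀ N : KE d → ℝ≥0∞, Measurable N →
      (∀ θ y, ∀ x ∈ Metric.ball y (Real.exp θ), V (θ, y) ≤ N x) → ∀ τ : ℝ, 1 ≤ τ →
      ∫⁻ θ : ℝ, ∫⁻ y, ‖opK k1 (Real.exp θ) f y‖ₑ * V (θ, y) * ‖opK k2 (τ * Real.exp θ) w y‖ₑ ≤
      K * ENNReal.ofReal (τ ^ ε) *
        (eLpNorm f p volume * eLpNorm N q volume * eLpNorm w s volume) := by
  obtain ⟨K, hK, H⟩ := tri_real hp hq hs h hk1 hk2 hε hε1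
  refine ⟨16 * K, by finiteness, ?_⟩
  intro f w hf hw B hfB hwB V hV N hN hVN τ hτ
  obtain ⟨fi, mfi, fi0, fin, fiop⟩ := four_parts hf hfB
  obtain ⟨wi, mwi, wi0, win, wiop⟩ := four_parts hw hwB
  have hτ0 : 0 < τ := by linarith
  have m1 : ∀ i, Measurable fun q : ℝ × KE d => ‖opK k1 (Real.exp q.1) (fun x => (fi i x : ℂ)) q.2‖ₑ :=
    fun i => (opK_meas2 hk1.1.1 (g := fun x => (fi i x : ℂ)) (Complex.measurable_ofReal.comp (mfi i))
      (fun θ => Real.exp θ) (by fun_prop)).enorm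
  have m2 : ∀ i, Measurable fun q : ℝ × KE d =>
      ‖opK k2 (τ * Real.exp q.1) (fun x => (wi i x : ℂ)) q.2‖ₑ :=
    fun i => (opK_meas2 hk2.1.1 (g := fun x => (wi i x : ℂ)) (Complex.measurable_ofReal.comp (mwi i))
      (fun θ => τ * Real.exp θ) (by fun_prop)).enorm
  have m3 : ∀ z : Fin 4 × Fin 4, Measurable fun q : ℝ × KE d =>
      ‖opK k1 (Real.exp q.1) (fun x => (fi z.1 x : ℂ)) q.2‖ₑ * V q *
      ‖opK k2 (τ * Real.exp q.1) (fun x => (wi z.2 x : ℂ)) q.2‖ₑ :=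
    fun z => ((m1 z.1).mul hV).mul (m2 z.2)
  calc ∫⁻ θ : ℝ, ∫⁻ y, ‖opK k1 (Real.exp θ) f y‖ₑ * V (θ, y) * ‖opK k2 (τ * Real.exp θ) w y‖ₑ
      ≤ ∫⁻ θ : ℝ, ∫⁻ y, ∑ z : Fin 4 × Fin 4,
        ‖opK k1 (Real.exp θ) (fun x => (fi z.1 x : ℂ)) y‖ₑ * V (θ, y) *
        ‖opK k2 (τ * Real.exp θ) (fun x => (wi z.2 x : ℂ)) y‖ₑ := by
        refine lintegral_mono fun θ => lintegral_mono fun y => ?_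
        refine (mul_le_mul' (mul_le_mul' (fiop k1 hk1.1 _ (Real.exp_pos θ) y) le_rfl)
          (wiop k2 hk2.1 _ (mul_pos hτ0 (Real.exp_pos θ)) y)).trans (le_of_eq ?_)
        rw [Finset.sum_mul, Finset.sum_mul_sum, Fintype.sum_prod_type]
    _ = ∑ z : Fin 4 × Fin 4, ∫⁻ θ : ℝ, ∫⁻ y,
        ‖opK k1 (Real.exp θ) (fun x => (fi z.1 x : ℂ)) y‖ₑ * V (θ, y) *
        ‖opK k2 (τ * Real.exp θ) (fun x => (wi z.2 x : ℂ)) y‖ₑ := by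
        exact sum_swap m3
    _ ≤ ∑ z : Fin 4 × Fin 4, K * ENNReal.ofReal (τ ^ ε) *
        (eLpNorm f p volume * eLpNorm N q volume * eLpNorm w s volume) := by
        refine Finset.sum_le_sum fun z _ => ?_
        refine (H (fi z.1) (wi z.2) (mfi _) (mwi _) (fi0 _) (wi0 _) B (fun x => (fin _ x).trans (hfB x))
          (fun x => (win _ x).trans (hwB x)) V hV N hN hVN τ hτ).trans ?_
        have n1 : eLpNorm (fun x => ENNReal.ofReal (fi z.1 x)) p volume ≤ eLpNorm f p volume :=
          eLpNorm_mono_enorm fun x => by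
            rw [enorm_eq_self, ← ofReal_norm]; exact ENNReal.ofReal_le_ofReal (fin _ x)
        have n2 : eLpNorm (fun x => ENNReal.ofReal (wi z.2 x)) s volume ≤ eLpNorm w s volume :=
          eLpNorm_mono_enorm fun x => by
            rw [enorm_eq_self, ← ofReal_norm]; exact ENNReal.ofReal_le_ofReal (win _ x)
        gcongr
    _ = _ := by
        rw [Finset.sum_const]
        simp only [Finset.card_univ, Fintype.card_prod, Fintype.card_fin, nsmul_eq_mul]
        push_cast; ring

end KP

namespace KP

lemma opK_MF {d : ℕ} {k : KE d → ℂ} (hk : Decay k) : ∃ C > (0 : ℝ), ∀ v : KE d → ℂ, Measurable v →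
    ∀ t : ℝ, 0 < t → ∀ y, ∀ x ∈ Metric.ball y t,
      ‖opK k t v y‖ₑ ≤ ENNReal.ofReal C * MF (fun z => ‖v z‖ₑ) x := by
  obtain ⟨C1, hC1, h1⟩ := ks_bd1 hk
  obtain ⟨C2, hC2, h2⟩ := kb_dom (d := d)
  refine ⟨C1 * C2, by positivity, fun v hv t ht y x hx => ?_⟩
  calc ‖opK k t v y‖ₑ ≤ ∫⁻ z, ‖ks k t (y - z) * v z‖ₑ := enorm_integral_le_lintegral_enorm _
    _ ≤ ∫⁻ z, ENNReal.ofReal C1 * (ENNReal.ofReal (kb t (y - z)) * ‖v z‖ₑ) := by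
        refine lintegral_mono fun z => ?_
        rw [enorm_mul, ← mul_assoc, ← ENNReal.ofReal_mul hC1.le, ← ofReal_norm (ks k t (y - z))]
        exact mul_le_mul' (ENNReal.ofReal_le_ofReal (h1 t ht _)) le_rfl
    _ = ENNReal.ofReal C1 * ∫⁻ z, ENNReal.ofReal (kb t (y - z)) * ‖v z‖ₑ :=
        lintegral_const_mul' _ _ ENNReal.ofReal_ne_top
    _ ≤ ENNReal.ofReal C1 * (ENNReal.ofReal C2 * MF (fun z => ‖v z‖ₑ) x) :=
        mul_le_mul' le_rfl (h2 _ hv.enorm t ht x y hx)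
    _ = _ := by rw [ENNReal.ofReal_mul hC1.le, mul_assoc]

lemma tri_final {d : ℕ} {p q s : ℝ≥0∞} (hp : 1 < p) (hq : 1 < q) (hs : 1 < s)
    (h : p⁻¹ + q⁻¹ + s⁻¹ = 1) {k1 k2 k3 : KE d → ℂ} (hk1 : Canc k1) (hk2 : Canc k2)
    (hk3 : Decay k3) {γ : ℝ} (hγ : 0 < γ) :
    ∃ K : ℝ≥0∞, K ≠ ∞ ∧ ∀ f w v : KE d → ℂ, Measurable f → Measurable w → Measurable v →
      ∀ B, (∀ x, ‖f x‖ ≤ B) → (∀ x, ‖w x‖ ≤ B) →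
      ∫⁻ β in Set.Ici (0 : ℝ), ENNReal.ofReal (Real.exp (-(γ * β))) *
        ∫⁻ θ : ℝ, ∫⁻ y, ‖opK k1 (Real.exp θ) f y‖ₑ * ‖opK k3 (Real.exp θ) v y‖ₑ *
          ‖opK k2 (Real.exp β * Real.exp θ) w y‖ₑ ≤
      K * (eLpNorm f p volume * eLpNorm v q volume * eLpNorm w s volume) := by
  set ε := min (γ / 2) 1 with hεd
  have hε : 0 < ε := lt_min (by positivity) one_pos
  have hεγ : 0 < γ - ε := by have := min_le_left (γ / 2) 1; linarith
  obtain ⟨K, hK, H⟩ := tri_cplx hp hq hs h hk1 hk2 hε (min_le_right _ _)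
  obtain ⟨C, hC, hV⟩ := opK_MF hk3
  obtain ⟨Cq, hCq, hM⟩ := MF_eLpNorm (d := d) hq
  refine ⟨ENNReal.ofReal ((γ - ε)⁻¹) * (K * (ENNReal.ofReal C * ENNReal.ofReal Cq)), by finiteness, ?_⟩
  intro f w v hf hw hv B hfB hwB
  set N : KE d → ℝ≥0∞ := fun x => ENNReal.ofReal C * MF (fun z => ‖v z‖ₑ) x with hN
  have mN : Measurable N := (MF_measurable _).const_mul _
  have hNq : eLpNorm N q volume ≤ ENNReal.ofReal C * ENNReal.ofReal Cq * eLpNorm v q volume := by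
    have e : eLpNorm N q volume ≤ ENNReal.ofReal C * eLpNorm (MF (fun z => ‖v z‖ₑ)) q volume :=
      eLpNorm_le_mul_eLpNorm_of_ae_le_mul' (c := C.toNNReal) (f := N) (g := MF (fun z => ‖v z‖ₑ))
        (Filter.Eventually.of_forall fun x => by simp only [hN, enorm_eq_self]; exact le_rfl) q
    refine e.trans ?_
    rw [mul_assoc]
    refine mul_le_mul' le_rfl ((hM _ hv.enorm).trans (le_of_eq ?_))
    rw [eLpNorm_enorm]
  have I : ∀ β ∈ Set.Ici (0 : ℝ), ENNReal.ofReal (Real.exp (-(γ * β))) *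
        ∫⁻ θ : ℝ, ∫⁻ y, ‖opK k1 (Real.exp θ) f y‖ₑ * ‖opK k3 (Real.exp θ) v y‖ₑ *
          ‖opK k2 (Real.exp β * Real.exp θ) w y‖ₑ ≤
        ENNReal.ofReal (Real.exp (-(γ - ε) * β)) *
        (K * (eLpNorm f p volume * eLpNorm N q volume * eLpNorm w s volume)) := by
    intro β hβ
    have := H f w hf hw B hfB hwB (fun z => ‖opK k3 (Real.exp z.1) v z.2‖ₑ)
      (opK_meas2 hk3.1 hv Real.exp Real.measurable_exp).enorm N mN
      (fun θ y x hx => hV v hv _ (Real.exp_pos θ) y x hx) (Real.exp β) (Real.one_le_exp hβ)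
    refine (mul_le_mul' le_rfl this).trans (le_of_eq ?_)
    rw [show Real.exp (-(γ - ε) * β) = Real.exp (-(γ * β)) * Real.exp β ^ ε by
      rw [← Real.exp_mul, ← Real.exp_add]; congr 1; ring, ENNReal.ofReal_mul (Real.exp_pos _).le]
    ring
  refine (setLIntegral_mono' measurableSet_Ici I).trans ?_
  rw [lintegral_mul_const'' _ (by fun_prop)]
  have hintg : ∫⁻ β in Set.Ici (0:ℝ), ENNReal.ofReal (Real.exp (-(γ - ε) * β)) =
      ENNReal.ofReal ((γ - ε)⁻¹) := by
    rw [setLIntegral_congr (Ioi_ae_eq_Ici (a := (0:ℝ))).symm, ← ofReal_integral_eq_lintegral_ofReal]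
    · rw [integral_exp_mul_Ioi (by linarith)]
      congr 1; rw [mul_zero, Real.exp_zero, neg_div_neg_eq, one_div]
    · exact integrableOn_exp_mul_Ioi (by linarith) 0
    · exact Filter.Eventually.of_forall fun x => (Real.exp_pos _).le
  rw [hintg, mul_assoc (ENNReal.ofReal _)]
  refine mul_le_mul' le_rfl ?_
  calc _ ≤ K * (eLpNorm f p volume * (ENNReal.ofReal C * ENNReal.ofReal Cq * eLpNorm v q volume) *
        eLpNorm w s volume) := by gcongr
    _ = _ := by ring

end KP

namespace KP

/-- smooth cutoff on the line -/
noncomputable def chi (s : ℝ) : ℝ := Real.smoothTransition (2 - s)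

/-- minus its derivative -/
noncomputable def dchi (s : ℝ) : ℝ := -deriv chi s

lemma chi_smooth : ContDiff ℝ (⊤ : ℕ∞) chi := by
  unfold chi
  exact Real.smoothTransition.contDiff.comp (contDiff_const.sub contDiff_id)

lemma chi_one {s : ℝ} (h : s ≤ 1) : chi s = 1 := Real.smoothTransition.one_of_one_le (by linarith)
lemma chi_zero {s : ℝ} (h : 2 ≤ s) : chi s = 0 := Real.smoothTransition.zero_of_nonpos (by linarith)
lemma chi_nonneg (s : ℝ) : 0 ≤ chi s := Real.smoothTransition.nonneg _
lemma chi_le_one (s : ℝ) : chi s ≤ 1 := Real.smoothTransition.le_one _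
lemma chi_anti : Antitone chi := fun _ _ h => Real.smoothTransition.monotone (by linarith)
lemma chi_cont : Continuous chi := chi_smooth.continuous

lemma chi_deriv (s : ℝ) : HasDerivAt chi (-dchi s) s := by
  have : DifferentiableAt ℝ chi s := (chi_smooth.differentiable (by simp)) s
  simpa [dchi] using this.hasDerivAt

lemma dchi_smooth : ContDiff ℝ (⊤ : ℕ∞) dchi := by
  unfold dchi
  have : ContDiff ℝ (⊤ : ℕ∞) (deriv chi) :=
    (contDiff_infty_iff_deriv.1 chi_smooth).2
  exact this.neg

lemma dchi_cont : Continuous dchi := dchi_smooth.continuous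

lemma dchi_nonneg (s : ℝ) : 0 ≤ dchi s := by
  unfold dchi
  have := chi_anti.deriv_nonpos (x := s)
  linarith

lemma dchi_supp {s : ℝ} (h : dchi s ≠ 0) : 1 ≤ s ∧ s ≤ 2 := by
  constructor
  · by_contra hc
    push Not at hc
    apply h
    have : chi =ᶠ[nhds s] fun _ => 1 := by
      filter_upwards [Iio_mem_nhds hc] with y hy using chi_one (le_of_lt hy)
    rw [dchi, this.deriv_eq]; simp
  · by_contra hc
    push Not at hc
    apply h
    have : chi =ᶠ[nhds s] fun _ => 0 := by
      filter_upwards [Ioi_mem_nhds hc] with y hy using chi_zero (le_of_lt hy)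
    rw [dchi, this.deriv_eq]; simp

lemma dchi_ne : ∃ s, dchi s ≠ 0 := by
  by_contra hc
  push Not at hc
  have : ∀ x, HasDerivAt chi 0 x := fun x => by have := chi_deriv x; rwa [hc, neg_zero] at this
  have h2 := is_const_of_deriv_eq_zero (fun x => (this x).differentiableAt) (fun x => (this x).deriv) 1 2
  rw [chi_one le_rfl, chi_zero le_rfl] at h2
  norm_num at h2

/-- logarithmic derivative of the cutoff -/
noncomputable def psi1 (s : ℝ) : ℝ := 2 * s * dchi s

lemma psi1_cont : Continuous psi1 := by unfold psi1; have := dchi_cont; fun_prop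

lemma psi1_nonneg {s : ℝ} (h : 0 ≤ s) : 0 ≤ psi1 s :=
  mul_nonneg (by positivity) (dchi_nonneg s)

lemma psi1_supp {s : ℝ} (h : psi1 s ≠ 0) : 1 ≤ s ∧ s ≤ 2 :=
  dchi_supp fun h0 => h (by rw [psi1, h0, mul_zero])

lemma fdecomp {a b : ℝ} (ha : 0 ≤ a) (hb : 0 ≤ b) (hab : 0 < max a b) :
    ∫⁻ θ : ℝ, ENNReal.ofReal (psi1 (Real.exp θ ^ 2 * a) * chi (Real.exp θ ^ 2 * b) +
      chi (Real.exp θ ^ 2 * a) * psi1 (Real.exp θ ^ 2 * b)) = 1 := by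
  set D : ℝ → ℝ := fun θ => psi1 (Real.exp θ ^ 2 * a) * chi (Real.exp θ ^ 2 * b) +
      chi (Real.exp θ ^ 2 * a) * psi1 (Real.exp θ ^ 2 * b) with hD
  have hcont : Continuous D := by
    have := psi1_cont; have := chi_cont
    fun_prop
  have hnn : ∀ θ, 0 ≤ D θ := fun θ => add_nonneg
    (mul_nonneg (psi1_nonneg (by positivity)) (chi_nonneg _))
    (mul_nonneg (chi_nonneg _) (psi1_nonneg (by positivity)))
  have hc2 : ∀ s, chi s ≠ 0 → s ≤ 2 := fun s h => by
    by_contra hc; exact h (chi_zero (by linarith))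
  have hsupp : ∀ θ, D θ ≠ 0 → 1 ≤ Real.exp θ ^ 2 * max a b ∧ Real.exp θ ^ 2 * max a b ≤ 2 := by
    intro θ h
    rw [mul_max_of_nonneg _ _ (by positivity : 0 ≤ Real.exp θ ^ 2)]
    by_cases h1 : psi1 (Real.exp θ ^ 2 * a) * chi (Real.exp θ ^ 2 * b) = 0
    · have h2 : chi (Real.exp θ ^ 2 * a) * psi1 (Real.exp θ ^ 2 * b) ≠ 0 := fun h2 => h (by
        simp only [hD]; rw [h1, h2, add_zero])
      have h3 := psi1_supp (right_ne_zero_of_mul h2)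
      exact ⟨le_max_of_le_right h3.1, max_le (hc2 _ (left_ne_zero_of_mul h2)) h3.2⟩
    · have h3 := psi1_supp (left_ne_zero_of_mul h1)
      exact ⟨le_max_of_le_left h3.1, max_le h3.2 (hc2 _ (right_ne_zero_of_mul h1))⟩
  set m := max a b with hm
  have hlog : ∀ θ, Real.log (Real.exp θ ^ 2 * m) = 2 * θ + Real.log m := fun θ => by
    rw [Real.log_mul (by positivity) hab.ne', Real.log_pow, Real.log_exp]; norm_num
  have hcs : HasCompactSupport D := by
    refine HasCompactSupport.intro (isCompact_Icc (a := -Real.log m / 2)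
      (b := (Real.log 2 - Real.log m) / 2)) fun θ hθ => ?_
    by_contra hne
    obtain ⟨h1, h2⟩ := hsupp θ hne
    apply hθ
    have l1 := Real.log_le_log one_pos h1
    have l2 := Real.log_le_log (by positivity) h2
    rw [hlog, Real.log_one] at l1
    rw [hlog] at l2
    constructor <;> linarith
  have hintg : Integrable D := hcont.integrable_of_hasCompactSupport hcs
  have hder : ∀ θ, HasDerivAt (fun θ => -(chi (Real.exp θ ^ 2 * a) * chi (Real.exp θ ^ 2 * b))) (D θ) θ := by
    intro θ
    have e : ∀ c, HasDerivAt (fun θ => chi (Real.exp θ ^ 2 * c)) (-psi1 (Real.exp θ ^ 2 * c)) θ := by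
      intro c
      have h1 : HasDerivAt (fun θ => Real.exp θ ^ 2 * c) (2 * (Real.exp θ ^ 2 * c)) θ := by
        have := ((Real.hasDerivAt_exp θ).pow 2).mul_const c
        exact this.congr_deriv (by push_cast; ring)
      have := (chi_deriv (Real.exp θ ^ 2 * c)).comp θ h1
      exact this.congr_deriv (by unfold psi1; ring)
    have := ((e a).mul (e b)).neg
    exact this.congr_deriv (by simp only [hD]; ring)
  have l1 : Filter.Tendsto (fun θ => -(chi (Real.exp θ ^ 2 * a) * chi (Real.exp θ ^ 2 * b)))
      Filter.atBot (nhds (-1)) := by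
    have t : ∀ c, Filter.Tendsto (fun θ => chi (Real.exp θ ^ 2 * c)) Filter.atBot (nhds 1) := by
      intro c
      have h1 : Filter.Tendsto (fun θ => Real.exp θ ^ 2 * c) Filter.atBot (nhds 0) := by
        have := (Real.tendsto_exp_atBot.pow 2).mul_const c
        simpa using this
      have := (chi_cont.tendsto 0).comp h1
      rwa [chi_one zero_le_one] at this
    have := ((t a).mul (t b)).neg
    simpa using this
  have l2 : Filter.Tendsto (fun θ => -(chi (Real.exp θ ^ 2 * a) * chi (Real.exp θ ^ 2 * b)))
      Filter.atTop (nhds 0) := by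
    have h1 : Filter.Tendsto (fun θ => Real.exp θ ^ 2 * m) Filter.atTop Filter.atTop :=
      (Filter.Tendsto.atTop_mul_const hab
        ((Filter.tendsto_pow_atTop two_ne_zero).comp Real.tendsto_exp_atTop))
    refine tendsto_const_nhds.congr' ?_
    filter_upwards [h1.eventually_ge_atTop 2] with θ hθ
    rcases max_cases a b with ⟨h, _⟩ | ⟨h, _⟩
    · rw [hm, h] at hθ; rw [chi_zero hθ]; ring
    · rw [hm, h] at hθ; rw [chi_zero hθ]; ring
  rw [← ofReal_integral_eq_lintegral_ofReal hintg (Filter.Eventually.of_forall hnn),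
    integral_of_hasDerivAt_of_tendsto hder hintg l1 l2]
  simp

/-- normalising constant -/
noncomputable def c0 (γ : ℝ) : ℝ≥0∞ :=
  ∫⁻ ρ : ℝ, ENNReal.ofReal (Real.exp (-(γ * ρ)) * dchi (Real.exp ρ ^ 2))

lemma c0_ne_top (γ : ℝ) : c0 γ ≠ ∞ := by
  have hcont : Continuous fun ρ : ℝ => Real.exp (-(γ * ρ)) * dchi (Real.exp ρ ^ 2) := by
    have := dchi_cont; fun_prop
  have hcs : HasCompactSupport fun ρ : ℝ => Real.exp (-(γ * ρ)) * dchi (Real.exp ρ ^ 2) := by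
    refine HasCompactSupport.intro (isCompact_Icc (a := (0:ℝ)) (b := Real.log 2 / 2)) fun ρ hρ => ?_
    by_contra hne
    obtain ⟨h1, h2⟩ := dchi_supp (right_ne_zero_of_mul hne)
    apply hρ
    have l1 := Real.log_le_log one_pos h1
    have l2 := Real.log_le_log (by positivity) h2
    rw [Real.log_pow, Real.log_exp] at l1 l2
    rw [Real.log_one] at l1
    push_cast at l1 l2
    constructor <;> linarith
  have hintg := hcont.integrable_of_hasCompactSupport hcs (μ := volume)
  rw [c0, ← ofReal_integral_eq_lintegral_ofReal hintg]
  · exact ENNReal.ofReal_ne_top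
  · exact Filter.Eventually.of_forall fun ρ => mul_nonneg (Real.exp_pos _).le (dchi_nonneg _)

lemma c0_ne_zero (γ : ℝ) : c0 γ ≠ 0 := by
  intro h
  have hcont : Continuous fun ρ : ℝ => ENNReal.ofReal (Real.exp (-(γ * ρ)) * dchi (Real.exp ρ ^ 2)) := by
    have := dchi_cont
    exact ENNReal.continuous_ofReal.comp (by fun_prop)
  rw [c0, lintegral_eq_zero_iff hcont.measurable] at h
  have h2 := (Continuous.ae_eq_iff_eq volume hcont (continuous_const : Continuous fun _ : ℝ => (0:ℝ≥0∞))).1 h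
  obtain ⟨s, hs⟩ := dchi_ne
  have hs1 := (dchi_supp hs).1
  have h3 := congrFun h2 (Real.log s / 2)
  have e : Real.exp (Real.log s / 2) ^ 2 = s := by
    rw [← Real.exp_nat_mul]; push_cast
    rw [mul_div_cancel₀ _ two_ne_zero, Real.exp_log (by linarith)]
  simp only [e, ENNReal.ofReal_eq_zero] at h3
  have : 0 < dchi s := lt_of_le_of_ne (dchi_nonneg s) hs.symm
  have := mul_pos (Real.exp_pos (-(γ * (Real.log s / 2)))) this
  linarith

lemma odecomp (γ : ℝ) {z : ℝ} (hz : 0 < z) :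
    ∫⁻ ρ : ℝ, ENNReal.ofReal (Real.exp (-(γ * ρ)) * dchi (Real.exp ρ ^ 2 * z ^ 2)) =
      ENNReal.ofReal (z ^ γ) * c0 γ := by
  unfold c0
  rw [← lintegral_add_right_eq_self
    (fun ρ => ENNReal.ofReal (Real.exp (-(γ * ρ)) * dchi (Real.exp ρ ^ 2))) (Real.log z), ← lintegral_const_mul' _ _ ENNReal.ofReal_ne_top]
  refine lintegral_congr fun ρ => ?_
  rw [← ENNReal.ofReal_mul (by positivity)]
  congr 1
  rw [Real.exp_add, Real.exp_log hz, mul_pow, ← mul_assoc, Real.rpow_def_of_pos hz, ← Real.exp_add]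
  congr 2
  ring

end KP

namespace KP

/-- the character -/
noncomputable def ee (t : ℝ) : ℂ := Complex.exp (2 * π * I * t)

lemma ee_cont : Continuous ee := by unfold ee; fun_prop

lemma ee_norm (t : ℝ) : ‖ee t‖ = 1 := by
  unfold ee
  rw [show (2 * π * I * t : ℂ) = ((2 * π * t : ℝ) : ℂ) * I by push_cast; ring]
  exact Complex.norm_exp_ofReal_mul_I _

lemma ee_add (a b : ℝ) : ee (a + b) = ee a * ee b := by
  unfold ee; rw [← Complex.exp_add]; congr 1; push_cast; ring

lemma ee_zero : ee 0 = 1 := by simp [ee]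

lemma four_ee {d : ℕ} (f : KE d → ℂ) (w : KE d) : 𝓕 f w = ∫ v, ee (-⟪v, w⟫) * f v := by
  rw [Real.fourier_eq']
  refine integral_congr_ae (Filter.Eventually.of_forall fun v => ?_)
  simp only [smul_eq_mul, ee]
  congr 2; push_cast; ring

lemma finv_ee {d : ℕ} (f : KE d → ℂ) (w : KE d) : 𝓕⁻ f w = ∫ v, ee ⟪w, v⟫ * f v := by
  rw [Real.fourierInv_eq']
  refine integral_congr_ae (Filter.Eventually.of_forall fun v => ?_)
  simp only [smul_eq_mul, ee]
  rw [real_inner_comm]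
  congr 2; push_cast; ring

lemma int_ee {α : Type*} [MeasurableSpace α] {μ : Measure α} {f : α → ℂ} (hf : Integrable f μ)
    {g : α → ℝ} (hg : Measurable g) : Integrable (fun x => ee (g x) * f x) μ :=
  hf.bdd_mul (c := 1) ((ee_cont.measurable.comp hg).aestronglyMeasurable)
    (Filter.Eventually.of_forall fun x => (ee_norm _).le)

lemma conv_four {d : ℕ} {K A : KE d → ℂ} (hK : Integrable K) (hA : Integrable A) (y : KE d) :
    ∫ x, K (y - x) * (∫ ξ, ee ⟪x, ξ⟫ * A ξ) = ∫ ξ, ee ⟪y, ξ⟫ * (𝓕 K ξ * A ξ) := by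
  have h1 : ∀ x, K (y - x) * (∫ ξ, ee ⟪x, ξ⟫ * A ξ) = ∫ ξ, ee ⟪x, ξ⟫ * (K (y - x) * A ξ) := by
    intro x
    rw [← integral_const_mul]
    refine integral_congr_ae (Filter.Eventually.of_forall fun ξ => ?_)
    simp only; ring
  simp_rw [h1]
  have hKy : Integrable fun x => K (y - x) := hK.comp_sub_left y
  have hintg : Integrable (Function.uncurry fun x ξ : KE d => ee ⟪x, ξ⟫ * (K (y - x) * A ξ))
      (volume.prod volume) := by
    have h := hKy.mul_prod hA
    exact int_ee (g := fun z : KE d × KE d => ⟪z.1, z.2⟫) h (by fun_prop)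
  rw [integral_integral_swap hintg]
  refine integral_congr_ae (Filter.Eventually.of_forall fun ξ => ?_)
  simp only
  rw [four_ee, ← integral_sub_left_eq_self (fun v => ee (-⟪v, ξ⟫) * K v) volume y,
    ← mul_assoc, ← integral_const_mul, ← integral_mul_const]
  refine integral_congr_ae (Filter.Eventually.of_forall fun x => ?_)
  simp only
  rw [show ⟪x, ξ⟫ = ⟪y, ξ⟫ + -⟪y - x, ξ⟫ by rw [inner_sub_left]; ring, ee_add]
  ring

lemma schwartz_decay {d : ℕ} (k : 𝓢(KE d, ℂ)) : Decay (⇑k) := by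
  refine ⟨k.continuous, ?_⟩
  have h := fun x => SchwartzMap.one_add_le_sup_seminorm_apply (𝕜 := ℝ) (m := (2 * d + 2, 0))
    (k := 2 * d + 2) (n := 0) le_rfl le_rfl k x
  set C := 2 ^ (2 * d + 2, 0).1 * ((Finset.Iic (2 * d + 2, 0)).sup fun m => SchwartzMap.seminorm ℝ (E := KE d) (F := ℂ) m.1 m.2) k with hC
  have hC0 : 0 ≤ C := le_trans (by positivity) (h 0)
  refine ⟨C + 1, by linarith, fun x => ?_⟩
  have := h x
  rw [norm_iteratedFDeriv_zero] at this
  rw [← div_eq_mul_inv, le_div_iff₀ (by positivity), mul_comm]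
  linarith

lemma sym_exists {d : ℕ} {h : ℝ → ℝ} (hs : ContDiff ℝ (⊤ : ℕ∞) h) {b : ℝ} (hb : ∀ s, b < s → h s = 0) :
    ∃ m : 𝓢(KE d, ℂ), ∀ x, m x = ((h (‖x‖ ^ 2) : ℝ) : ℂ) := by
  have h1 : ContDiff ℝ (⊤ : ℕ∞) fun x : KE d => ((h (‖x‖ ^ 2) : ℝ) : ℂ) :=
    Complex.ofRealCLM.contDiff.comp (hs.comp (contDiff_norm_sq ℝ))
  have h2 : HasCompactSupport fun x : KE d => ((h (‖x‖ ^ 2) : ℝ) : ℂ) := by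
    refine HasCompactSupport.intro (isCompact_closedBall 0 (|b| + 1)) fun x hx => ?_
    rw [Metric.mem_closedBall, dist_zero_right, not_le] at hx
    rw [hb _ ?_, Complex.ofReal_zero]
    nlinarith [abs_nonneg b, le_abs_self b]
  exact ⟨h2.toSchwartzMap h1, fun x => rfl⟩

/-- kernel with a given symbol -/
lemma ker_exists {d : ℕ} {h : ℝ → ℝ} (hs : ContDiff ℝ (⊤ : ℕ∞) h) {b : ℝ} (hb : ∀ s, b < s → h s = 0) :
    ∃ k : 𝓢(KE d, ℂ), (∀ x, 𝓕 (⇑k) x = ((h (‖x‖ ^ 2) : ℝ) : ℂ)) ∧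
      ∀ x, k x = ∫ ξ, ee ⟪x, ξ⟫ * ((h (‖ξ‖ ^ 2) : ℝ) : ℂ) := by
  obtain ⟨m, hm⟩ := sym_exists (d := d) hs hb
  refine ⟨𝓕⁻ m, fun x => ?_, fun x => ?_⟩
  · rw [← SchwartzMap.fourier_coe, FourierTransform.fourier_fourierInv_eq, hm]
  · rw [SchwartzMap.fourierInv_coe, finv_ee]
    simp_rw [hm]

lemma eg_four {d : ℕ} {τ : ℝ} (hτ : 0 < τ) (ξ : KE d) :
    𝓕 (fun x : KE d => ((eg τ x : ℝ) : ℂ)) ξ = ((Real.exp (-(π * τ * ‖ξ‖ ^ 2)) : ℝ) : ℂ) := by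
  have hb : 0 < (((π / τ : ℝ) : ℂ)).re := by rw [Complex.ofReal_re]; positivity
  have h := fourier_gaussian_innerProductSpace hb ξ
  have e : (fun x : KE d => ((eg τ x : ℝ) : ℂ)) =
      fun x => (((τ ^ ((d : ℝ) / 2))⁻¹ : ℝ) : ℂ) * cexp (-((π / τ : ℝ) : ℂ) * ‖x‖ ^ 2) := by
    funext x; unfold eg; push_cast; rfl
  rw [e, four_ee]
  rw [four_ee] at h
  have e2 : ∀ v : KE d, ee (-⟪v, ξ⟫) * ((((τ ^ ((d : ℝ) / 2))⁻¹ : ℝ) : ℂ) * cexp (-((π / τ : ℝ) : ℂ) * ‖v‖ ^ 2))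
    = (((τ ^ ((d : ℝ) / 2))⁻¹ : ℝ) : ℂ) * (ee (-⟪v, ξ⟫) * cexp (-((π / τ : ℝ) : ℂ) * ‖v‖ ^ 2)) := fun v => by ring
  simp_rw [e2]
  rw [integral_const_mul, h]
  have e3 : ((π : ℂ) / ((π / τ : ℝ) : ℂ)) = ((τ : ℝ) : ℂ) := by
    push_cast; field_simp [Real.pi_ne_zero, hτ.ne']
  have e4 : ((Module.finrank ℝ (KE d) : ℂ) / 2) = (((d : ℝ) / 2 : ℝ) : ℂ) := by
    rw [finrank_euclideanSpace_fin]; push_cast; rfl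
  have e5 : (-(π : ℂ) ^ 2 * ‖ξ‖ ^ 2 / ((π / τ : ℝ) : ℂ)) = ((-(π * τ * ‖ξ‖ ^ 2) : ℝ) : ℂ) := by
    have : (τ : ℂ) ≠ 0 := by exact_mod_cast hτ.ne'
    have : (π : ℂ) ≠ 0 := by exact_mod_cast Real.pi_ne_zero
    push_cast; field_simp
  rw [e3, e4, e5, ← Complex.ofReal_cpow hτ.le, ← mul_assoc, ← Complex.ofReal_mul, inv_mul_cancel₀ (by positivity),
    Complex.ofReal_exp]
  simp

lemma mul_smooth {h g : ℝ → ℝ} (hs : ContDiff ℝ (⊤ : ℕ∞) h) {a : ℝ} (ha : 0 < a)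
    (hsupp : ∀ s, s < a → h s = 0) (hg : ∀ s, 0 < s → ContDiffAt ℝ (⊤ : ℕ∞) g s) :
    ContDiff ℝ (⊤ : ℕ∞) fun s => h s * g s := by
  rw [contDiff_iff_contDiffAt]
  intro s
  rcases lt_or_ge 0 s with h0 | h0
  · exact hs.contDiffAt.mul (hg s h0)
  · refine (contDiffAt_const (c := (0:ℝ))).congr_of_eventuallyEq ?_
    filter_upwards [Iio_mem_nhds (lt_of_le_of_lt h0 ha)] with t ht
    rw [hsupp t ht, zero_mul]

lemma canc_exists {d : ℕ} {h : ℝ → ℝ} (hs : ContDiff ℝ (⊤ : ℕ∞) h) {a b : ℝ} (ha : 0 < a)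
    (hsupp : ∀ s, s < a → h s = 0) (hb : ∀ s, b < s → h s = 0) :
    ∃ k : 𝓢(KE d, ℂ), (∀ x, 𝓕 (⇑k) x = ((h (‖x‖ ^ 2) : ℝ) : ℂ)) ∧ Canc (⇑k) := by
  obtain ⟨k, hk1, hk2⟩ := ker_exists (d := d) hs hb
  refine ⟨k, hk1, schwartz_decay k, ?_⟩
  have hpos : ∀ s : ℝ, 0 < s → 0 < Real.exp (-(π * 2 * s)) - Real.exp (-(π * 3 * s)) := by
    intro s hs
    rw [sub_pos, Real.exp_lt_exp]
    nlinarith [mul_pos Real.pi_pos hs]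
  have hs' := mul_smooth (g := fun s => (Real.exp (-(π * 2 * s)) - Real.exp (-(π * 3 * s)))⁻¹) hs ha hsupp
    (fun s h0 => ContDiffAt.inv (by fun_prop) (hpos s h0).ne')
  obtain ⟨m, hm⟩ := sym_exists (d := d) hs' (b := b) (fun s h => by rw [hb s h, zero_mul])
  refine ⟨⇑(𝓕⁻ m : 𝓢(KE d, ℂ)), schwartz_decay _, fun x => ?_⟩
  have hD : Integrable fun z : KE d => ((eg 2 z - eg 3 z : ℝ) : ℂ) :=
    ((eg_integrable two_pos).sub (eg_integrable three_pos)).ofReal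
  have hc := conv_four hD m.integrable x
  have e1 : ∫ z, (𝓕⁻ m : 𝓢(KE d, ℂ)) (x - z) * ((eg 2 z - eg 3 z : ℝ) : ℂ) =
      ∫ z, ((eg 2 (x - z) - eg 3 (x - z) : ℝ) : ℂ) * ∫ ξ, ee ⟪z, ξ⟫ * m ξ := by
    rw [← integral_sub_left_eq_self _ volume x]
    refine integral_congr_ae (Filter.Eventually.of_forall fun z => ?_)
    simp only
    rw [sub_sub_cancel, SchwartzMap.fourierInv_coe, finv_ee, mul_comm]
  rw [e1, hc, hk2]
  refine integral_congr_ae (Filter.Eventually.of_forall fun ξ => ?_)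
  simp only
  congr 1
  have e2 : 𝓕 (fun z : KE d => ((eg 2 z - eg 3 z : ℝ) : ℂ)) ξ =
      ((Real.exp (-(π * 2 * ‖ξ‖ ^ 2)) - Real.exp (-(π * 3 * ‖ξ‖ ^ 2)) : ℝ) : ℂ) := by
    rw [Complex.ofReal_sub, ← eg_four two_pos, ← eg_four three_pos, four_ee, four_ee, four_ee, ← integral_sub]
    · refine integral_congr_ae (Filter.Eventually.of_forall fun z => ?_)
      simp only; push_cast; ring
    · exact int_ee (eg_integrable two_pos).ofReal (by fun_prop)
    · exact int_ee (eg_integrable three_pos).ofReal (by fun_prop)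
  rw [e2, hm, ← Complex.ofReal_mul]
  congr 1
  rcases eq_or_ne (‖ξ‖ ^ 2) 0 with h0 | h0
  · rw [h0, hsupp 0 ha]; simp
  · have := (hpos _ (lt_of_le_of_ne (sq_nonneg _) h0.symm)).ne'
    rw [mul_left_comm, mul_inv_cancel₀ this, mul_one]

end KP

namespace KP

lemma ks_four {d : ℕ} (k : KE d → ℂ) {t : ℝ} (ht : 0 < t) (ξ : KE d) :
    𝓕 (ks k t) ξ = 𝓕 k (t • ξ) := by
  rw [four_ee, four_ee]
  have h := Measure.integral_comp_smul volume (fun v : KE d => ee (-⟪v, t • ξ⟫) * k v) t⁻¹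
  rw [finrank_euclideanSpace_fin, inv_pow, inv_inv, abs_of_pos (pow_pos ht d)] at h
  have e : ∀ v : KE d, ee (-⟪v, ξ⟫) * ks k t v =
      (((t ^ d)⁻¹ : ℝ) : ℂ) * (ee (-⟪t⁻¹ • v, t • ξ⟫) * k (t⁻¹ • v)) := by
    intro v
    rw [inner_smul_left, inner_smul_right]
    simp only [ks, conj_trivial]
    rw [← mul_assoc t⁻¹ t, inv_mul_cancel₀ ht.ne', one_mul]
    ring
  simp_rw [e]
  rw [integral_const_mul, h, Complex.real_smul, ← mul_assoc, ← Complex.ofReal_mul,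
    inv_mul_cancel₀ (pow_pos ht d).ne', Complex.ofReal_one, one_mul]

lemma opK_four {d : ℕ} {k : KE d → ℂ} (hk : Decay k) {t : ℝ} (ht : 0 < t) {A : KE d → ℂ}
    (hA : Integrable A) (y : KE d) :
    opK k t (fun x => ∫ ξ, ee ⟪x, ξ⟫ * A ξ) y = ∫ ξ, ee ⟪y, ξ⟫ * (𝓕 k (t • ξ) * A ξ) := by
  unfold opK
  rw [conv_four (ks_integrable hk ht) hA]
  simp_rw [ks_four k ht]

lemma opK_integrand {d : ℕ} {k : KE d → ℂ} (hk : Decay k) {t : ℝ} (ht : 0 < t) {w : KE d → ℂ}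
    (hw : Integrable w) : Integrable (fun p : KE d × KE d => ks k t (p.1 - p.2) * w p.2)
      (volume.prod volume) := by
  have h := Integrable.convolution_integrand (ContinuousLinearMap.mul ℝ ℂ) hw (ks_integrable hk ht)
  refine h.congr (Filter.Eventually.of_forall fun p => ?_)
  simp only [ContinuousLinearMap.mul_apply']
  ring

lemma opK_integrable {d : ℕ} {k : KE d → ℂ} (hk : Decay k) {t : ℝ} (ht : 0 < t) {w : KE d → ℂ}
    (hw : Integrable w) : Integrable (opK k t w) :=
  (opK_integrand hk ht hw).integral_prod_left

lemma opK_wh {d : ℕ} {k : KE d → ℂ} (hk : Decay k) {t : ℝ} (ht : 0 < t) {w : KE d → ℂ}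
    (hw : Integrable w) (ζ : KE d) :
    ∫ y, ee ⟪y, ζ⟫ * opK k t w y = 𝓕 k (t • (-ζ)) * ∫ x, ee ⟪x, ζ⟫ * w x := by
  have h1 : ∀ y, ee ⟪y, ζ⟫ * opK k t w y = ∫ x, ee ⟪y, ζ⟫ * (ks k t (y - x) * w x) := by
    intro y
    rw [integral_const_mul]; rfl
  simp_rw [h1]
  have hintg : Integrable (Function.uncurry fun y x : KE d => ee ⟪y, ζ⟫ * (ks k t (y - x) * w x))
      (volume.prod volume) :=
    int_ee (g := fun z : KE d × KE d => ⟪z.1, ζ⟫) (opK_integrand hk ht hw) (by fun_prop)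
  rw [integral_integral_swap hintg, ← integral_const_mul]
  refine integral_congr_ae (Filter.Eventually.of_forall fun x => ?_)
  simp only
  rw [← ks_four k ht, four_ee,
    ← integral_sub_right_eq_self (fun v => ee (-⟪v, -ζ⟫) * ks k t v) x, ← integral_mul_const]
  refine integral_congr_ae (Filter.Eventually.of_forall fun y => ?_)
  simp only
  rw [show ⟪y, ζ⟫ = -⟪y - x, -ζ⟫ + ⟪x, ζ⟫ by rw [inner_neg_right, inner_sub_left]; ring, ee_add]
  ring

lemma tri_four {d : ℕ} {A B Ω : KE d → ℂ} (hA : Integrable A) (hB : Integrable B) (hΩ : Integrable Ω) :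
    ∫ z : KE d × KE d, A z.1 * B z.2 * (∫ y, ee ⟪y, z.1 + z.2⟫ * Ω y) =
      ∫ y, (∫ ξ, ee ⟪y, ξ⟫ * A ξ) * (∫ η, ee ⟪y, η⟫ * B η) * Ω y := by
  have h1 : ∀ z : KE d × KE d, A z.1 * B z.2 * (∫ y, ee ⟪y, z.1 + z.2⟫ * Ω y) =
      ∫ y, ee ⟪y, z.1 + z.2⟫ * (A z.1 * B z.2 * Ω y) := by
    intro z
    rw [← integral_const_mul]
    refine integral_congr_ae (Filter.Eventually.of_forall fun y => ?_)
    simp only; ring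
  simp_rw [h1]
  have hintg : Integrable (Function.uncurry fun (z : KE d × KE d) (y : KE d) =>
      ee ⟪y, z.1 + z.2⟫ * (A z.1 * B z.2 * Ω y)) ((volume.prod volume).prod volume) :=
    int_ee (g := fun p : (KE d × KE d) × KE d => ⟪p.2, p.1.1 + p.1.2⟫)
      ((hA.mul_prod hB).mul_prod hΩ) (by fun_prop)
  rw [Measure.volume_eq_prod, integral_integral_swap hintg]
  refine integral_congr_ae (Filter.Eventually.of_forall fun y => ?_)
  simp only
  rw [← integral_prod_mul, ← integral_mul_const]
  refine integral_congr_ae (Filter.Eventually.of_forall fun z => ?_)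
  simp only
  rw [inner_add_right, ee_add]; ring

lemma schwartz_inv {d : ℕ} (u : 𝓢(KE d, ℂ)) (x : KE d) : u x = ∫ ξ, ee ⟪x, ξ⟫ * 𝓕 (⇑u) ξ := by
  rw [← finv_ee, ← SchwartzMap.fourier_coe, ← SchwartzMap.fourierInv_coe,
    FourierTransform.fourierInv_fourier_eq]

lemma four_int {d : ℕ} (u : 𝓢(KE d, ℂ)) : Integrable (𝓕 (⇑u)) := by
  rw [← SchwartzMap.fourier_coe]; exact SchwartzMap.integrable _

lemma four_mul {d : ℕ} (u v : 𝓢(KE d, ℂ)) (ζ : KE d) :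
    𝓕 (fun x => u x * v x) ζ = ∫ η, 𝓕 (⇑u) (ζ - η) * 𝓕 (⇑v) η := by
  rw [four_ee]
  have h1 : ∀ x, ee (-⟪x, ζ⟫) * (u x * v x) = ∫ η, ee (-⟪x, ζ - η⟫) * (u x * 𝓕 (⇑v) η) := by
    intro x
    conv_lhs => rw [schwartz_inv v x, ← mul_assoc, ← integral_const_mul]
    refine integral_congr_ae (Filter.Eventually.of_forall fun η => ?_)
    simp only
    rw [show -⟪x, ζ - η⟫ = -⟪x, ζ⟫ + ⟪x, η⟫ by rw [inner_sub_right]; ring, ee_add]; ring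
  simp_rw [h1]
  have hintg : Integrable (Function.uncurry fun x η : KE d => ee (-⟪x, ζ - η⟫) * (u x * 𝓕 (⇑v) η))
      (volume.prod volume) :=
    int_ee (g := fun p : KE d × KE d => -⟪p.1, ζ - p.2⟫) (u.integrable.mul_prod (four_int v)) (by fun_prop)
  rw [integral_integral_swap hintg]
  refine integral_congr_ae (Filter.Eventually.of_forall fun η => ?_)
  simp only
  rw [four_ee (⇑u), ← integral_mul_const]
  refine integral_congr_ae (Filter.Eventually.of_forall fun x => ?_)
  simp only; ring

lemma weight_int {d : ℕ} (u : 𝓢(KE d, ℂ)) (n : ℕ) :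
    Integrable fun ξ : KE d => (((1 + ‖ξ‖) ^ n : ℝ) : ℂ) * 𝓕 (⇑u) ξ := by
  have hc : Continuous (𝓕 (⇑u)) := by rw [← SchwartzMap.fourier_coe]; exact SchwartzMap.continuous _
  have h := fun x => SchwartzMap.one_add_le_sup_seminorm_apply (𝕜 := ℝ) (m := (n + (d + 1), 0))
    (k := n + (d + 1)) (n := 0) le_rfl le_rfl (𝓕 u : 𝓢(KE d, ℂ)) x
  set C := 2 ^ (n + (d + 1), 0).1 * ((Finset.Iic (n + (d + 1), 0)).sup
    fun m => SchwartzMap.seminorm ℝ (E := KE d) (F := ℂ) m.1 m.2) (𝓕 u : 𝓢(KE d, ℂ)) with hC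
  have hi := (integrable_one_add_norm (E := KE d) (μ := volume) (r := (d + 1 : ℕ)) (by
    rw [finrank_euclideanSpace_fin]; push_cast; linarith)).const_mul C
  refine hi.mono' ?_ (Filter.Eventually.of_forall fun ξ => ?_)
  · have : Continuous fun ξ : KE d => (((1 + ‖ξ‖) ^ n : ℝ) : ℂ) * 𝓕 (⇑u) ξ := by fun_prop
    exact this.aestronglyMeasurable
  · have := h ξ
    rw [norm_iteratedFDeriv_zero, SchwartzMap.fourier_coe] at this
    rw [norm_mul, Complex.norm_real, Real.norm_eq_abs, abs_of_nonneg (by positivity),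
      Real.rpow_neg (by positivity), Real.rpow_natCast, ← div_eq_mul_inv, le_div_iff₀ (by positivity)]
    calc _ = (1 + ‖ξ‖) ^ (n + (d + 1)) * ‖𝓕 (⇑u) ξ‖ := by ring
      _ ≤ _ := this

lemma weight2_int {d : ℕ} (u v : 𝓢(KE d, ℂ)) {γ : ℝ} (hγ : 0 ≤ γ) :
    Integrable (fun z : KE d × KE d => ((‖z.1 + z.2‖ ^ γ : ℝ) : ℂ) * (𝓕 (⇑u) z.1 * 𝓕 (⇑v) z.2))
      (volume.prod volume) := by
  obtain ⟨n, hn⟩ := exists_nat_ge γ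
  have h := (weight_int u n).mul_prod (weight_int v n)
  have hu : Continuous (𝓕 (⇑u)) := by rw [← SchwartzMap.fourier_coe]; exact SchwartzMap.continuous _
  have hv : Continuous (𝓕 (⇑v)) := by rw [← SchwartzMap.fourier_coe]; exact SchwartzMap.continuous _
  refine h.mono ?_ (Filter.Eventually.of_forall fun z => ?_)
  · have : Measurable fun z : KE d × KE d => ((‖z.1 + z.2‖ ^ γ : ℝ) : ℂ) := by fun_prop
    exact (this.mul ((hu.measurable.comp measurable_fst).mul (hv.measurable.comp measurable_snd))).aestronglyMeasurable
  · have e : ‖z.1 + z.2‖ ^ γ ≤ (1 + ‖z.1‖) ^ n * (1 + ‖z.2‖) ^ n := by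
      calc ‖z.1 + z.2‖ ^ γ ≤ (1 + ‖z.1 + z.2‖) ^ γ := by gcongr; linarith
        _ ≤ (1 + ‖z.1 + z.2‖) ^ (n : ℝ) := by
            apply Real.rpow_le_rpow_of_exponent_le _ hn
            linarith [norm_nonneg (z.1 + z.2)]
        _ = (1 + ‖z.1 + z.2‖) ^ n := Real.rpow_natCast _ _
        _ ≤ _ := by
            rw [← mul_pow]; gcongr
            nlinarith [norm_add_le z.1 z.2, norm_nonneg z.1, norm_nonneg z.2, mul_nonneg (norm_nonneg z.1) (norm_nonneg z.2)]
    simp only [norm_mul, Complex.norm_real, Real.norm_eq_abs]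
    rw [abs_of_nonneg (by positivity), abs_of_nonneg (by positivity), abs_of_nonneg (by positivity)]
    calc _ ≤ ((1 + ‖z.1‖) ^ n * (1 + ‖z.2‖) ^ n) * (‖𝓕 (⇑u) z.1‖ * ‖𝓕 (⇑v) z.2‖) := by gcongr
      _ = _ := by ring

lemma lam_eq {d : ℕ} (γ : ℝ) (f : KE d → ℂ) (x : KE d) :
    lamPow γ f x = ∫ ξ, ee ⟪x, ξ⟫ * (((‖ξ‖ ^ γ : ℝ) : ℂ) * 𝓕 f ξ) := by
  unfold lamPow ee
  simp_rw [mul_assoc]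

lemma lam_int {d : ℕ} (u : 𝓢(KE d, ℂ)) {γ : ℝ} (hγ : 0 ≤ γ) :
    Integrable fun ξ : KE d => ((‖ξ‖ ^ γ : ℝ) : ℂ) * 𝓕 (⇑u) ξ := by
  obtain ⟨n, hn⟩ := exists_nat_ge γ
  have hc : Continuous (𝓕 (⇑u)) := by rw [← SchwartzMap.fourier_coe]; exact SchwartzMap.continuous _
  refine (weight_int u n).mono ?_ (Filter.Eventually.of_forall fun ξ => ?_)
  · have : Measurable fun z : KE d => ((‖z‖ ^ γ : ℝ) : ℂ) := by fun_prop
    exact (this.mul hc.measurable).aestronglyMeasurable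
  · have e : ‖ξ‖ ^ γ ≤ (1 + ‖ξ‖) ^ n := by
      calc ‖ξ‖ ^ γ ≤ (1 + ‖ξ‖) ^ γ := by gcongr; linarith
        _ ≤ (1 + ‖ξ‖) ^ (n : ℝ) := by
            apply Real.rpow_le_rpow_of_exponent_le _ hn
            linarith [norm_nonneg ξ]
        _ = (1 + ‖ξ‖) ^ n := Real.rpow_natCast _ _
    simp only [norm_mul, Complex.norm_real, Real.norm_eq_abs]
    rw [abs_of_nonneg (by positivity), abs_of_nonneg (by positivity)]
    gcongr

lemma lam_mul {d : ℕ} (u v : 𝓢(KE d, ℂ)) {γ : ℝ} (hγ : 0 ≤ γ) (x : KE d) :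
    lamPow γ (fun x => u x * v x) x = ∫ z : KE d × KE d, ee ⟪x, z.1 + z.2⟫ *
      (((‖z.1 + z.2‖ ^ γ : ℝ) : ℂ) * (𝓕 (⇑u) z.1 * 𝓕 (⇑v) z.2)) := by
  rw [lam_eq]
  simp_rw [four_mul]
  have hI := weight2_int u v hγ
  have mp := measurePreserving_sub_prod (volume : Measure (KE d)) (volume : Measure (KE d))
  have hI2 : Integrable (fun z : KE d × KE d => ((‖z.1‖ ^ γ : ℝ) : ℂ) * (𝓕 (⇑u) (z.1 - z.2) * 𝓕 (⇑v) z.2))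
      (volume.prod volume) := by
    have h := mp.integrable_comp_of_integrable hI
    refine h.congr (Filter.Eventually.of_forall fun z => ?_)
    simp [Function.comp]
  have hI3 := int_ee (g := fun z : KE d × KE d => ⟪x, z.1⟫) hI2 (by fun_prop)
  have hI4 : AEStronglyMeasurable (fun z : KE d × KE d => ee ⟪x, z.1 + z.2⟫ *
      (((‖z.1 + z.2‖ ^ γ : ℝ) : ℂ) * (𝓕 (⇑u) z.1 * 𝓕 (⇑v) z.2)))
      (Measure.map (fun z : KE d × KE d => (z.1 - z.2, z.2)) (volume.prod volume)) := by
    rw [mp.map_eq]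
    exact (int_ee (g := fun z : KE d × KE d => ⟪x, z.1 + z.2⟫) hI (by fun_prop)).aestronglyMeasurable
  rw [Measure.volume_eq_prod]
  conv_rhs => rw [← mp.map_eq]
  rw [integral_map mp.measurable.aemeasurable hI4]
  simp only [sub_add_cancel]
  rw [integral_prod _ hI3]
  refine integral_congr_ae (Filter.Eventually.of_forall fun ζ => ?_)
  simp only
  rw [← integral_const_mul, ← integral_const_mul]

lemma lam_meas {d : ℕ} (γ : ℝ) (f : KE d → ℂ) (hf : Measurable (𝓕 f)) : Measurable (lamPow γ f) := by
  have : StronglyMeasurable fun p : KE d × KE d => ee ⟪p.1, p.2⟫ * (((‖p.2‖ ^ γ : ℝ) : ℂ) * 𝓕 f p.2) := by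
    apply Measurable.stronglyMeasurable
    have h1 : Measurable fun p : KE d × KE d => ee ⟪p.1, p.2⟫ :=
      ee_cont.measurable.comp (by fun_prop)
    have h2 : Measurable fun p : KE d × KE d => ((‖p.2‖ ^ γ : ℝ) : ℂ) := by fun_prop
    exact h1.mul (h2.mul (hf.comp measurable_snd))
  have h := this.integral_prod_right' (ν := volume)
  rw [show lamPow γ f = fun x => ∫ ξ, ee ⟪x, ξ⟫ * (((‖ξ‖ ^ γ : ℝ) : ℂ) * 𝓕 f ξ) from
    funext fun x => lam_eq γ f x]
  exact h.measurable

lemma lam_bdd {d : ℕ} (γ : ℝ) (f : KE d → ℂ) : ∃ B, ∀ x, ‖lamPow γ f x‖ ≤ B := by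
  refine ⟨∫ ξ, ‖((‖ξ‖ ^ γ : ℝ) : ℂ) * 𝓕 f ξ‖, fun x => ?_⟩
  rw [lam_eq]
  refine (norm_integral_le_integral_norm _).trans (le_of_eq ?_)
  congr 1; funext ξ
  rw [norm_mul, ee_norm, one_mul]

lemma lam_pair {d : ℕ} (u v : 𝓢(KE d, ℂ)) {γ : ℝ} (hγ : 0 ≤ γ) {w : KE d → ℂ} (hw : Integrable w) :
    ∫ x, lamPow γ (fun x => u x * v x) x * w x = ∫ z : KE d × KE d,
      (𝓕 (⇑u) z.1 * 𝓕 (⇑v) z.2 * (∫ x, ee ⟪x, z.1 + z.2⟫ * w x)) * ((‖z.1 + z.2‖ ^ γ : ℝ) : ℂ) := by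
  have h1 : ∀ x, lamPow γ (fun x => u x * v x) x * w x = ∫ z : KE d × KE d, ee ⟪x, z.1 + z.2⟫ *
      (w x * (((‖z.1 + z.2‖ ^ γ : ℝ) : ℂ) * (𝓕 (⇑u) z.1 * 𝓕 (⇑v) z.2))) := by
    intro x
    rw [lam_mul u v hγ, ← integral_mul_const]
    refine integral_congr_ae (Filter.Eventually.of_forall fun z => ?_)
    simp only; ring
  simp_rw [h1]
  have hintg : Integrable (Function.uncurry fun (x : KE d) (z : KE d × KE d) => ee ⟪x, z.1 + z.2⟫ *
      (w x * (((‖z.1 + z.2‖ ^ γ : ℝ) : ℂ) * (𝓕 (⇑u) z.1 * 𝓕 (⇑v) z.2)))) (volume.prod (volume.prod volume)) :=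
    int_ee (g := fun p : KE d × (KE d × KE d) => ⟪p.1, p.2.1 + p.2.2⟫)
      (hw.mul_prod (weight2_int u v hγ)) (by fun_prop)
  rw [Measure.volume_eq_prod, integral_integral_swap hintg]
  refine integral_congr_ae (Filter.Eventually.of_forall fun z => ?_)
  simp only
  rw [mul_right_comm, ← integral_const_mul]
  refine integral_congr_ae (Filter.Eventually.of_forall fun x => ?_)
  simp only; ring

end KP

namespace KP

lemma dchi_bdd : ∃ M, ∀ s, dchi s ≤ M := by
  have hcs : HasCompactSupport dchi := by
    refine HasCompactSupport.intro (isCompact_Icc (a := (1:ℝ)) (b := 2)) fun s hs => ?_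
    by_contra h; exact hs (dchi_supp h)
  obtain ⟨C, hC⟩ := hcs.exists_bound_of_continuous dchi_cont
  exact ⟨C, fun s => (le_abs_self _).trans (hC s)⟩

lemma psi1_bdd : ∃ M, ∀ s, psi1 s ≤ M := by
  have hcs : HasCompactSupport psi1 := by
    refine HasCompactSupport.intro (isCompact_Icc (a := (1:ℝ)) (b := 2)) fun s hs => ?_
    by_contra h; exact hs (psi1_supp h)
  obtain ⟨C, hC⟩ := hcs.exists_bound_of_continuous psi1_cont
  exact ⟨C, fun s => (le_abs_self _).trans (hC s)⟩

lemma psi1_smooth : ContDiff ℝ (⊤ : ℕ∞) psi1 := by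
  have := dchi_smooth
  unfold psi1; fun_prop

lemma psi1_nn {s : ℝ} (hs : 0 ≤ s) : 0 ≤ psi1 s := by
  unfold psi1; have := dchi_nonneg s; positivity

/-- density in the scale parameters -/
noncomputable def bb {d : ℕ} (γ : ℝ) (ν : ℝ × ℝ) (z : KE d × KE d) : ℝ :=
  Real.exp (-(γ * (ν.2 + ν.1))) * dchi (Real.exp (ν.2 + ν.1) ^ 2 * ‖z.1 + z.2‖ ^ 2) *
    (psi1 (Real.exp ν.2 ^ 2 * (16 * ‖z.1‖ ^ 2)) * chi (Real.exp ν.2 ^ 2 * (16 * ‖z.2‖ ^ 2)))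

lemma bb_cont {d : ℕ} (γ : ℝ) : Continuous fun p : (ℝ × ℝ) × (KE d × KE d) => bb γ p.1 p.2 := by
  unfold bb
  have := dchi_cont; have := psi1_cont; have := chi_cont
  fun_prop

lemma bb_nonneg {d : ℕ} (γ : ℝ) (ν : ℝ × ℝ) (z : KE d × KE d) : 0 ≤ bb γ ν z := by
  unfold bb
  have h1 := dchi_nonneg (Real.exp (ν.2 + ν.1) ^ 2 * ‖z.1 + z.2‖ ^ 2)
  have h2 := psi1_nn (s := Real.exp ν.2 ^ 2 * (16 * ‖z.1‖ ^ 2)) (by positivity)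
  have h3 := chi_nonneg (Real.exp ν.2 ^ 2 * (16 * ‖z.2‖ ^ 2))
  positivity

lemma bb_bdd {d : ℕ} (γ : ℝ) (ν : ℝ × ℝ) : ∃ M, ∀ z : KE d × KE d, bb γ ν z ≤ M := by
  obtain ⟨M1, h1⟩ := dchi_bdd
  obtain ⟨M2, h2⟩ := psi1_bdd
  have p1 : 0 ≤ M1 := (dchi_nonneg 0).trans (h1 0)
  have p2 : 0 ≤ M2 := (psi1_nn le_rfl).trans (h2 0)
  refine ⟨Real.exp (-(γ * (ν.2 + ν.1))) * M1 * (M2 * 1), fun z => ?_⟩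
  have h3 := psi1_nn (s := Real.exp ν.2 ^ 2 * (16 * ‖z.1‖ ^ 2)) (by positivity)
  have h4 := chi_nonneg (Real.exp ν.2 ^ 2 * (16 * ‖z.2‖ ^ 2))
  unfold bb
  gcongr
  · exact h1 _
  · exact h2 _
  · exact chi_le_one _

lemma bb_zero {d : ℕ} (γ : ℝ) {ν : ℝ × ℝ} (hν : ν.1 < 0) (z : KE d × KE d) : bb γ ν z = 0 := by
  by_contra h
  unfold bb at h
  have h1 := (dchi_supp (right_ne_zero_of_mul (left_ne_zero_of_mul h))).1
  have h2 := (psi1_supp (left_ne_zero_of_mul (right_ne_zero_of_mul h))).2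
  have h3 : Real.exp ν.2 ^ 2 * (16 * ‖z.2‖ ^ 2) ≤ 2 := by
    by_contra h5
    exact (right_ne_zero_of_mul (right_ne_zero_of_mul h)) (chi_zero (not_le.1 h5).le)
  have h4 : Real.exp (ν.2 + ν.1) ≤ Real.exp ν.2 := by rw [Real.exp_le_exp]; linarith
  have h5 := norm_add_le z.1 z.2
  have h6 : Real.exp (ν.2 + ν.1) ^ 2 * ‖z.1 + z.2‖ ^ 2 ≤ Real.exp ν.2 ^ 2 * (‖z.1‖ + ‖z.2‖) ^ 2 := by
    gcongr
  have h7 : Real.exp ν.2 ^ 2 * (‖z.1‖ + ‖z.2‖) ^ 2 ≤ Real.exp ν.2 ^ 2 * (2 * ‖z.1‖ ^ 2 + 2 * ‖z.2‖ ^ 2) := by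
    gcongr; nlinarith [sq_nonneg (‖z.1‖ - ‖z.2‖)]
  nlinarith

lemma bb_mass {d : ℕ} {γ : ℝ} (hγ : 0 < γ) (z : KE d × KE d) :
    ∫⁻ ν : ℝ × ℝ, ENNReal.ofReal (bb γ ν z + bb γ ν z.swap) = ENNReal.ofReal (‖z.1 + z.2‖ ^ γ) * c0 γ := by
  set ζ := ‖z.1 + z.2‖ with hζ
  have e : ∀ ν : ℝ × ℝ, bb γ ν z + bb γ ν z.swap =
      (Real.exp (-(γ * (ν.2 + ν.1))) * dchi (Real.exp (ν.2 + ν.1) ^ 2 * ζ ^ 2)) *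
      (psi1 (Real.exp ν.2 ^ 2 * (16 * ‖z.1‖ ^ 2)) * chi (Real.exp ν.2 ^ 2 * (16 * ‖z.2‖ ^ 2))
       + chi (Real.exp ν.2 ^ 2 * (16 * ‖z.1‖ ^ 2)) * psi1 (Real.exp ν.2 ^ 2 * (16 * ‖z.2‖ ^ 2))) := by
    intro ν
    unfold bb
    simp only [Prod.fst_swap, Prod.snd_swap]
    rw [add_comm z.2 z.1, ← hζ]; ring
  rcases eq_or_ne ζ 0 with h0 | h0
  · rw [h0, Real.zero_rpow hγ.ne', ENNReal.ofReal_zero, zero_mul]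
    simp_rw [e, h0]
    have : dchi 0 = 0 := by
      by_contra h; have := (dchi_supp h).1; linarith
    simp [this]
  have hpos : 0 < ζ := lt_of_le_of_ne (norm_nonneg _) h0.symm
  have hmax : 0 < max (16 * ‖z.1‖ ^ 2) (16 * ‖z.2‖ ^ 2) := by
    rw [lt_max_iff]
    by_contra h
    push Not at h
    have h1 : ‖z.1‖ = 0 := by nlinarith [norm_nonneg z.1, h.1]
    have h2 : ‖z.2‖ = 0 := by nlinarith [norm_nonneg z.2, h.2]
    have := norm_add_le z.1 z.2
    rw [h1, h2] at this
    linarith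
  have hm : Measurable fun ν : ℝ × ℝ => ENNReal.ofReal (bb γ ν z + bb γ ν z.swap) := by
    have c1 : Continuous fun ν : ℝ × ℝ => bb γ ν z := (bb_cont γ).comp (f := fun ν => (ν, z)) (by fun_prop)
    have c2 : Continuous fun ν : ℝ × ℝ => bb γ ν z.swap := (bb_cont γ).comp (f := fun ν => (ν, z.swap)) (by fun_prop)
    exact (c1.add c2).measurable.ennreal_ofReal
  rw [Measure.volume_eq_prod, lintegral_prod_symm _ hm.aemeasurable]
  have h1 : ∀ θ : ℝ, ∫⁻ β : ℝ, ENNReal.ofReal (bb γ (β, θ) z + bb γ (β, θ) z.swap) =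
      (ENNReal.ofReal (ζ ^ γ) * c0 γ) * ENNReal.ofReal
      (psi1 (Real.exp θ ^ 2 * (16 * ‖z.1‖ ^ 2)) * chi (Real.exp θ ^ 2 * (16 * ‖z.2‖ ^ 2))
       + chi (Real.exp θ ^ 2 * (16 * ‖z.1‖ ^ 2)) * psi1 (Real.exp θ ^ 2 * (16 * ‖z.2‖ ^ 2))) := by
    intro θ
    rw [← odecomp γ hpos, ← lintegral_mul_const' _ _ ENNReal.ofReal_ne_top]
    conv_rhs => rw [← lintegral_add_left_eq_self _ θ]
    refine lintegral_congr fun β => ?_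
    rw [e, ENNReal.ofReal_mul (mul_nonneg (Real.exp_pos _).le (dchi_nonneg _))]
  simp_rw [h1]
  rw [lintegral_const_mul' _ _ (ENNReal.mul_ne_top ENNReal.ofReal_ne_top (c0_ne_top γ)),
    fdecomp (by positivity) (by positivity) hmax, mul_one]

lemma swap_bd {X : Type*} [MeasurableSpace X] {μ : Measure X} [SFinite μ] {N : Type*} [MeasurableSpace N]
    {n : Measure N} [SFinite n] {a : X → ℂ} {b : N → X → ℝ} {m : X → ℝ}
    (ha : AEStronglyMeasurable a μ) (hb : Measurable fun p : N × X => b p.1 p.2) (hb0 : ∀ ν x, 0 ≤ b ν x)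
    (hm0 : ∀ x, 0 ≤ m x)
    (hm : ∀ x, ∫⁻ ν, ENNReal.ofReal (b ν x) ∂n = ENNReal.ofReal (m x))
    (hi : Integrable (fun x => a x * (m x : ℂ)) μ) :
    ‖∫ x, a x * (m x : ℂ) ∂μ‖ₑ ≤ ∫⁻ ν, ‖∫ x, a x * (b ν x : ℂ) ∂μ‖ₑ ∂n := by
  have hbx : ∀ x, Measurable fun ν => b ν x := fun x =>
    hb.comp (f := fun ν : N => (ν, x)) (by fun_prop)
  have h1 : ∀ x, a x * (m x : ℂ) = ∫ ν, a x * (b ν x : ℂ) ∂n := by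
    intro x
    rw [integral_const_mul, integral_complex_ofReal, integral_eq_lintegral_of_nonneg_ae
      (Filter.Eventually.of_forall fun ν => hb0 ν x) (hbx x).aestronglyMeasurable, hm,
      ENNReal.toReal_ofReal (hm0 x)]
  have hb' : Measurable fun p : X × N => ((b p.2 p.1 : ℝ) : ℂ) :=
    Complex.measurable_ofReal.comp (hb.comp (f := fun p : X × N => (p.2, p.1)) (by fun_prop))
  have hmeas : AEStronglyMeasurable (Function.uncurry fun x ν => a x * (b ν x : ℂ)) (μ.prod n) :=
    (ha.comp_fst).mul hb'.aestronglyMeasurable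
  have hintg : Integrable (Function.uncurry fun x ν => a x * (b ν x : ℂ)) (μ.prod n) := by
    refine ⟨hmeas, ?_⟩
    unfold HasFiniteIntegral
    rw [lintegral_prod _ hmeas.enorm]
    refine lt_of_le_of_lt (lintegral_mono fun x => ?_) hi.2
    simp only [Function.uncurry]
    simp_rw [enorm_mul]
    rw [lintegral_const_mul' _ _ enorm_ne_top]
    refine mul_le_mul' le_rfl (le_of_eq ?_)
    have : ∀ y : ℝ, 0 ≤ y → ‖(y : ℂ)‖ₑ = ENNReal.ofReal y := fun y hy => by
      rw [← ofReal_norm, Complex.norm_real, Real.norm_of_nonneg hy]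
    rw [this _ (hm0 x), ← hm]
    exact lintegral_congr fun ν => this _ (hb0 ν x)
  simp_rw [h1]
  rw [integral_integral_swap hintg]
  exact enorm_integral_le_lintegral_enorm _

end KP

namespace KP

/-- Fourier side amplitude -/
noncomputable def aa {d : ℕ} (u v : 𝓢(KE d, ℂ)) (w : KE d → ℂ) (z : KE d × KE d) : ℂ :=
  𝓕 (⇑u) z.1 * 𝓕 (⇑v) z.2 * (∫ x, ee ⟪x, z.1 + z.2⟫ * w x)

lemma T_id {d : ℕ} {γ : ℝ} (hγ : 0 ≤ γ) {k1 k2 k3 : 𝓢(KE d, ℂ)}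
    (h1 : ∀ x, 𝓕 (⇑k1) x = ((psi1 (16 * ‖x‖ ^ 2) * (‖x‖ ^ 2) ^ (-(γ / 2)) : ℝ) : ℂ))
    (h2 : ∀ x, 𝓕 (⇑k2) x = ((dchi (‖x‖ ^ 2) : ℝ) : ℂ))
    (h3 : ∀ x, 𝓕 (⇑k3) x = ((chi (16 * ‖x‖ ^ 2) : ℝ) : ℂ))
    (u v : 𝓢(KE d, ℂ)) {w : KE d → ℂ} (hw : Integrable w) (β θ : ℝ) :
    ∫ z : KE d × KE d, aa u v w z * (bb γ (β, θ) z : ℂ) =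
      ((Real.exp (-(γ * β)) : ℝ) : ℂ) * ∫ y, opK k1 (Real.exp θ) (lamPow γ ⇑u) y *
        opK k3 (Real.exp θ) v y * opK k2 (Real.exp β * Real.exp θ) w y := by
  have ht := Real.exp_pos θ
  have ht2 : 0 < Real.exp β * Real.exp θ := by positivity
  obtain ⟨M2, hM2⟩ := psi1_bdd
  have hA : Integrable fun ξ => ((psi1 (Real.exp θ ^ 2 * (16 * ‖ξ‖ ^ 2)) : ℝ) : ℂ) * 𝓕 (⇑u) ξ := by
    refine (four_int u).bdd_mul (c := M2) ?_ (Filter.Eventually.of_forall fun ξ => ?_)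
    · have := psi1_cont
      exact Continuous.aestronglyMeasurable (by fun_prop)
    · rw [Complex.norm_real, Real.norm_of_nonneg (psi1_nn (by positivity))]; exact hM2 _
  have hB : Integrable fun ξ => ((chi (Real.exp θ ^ 2 * (16 * ‖ξ‖ ^ 2)) : ℝ) : ℂ) * 𝓕 (⇑v) ξ := by
    refine (four_int v).bdd_mul (c := 1) ?_ (Filter.Eventually.of_forall fun ξ => ?_)
    · have := chi_cont
      exact Continuous.aestronglyMeasurable (by fun_prop)
    · rw [Complex.norm_real, Real.norm_of_nonneg (chi_nonneg _)]; exact chi_le_one _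
  have hT := tri_four hA hB (opK_integrable (schwartz_decay k2) ht2 hw)
  have e3 : ∀ y, opK k3 (Real.exp θ) v y =
      ∫ ξ, ee ⟪y, ξ⟫ * (((chi (Real.exp θ ^ 2 * (16 * ‖ξ‖ ^ 2)) : ℝ) : ℂ) * 𝓕 (⇑v) ξ) := by
    intro y
    rw [show (⇑v : KE d → ℂ) = fun x => ∫ ξ, ee ⟪x, ξ⟫ * 𝓕 (⇑v) ξ from funext (schwartz_inv v),
      opK_four (schwartz_decay k3) ht (four_int v), ← funext (schwartz_inv v)]
    refine integral_congr_ae (Filter.Eventually.of_forall fun ξ => ?_)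
    simp only
    rw [h3, norm_smul, Real.norm_of_nonneg ht.le]
    rw [show 16 * (Real.exp θ * ‖ξ‖) ^ 2 = Real.exp θ ^ 2 * (16 * ‖ξ‖ ^ 2) by ring]
  have e1 : ∀ y, opK k1 (Real.exp θ) (lamPow γ ⇑u) y = ((Real.exp (-(γ * θ)) : ℝ) : ℂ) *
      ∫ ξ, ee ⟪y, ξ⟫ * (((psi1 (Real.exp θ ^ 2 * (16 * ‖ξ‖ ^ 2)) : ℝ) : ℂ) * 𝓕 (⇑u) ξ) := by
    intro y
    rw [show lamPow γ (⇑u) = fun x => ∫ ξ, ee ⟪x, ξ⟫ * (((‖ξ‖ ^ γ : ℝ) : ℂ) * 𝓕 (⇑u) ξ) from funext (lam_eq γ u),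
      opK_four (schwartz_decay k1) ht (lam_int u hγ), ← integral_const_mul]
    refine integral_congr_ae (Filter.Eventually.of_forall fun ξ => ?_)
    simp only
    rw [h1, norm_smul, Real.norm_of_nonneg ht.le]
    rw [show 16 * (Real.exp θ * ‖ξ‖) ^ 2 = Real.exp θ ^ 2 * (16 * ‖ξ‖ ^ 2) by ring]
    suffices key : psi1 (Real.exp θ ^ 2 * (16 * ‖ξ‖ ^ 2)) * ((Real.exp θ * ‖ξ‖) ^ 2) ^ (-(γ / 2)) * ‖ξ‖ ^ γ =
        Real.exp (-(γ * θ)) * psi1 (Real.exp θ ^ 2 * (16 * ‖ξ‖ ^ 2)) by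
      have key' := congrArg Complex.ofReal key
      simp only [Complex.ofReal_mul] at key' ⊢
      linear_combination (ee ⟪y, ξ⟫ * 𝓕 (⇑u) ξ) * key'
    rcases eq_or_ne (‖ξ‖) 0 with h0 | h0
    · rw [h0]; simp [psi1]
    · have hp : 0 < ‖ξ‖ := lt_of_le_of_ne (norm_nonneg _) h0.symm
      have : ((Real.exp θ * ‖ξ‖) ^ 2) ^ (-(γ / 2)) * ‖ξ‖ ^ γ = Real.exp (-(γ * θ)) := by
        rw [← Real.rpow_natCast, ← Real.rpow_mul (by positivity), Real.mul_rpow ht.le hp.le,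
          ← Real.exp_mul, mul_assoc, ← Real.rpow_add hp]
        push_cast
        rw [show 2 * -(γ / 2) + γ = 0 by ring, Real.rpow_zero, mul_one]
        congr 1; ring
      rw [mul_assoc, this, mul_comm]
  calc _ = ((Real.exp (-(γ * (θ + β))) : ℝ) : ℂ) * ∫ z : KE d × KE d,
        (((psi1 (Real.exp θ ^ 2 * (16 * ‖z.1‖ ^ 2)) : ℝ) : ℂ) * 𝓕 (⇑u) z.1) *
        (((chi (Real.exp θ ^ 2 * (16 * ‖z.2‖ ^ 2)) : ℝ) : ℂ) * 𝓕 (⇑v) z.2) *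
        (∫ y, ee ⟪y, z.1 + z.2⟫ * opK k2 (Real.exp β * Real.exp θ) w y) := by
        rw [← integral_const_mul]
        refine integral_congr_ae (Filter.Eventually.of_forall fun z => ?_)
        simp only
        rw [opK_wh (schwartz_decay k2) ht2 hw, h2, norm_smul, norm_neg, Real.norm_of_nonneg ht2.le]
        unfold aa bb
        simp only
        rw [show (Real.exp β * Real.exp θ * ‖z.1 + z.2‖) ^ 2 = Real.exp (θ + β) ^ 2 * ‖z.1 + z.2‖ ^ 2 by
          rw [Real.exp_add]; ring]
        push_cast; ring
    _ = _ := by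
        rw [hT]
        simp_rw [e3, e1]
        rw [← integral_const_mul, ← integral_const_mul]
        refine integral_congr_ae (Filter.Eventually.of_forall fun y => ?_)
        simp only
        rw [show -(γ * (θ + β)) = -(γ * β) + -(γ * θ) by ring, Real.exp_add]
        push_cast; ring

lemma wh_bdd {d : ℕ} (w : KE d → ℂ) (ζ : KE d) : ‖∫ x, ee ⟪x, ζ⟫ * w x‖ ≤ ∫ x, ‖w x‖ := by
  refine (norm_integral_le_integral_norm _).trans (le_of_eq ?_)
  congr 1; funext ξ
  rw [norm_mul, ee_norm, one_mul]

lemma wh_meas {d : ℕ} {w : KE d → ℂ} (hw : Measurable w) : Measurable fun ζ : KE d => ∫ x, ee ⟪x, ζ⟫ * w x := by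
  have : StronglyMeasurable fun p : KE d × KE d => ee ⟪p.2, p.1⟫ * w p.2 := by
    apply Measurable.stronglyMeasurable
    have h1 : Measurable fun p : KE d × KE d => ee ⟪p.2, p.1⟫ :=
      ee_cont.measurable.comp (by fun_prop)
    exact h1.mul (hw.comp measurable_snd)
  exact (this.integral_prod_right' (ν := volume)).measurable

lemma aa_meas {d : ℕ} (u v : 𝓢(KE d, ℂ)) {w : KE d → ℂ} (hw : Measurable w) : Measurable (aa u v w) := by
  have hu : Continuous (𝓕 (⇑u)) := by rw [← SchwartzMap.fourier_coe]; exact SchwartzMap.continuous _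
  have hv : Continuous (𝓕 (⇑v)) := by rw [← SchwartzMap.fourier_coe]; exact SchwartzMap.continuous _
  exact ((hu.measurable.comp measurable_fst).mul (hv.measurable.comp measurable_snd)).mul
    ((wh_meas hw).comp (f := fun z : KE d × KE d => z.1 + z.2) (by fun_prop))

lemma aa_int {d : ℕ} (u v : 𝓢(KE d, ℂ)) {w : KE d → ℂ} (hw : Measurable w) : Integrable (aa u v w) := by
  have h := (four_int u).mul_prod (four_int v)
  refine h.mul_bdd (c := ∫ x, ‖w x‖) ?_ (Filter.Eventually.of_forall fun z => wh_bdd w _)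
  exact ((wh_meas hw).comp (f := fun z : KE d × KE d => z.1 + z.2) (by fun_prop)).aestronglyMeasurable

lemma aa_bb_int {d : ℕ} (u v : 𝓢(KE d, ℂ)) {w : KE d → ℂ} (hw : Measurable w) (γ : ℝ) (ν : ℝ × ℝ) :
    Integrable fun z : KE d × KE d => aa u v w z * (bb γ ν z : ℂ) := by
  obtain ⟨M, hM⟩ := bb_bdd (d := d) γ ν
  refine (aa_int u v hw).mul_bdd (c := M) ?_ (Filter.Eventually.of_forall fun z => ?_)
  · have c1 : Continuous fun z : KE d × KE d => bb γ ν z := (bb_cont γ).comp (f := fun z => (ν, z)) (by fun_prop)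
    exact (Complex.continuous_ofReal.comp c1).aestronglyMeasurable
  · rw [Complex.norm_real, Real.norm_of_nonneg (bb_nonneg _ _ _)]; exact hM z

lemma T_swap {d : ℕ} (u v : 𝓢(KE d, ℂ)) (w : KE d → ℂ) (γ : ℝ) (ν : ℝ × ℝ) :
    ∫ z : KE d × KE d, aa u v w z * (bb γ ν z.swap : ℂ) = ∫ z : KE d × KE d, aa v u w z * (bb γ ν z : ℂ) := by
  rw [Measure.volume_eq_prod, ← integral_prod_swap]
  refine integral_congr_ae (Filter.Eventually.of_forall fun z => ?_)
  simp only [aa, Prod.swap_swap, Prod.fst_swap, Prod.snd_swap]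
  rw [add_comm z.2 z.1, mul_comm (𝓕 (⇑u) z.2)]

lemma T_meas {d : ℕ} (u v : 𝓢(KE d, ℂ)) {w : KE d → ℂ} (hw : Measurable w) (γ : ℝ) :
    Measurable fun ν : ℝ × ℝ => ‖∫ z : KE d × KE d, aa u v w z * (bb γ ν z : ℂ)‖ₑ := by
  have h1 : StronglyMeasurable fun p : (ℝ × ℝ) × (KE d × KE d) => aa u v w p.2 * (bb γ p.1 p.2 : ℂ) := by
    apply Measurable.stronglyMeasurable
    exact ((aa_meas u v hw).comp measurable_snd).mul (Complex.measurable_ofReal.comp (bb_cont γ).measurable)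
  exact (h1.integral_prod_right' (ν := volume)).measurable.enorm

lemma half_bd {d : ℕ} {p q s : ℝ≥0∞} (hp : 1 < p) (hq : 1 < q) (hs : 1 < s) (h : p⁻¹ + q⁻¹ + s⁻¹ = 1)
    {γ : ℝ} (hγ : 0 < γ) : ∃ K : ℝ≥0∞, K ≠ ∞ ∧ ∀ u v : 𝓢(KE d, ℂ), ∀ w : KE d → ℂ, Measurable w →
      Integrable w → ∀ B, (∀ x, ‖w x‖ ≤ B) →
      ∫⁻ ν : ℝ × ℝ, ‖∫ z : KE d × KE d, aa u v w z * (bb γ ν z : ℂ)‖ₑ ≤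
        K * (eLpNorm (lamPow γ ⇑u) p * eLpNorm (⇑v) q * eLpNorm w s) := by
  have sm1 : ContDiff ℝ (⊤ : ℕ∞) fun s : ℝ => psi1 (16 * s) * s ^ (-(γ / 2)) := by
    refine mul_smooth (h := fun s => psi1 (16 * s)) (a := 1 / 16) ?_ (by norm_num) (fun s hs => ?_) (fun s hs => ?_)
    · exact psi1_smooth.comp (by fun_prop)
    · by_contra hne; have := (psi1_supp hne).1; linarith
    · exact Real.contDiffAt_rpow_const_of_ne hs.ne'
  obtain ⟨k1, hk1, hc1⟩ := canc_exists (d := d) sm1 (a := 1 / 16) (b := 1 / 8) (by norm_num)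
    (fun s hs => by
      by_contra hne; have := (psi1_supp (left_ne_zero_of_mul hne)).1; linarith)
    (fun s hs => by
      by_contra hne; have := (psi1_supp (left_ne_zero_of_mul hne)).2; linarith)
  obtain ⟨k2, hk2, hc2⟩ := canc_exists (d := d) dchi_smooth (a := 1) (b := 2) (by norm_num)
    (fun s hs => by
      by_contra hne; have := (dchi_supp hne).1; linarith)
    (fun s hs => by
      by_contra hne; have := (dchi_supp hne).2; linarith)
  obtain ⟨k3, hk3, -⟩ := ker_exists (d := d) (h := fun s => chi (16 * s)) (b := 1 / 8)
    (chi_smooth.comp (by fun_prop)) (fun s hs => chi_zero (by linarith))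
  obtain ⟨K, hK, hmain⟩ := tri_final hp hq hs h hc1 hc2 (schwartz_decay k3) hγ
  refine ⟨K, hK, fun u v w hw hwi B hB => ?_⟩
  obtain ⟨B1, hB1⟩ := lam_bdd γ (⇑u)
  have hmu : Measurable (lamPow γ (⇑u)) := by
    apply lam_meas
    rw [← SchwartzMap.fourier_coe]; exact (SchwartzMap.continuous _).measurable
  refine le_trans ?_ (hmain (lamPow γ (⇑u)) w (⇑v) hmu hw v.continuous.measurable (max B B1)
    (fun x => (hB1 x).trans (le_max_right _ _)) (fun x => (hB x).trans (le_max_left _ _)))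
  rw [Measure.volume_eq_prod, lintegral_prod _ (T_meas u v hw γ).aemeasurable,
    ← lintegral_indicator measurableSet_Ici]
  refine lintegral_mono fun β => ?_
  simp only [Set.indicator_apply, Set.mem_Ici]
  split_ifs with hβ
  · rw [← lintegral_const_mul' _ _ ENNReal.ofReal_ne_top]
    refine lintegral_mono fun θ => ?_
    simp only
    rw [T_id hγ.le hk1 hk2 hk3 u v hwi, enorm_mul]
    refine mul_le_mul' (le_of_eq ?_) ?_
    · rw [← ofReal_norm, Complex.norm_real, Real.norm_of_nonneg (Real.exp_pos _).le]
    · refine (enorm_integral_le_lintegral_enorm _).trans (le_of_eq ?_)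
      simp_rw [enorm_mul]
  · simp [bb_zero γ (ν := (β, _)) (not_le.1 hβ)]

lemma pair_bd {d : ℕ} {p₁ q₁ p₂ q₂ s : ℝ≥0∞} (hp₁ : 1 < p₁) (hq₁ : 1 < q₁) (hp₂ : 1 < p₂) (hq₂ : 1 < q₂)
    (hs : 1 < s) (h₁ : p₁⁻¹ + q₁⁻¹ + s⁻¹ = 1) (h₂ : q₂⁻¹ + p₂⁻¹ + s⁻¹ = 1)
    {γ : ℝ} (hγ : 0 < γ) : ∃ K : ℝ≥0∞, K ≠ ∞ ∧ ∀ u v : 𝓢(KE d, ℂ), ∀ w : KE d → ℂ, Measurable w →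
      Integrable w → ∀ B, (∀ x, ‖w x‖ ≤ B) →
      ‖∫ x, lamPow γ (fun x => u x * v x) x * w x‖ₑ ≤
        K * (eLpNorm (lamPow γ ⇑u) p₁ * eLpNorm (⇑v) q₁ +
          eLpNorm (⇑u) p₂ * eLpNorm (lamPow γ ⇑v) q₂) * eLpNorm w s := by
  obtain ⟨K1, hK1, hb1⟩ := half_bd (d := d) hp₁ hq₁ hs h₁ hγ
  obtain ⟨K2, hK2, hb2⟩ := half_bd (d := d) hq₂ hp₂ hs h₂ hγ
  have hc := c0_ne_top γ
  have hc0 := c0_ne_zero γ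
  refine ⟨(c0 γ)⁻¹ * max K1 K2, ENNReal.mul_ne_top (ENNReal.inv_ne_top.2 hc0) (by simp [hK1, hK2]),
    fun u v w hw hwi B hB => ?_⟩
  have hI : Integrable fun z : KE d × KE d => aa u v w z * ((‖z.1 + z.2‖ ^ γ * (c0 γ).toReal : ℝ) : ℂ) := by
    have h := ((weight2_int u v hγ.le).mul_bdd (c := ∫ x, ‖w x‖)
      ((wh_meas hw).comp (f := fun z : KE d × KE d => z.1 + z.2) (by fun_prop)).aestronglyMeasurable
      (Filter.Eventually.of_forall fun z => wh_bdd w _)).mul_const (((c0 γ).toReal : ℝ) : ℂ)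
    refine h.congr (Filter.Eventually.of_forall fun z => ?_)
    simp only [aa, Function.comp]; push_cast; ring
  have hbm : Measurable fun p : (ℝ × ℝ) × (KE d × KE d) => bb γ p.1 p.2 + bb γ p.1 p.2.swap :=
    (bb_cont γ).measurable.add ((bb_cont γ).measurable.comp
      (f := fun p : (ℝ × ℝ) × (KE d × KE d) => (p.1, p.2.swap)) (by fun_prop))
  have hS := swap_bd (μ := (volume : Measure (KE d × KE d))) (n := (volume : Measure (ℝ × ℝ)))
    (b := fun ν z => bb γ ν z + bb γ ν z.swap)
    (m := fun z => ‖z.1 + z.2‖ ^ γ * (c0 γ).toReal) (aa_meas u v hw).aestronglyMeasurable hbm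
    (fun ν z => add_nonneg (bb_nonneg _ _ _) (bb_nonneg _ _ _)) (fun z => by positivity)
    (fun z => by rw [bb_mass hγ, ENNReal.ofReal_mul (by positivity), ENNReal.ofReal_toReal hc]) hI
  have e1 : ∫ z : KE d × KE d, aa u v w z * ((‖z.1 + z.2‖ ^ γ * (c0 γ).toReal : ℝ) : ℂ) =
      (∫ x, lamPow γ (fun x => u x * v x) x * w x) * ((c0 γ).toReal : ℂ) := by
    rw [lam_pair u v hγ.le hwi, ← integral_mul_const]
    refine integral_congr_ae (Filter.Eventually.of_forall fun z => ?_)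
    simp only [aa]; push_cast; ring
  have e2 : ∀ ν : ℝ × ℝ, ∫ z : KE d × KE d, aa u v w z * ((bb γ ν z + bb γ ν z.swap : ℝ) : ℂ) =
      (∫ z : KE d × KE d, aa u v w z * (bb γ ν z : ℂ)) + ∫ z : KE d × KE d, aa v u w z * (bb γ ν z : ℂ) := by
    intro ν
    rw [← T_swap u v, ← integral_add (aa_bb_int u v hw γ ν)]
    · refine integral_congr_ae (Filter.Eventually.of_forall fun z => ?_)
      simp only; push_cast; ring
    · have := (aa_bb_int v u hw γ ν).swap
      refine this.congr (Filter.Eventually.of_forall fun z => ?_)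
      simp only [aa, Function.comp, Prod.fst_swap, Prod.snd_swap]
      rw [add_comm z.2 z.1, mul_comm (𝓕 (⇑v) z.2)]
  rw [e1] at hS
  simp only [e2] at hS
  have hS2 := hS.trans (lintegral_mono fun ν => enorm_add_le _ _)
  rw [lintegral_add_left (T_meas u v hw γ)] at hS2
  have hS3 := hS2.trans (add_le_add (hb1 u v w hw hwi B hB) (hb2 v u w hw hwi B hB))
  have e4 : ‖((c0 γ).toReal : ℂ)‖ₑ = c0 γ := by
    rw [← ofReal_norm, Complex.norm_real, Real.norm_of_nonneg ENNReal.toReal_nonneg, ENNReal.ofReal_toReal hc]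
  rw [enorm_mul, e4, mul_comm] at hS3
  calc _ = (c0 γ)⁻¹ * (c0 γ * ‖∫ x, lamPow γ (fun x => u x * v x) x * w x‖ₑ) := by
        rw [← mul_assoc, ENNReal.inv_mul_cancel hc0 hc, one_mul]
    _ ≤ (c0 γ)⁻¹ * (max K1 K2 * (eLpNorm (lamPow γ ⇑u) p₁ * eLpNorm (⇑v) q₁ * eLpNorm w s) +
          max K1 K2 * (eLpNorm (lamPow γ ⇑v) q₂ * eLpNorm (⇑u) p₂ * eLpNorm w s)) := by
        refine mul_le_mul' le_rfl (hS3.trans (add_le_add ?_ ?_))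
        · exact mul_le_mul' (le_max_left _ _) le_rfl
        · exact mul_le_mul' (le_max_right _ _) le_rfl
    _ = _ := by ring

end KP

namespace KP

lemma dual_bd {d : ℕ} {F : KE d → ℂ} (hF : Measurable F) {B0 : ℝ} (hB0 : ∀ x, ‖F x‖ ≤ B0)
    {R S : ℝ} (hR : 1 < R) (hRS : S = R / (R - 1)) {D : ℝ≥0∞}
    (hD : ∀ w : KE d → ℂ, Measurable w → Integrable w → ∀ B, (∀ x, ‖w x‖ ≤ B) →
      ‖∫ x, F x * w x‖ₑ ≤ D * eLpNorm w (ENNReal.ofReal S)) :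
    eLpNorm F (ENNReal.ofReal R) ≤ D := by
  have hR0 : 0 < R := by linarith
  have hR1 : 0 < R - 1 := by linarith
  have hS0 : 0 < S := by rw [hRS]; positivity
  have hB00 : 0 ≤ B0 := (norm_nonneg _).trans (hB0 0)
  have key : ∀ n : ℕ, ∫⁻ x in Metric.closedBall (0 : KE d) n, ‖F x‖ₑ ^ R ≤ D ^ R := by
    intro n
    set b := Metric.closedBall (0 : KE d) n with hb
    have hbm : MeasurableSet b := Metric.isClosed_closedBall.measurableSet
    have hbf : volume b < ∞ := measure_closedBall_lt_top
    set A := ∫⁻ x in b, ‖F x‖ₑ ^ R with hA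
    have hAf : A ≠ ∞ := by
      refine ne_top_of_le_ne_top ?_ (setLIntegral_mono (μ := volume) (g := fun _ => ENNReal.ofReal B0 ^ R) measurable_const
        (fun x _ => ENNReal.rpow_le_rpow (z := R) ?_ hR0.le))
      · rw [setLIntegral_const]
        exact ENNReal.mul_ne_top (ENNReal.rpow_ne_top_of_nonneg hR0.le ENNReal.ofReal_ne_top) hbf.ne
      · rw [← ofReal_norm]; exact ENNReal.ofReal_le_ofReal (hB0 x)
    set g : KE d → ℂ := fun x => (starRingEnd ℂ) (F x) * ((‖F x‖ ^ (R - 2) : ℝ) : ℂ) with hg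
    have hgm : Measurable g :=
      (Complex.continuous_conj.measurable.comp hF).mul
        (Complex.measurable_ofReal.comp (hF.norm.pow_const (R - 2)))
    have hgn : ∀ x, ‖g x‖ = ‖F x‖ ^ (R - 1) := by
      intro x
      simp only [hg, norm_mul, RCLike.norm_conj, Complex.norm_real]
      rw [Real.norm_of_nonneg (by positivity)]
      rcases eq_or_ne (‖F x‖) 0 with h0 | h0
      · rw [h0, zero_mul, Real.zero_rpow hR1.ne']
      · rw [show R - 1 = 1 + (R - 2) by ring, Real.rpow_add (lt_of_le_of_ne (norm_nonneg _) h0.symm), Real.rpow_one]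
    have hgF : ∀ x, F x * g x = ((‖F x‖ ^ R : ℝ) : ℂ) := by
      intro x
      simp only [hg]
      rw [← mul_assoc, Complex.mul_conj, Complex.normSq_eq_norm_sq, ← Complex.ofReal_mul]
      congr 1
      rcases eq_or_ne (‖F x‖) 0 with h0 | h0
      · rw [h0, Real.zero_rpow hR0.ne']; simp
      · rw [← Real.rpow_natCast, ← Real.rpow_add (lt_of_le_of_ne (norm_nonneg _) h0.symm)]
        congr 1; push_cast; ring
    set w := b.indicator g with hw
    have hwm : Measurable w := hgm.indicator hbm
    have hgb : ∀ x, ‖g x‖ ≤ B0 ^ (R - 1) := fun x => by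
      rw [hgn]; exact Real.rpow_le_rpow (norm_nonneg _) (hB0 x) hR1.le
    have hwb : ∀ x, ‖w x‖ ≤ B0 ^ (R - 1) := fun x => (norm_indicator_le_norm_self _ _).trans (hgb x)
    have hwi : Integrable w := by
      rw [hw, integrable_indicator_iff hbm]
      exact Measure.integrableOn_of_bounded hbf.ne hgm.aestronglyMeasurable
        (Filter.Eventually.of_forall hgb)
    have h1 := hD w hwm hwi _ hwb
    have e1 : ‖∫ x, F x * w x‖ₑ = A := by
      have : ∀ x, F x * w x = b.indicator (fun x => ((‖F x‖ ^ R : ℝ) : ℂ)) x := by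
        intro x
        by_cases hx : x ∈ b
        · simp only [hw, Set.indicator_of_mem hx, hgF]
        · simp only [hw, Set.indicator_of_notMem hx, mul_zero]
      simp_rw [this]
      rw [integral_indicator hbm, integral_complex_ofReal, ← ofReal_norm, Complex.norm_real,
        Real.norm_of_nonneg (integral_nonneg fun x => by positivity),
        ofReal_integral_eq_lintegral_ofReal]
      · refine lintegral_congr fun x => ?_
        rw [← ofReal_norm, ENNReal.ofReal_rpow_of_nonneg (norm_nonneg _) hR0.le]
      · refine Measure.integrableOn_of_bounded (M := B0 ^ R) hbf.ne (hF.norm.pow_const R).aestronglyMeasurable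
          (Filter.Eventually.of_forall fun x => ?_)
        rw [Real.norm_of_nonneg (by positivity)]
        exact Real.rpow_le_rpow (norm_nonneg _) (hB0 x) hR0.le
      · exact Filter.Eventually.of_forall fun x => by simp only [Pi.zero_apply]; positivity
    have e2 : eLpNorm w (ENNReal.ofReal S) = A ^ (1 / S) := by
      rw [eLpNorm_eq_lintegral_rpow_enorm_toReal (by simpa using hS0) ENNReal.ofReal_ne_top,
        ENNReal.toReal_ofReal hS0.le, hA, ← lintegral_indicator hbm]
      congr 1
      refine lintegral_congr fun x => ?_
      by_cases hx : x ∈ b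
      · simp only [hw, Set.indicator_of_mem hx]
        rw [← ofReal_norm, hgn, ← ofReal_norm, ← ENNReal.ofReal_rpow_of_nonneg (norm_nonneg _) hR1.le,
          ← ENNReal.rpow_mul]
        congr 1
        rw [hRS]; field_simp
      · simp only [hw, Set.indicator_of_notMem hx, enorm_zero, ENNReal.zero_rpow_of_pos hS0]
    rw [e1, e2] at h1
    rcases eq_or_ne A 0 with h0 | h0
    · rw [h0]; exact zero_le
    have h2 : A ^ (1 / R) ≤ D := by
      calc A ^ (1 / R) = A ^ (1 : ℝ) * A ^ (-(1 / S)) := by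
            rw [← ENNReal.rpow_add _ _ h0 hAf]; congr 1; rw [hRS]; field_simp; ring
        _ ≤ D * A ^ (1 / S) * A ^ (-(1 / S)) := by
            rw [ENNReal.rpow_one]; exact mul_le_mul' h1 le_rfl
        _ = D := by
            rw [mul_assoc, ← ENNReal.rpow_add _ _ h0 hAf, add_neg_cancel, ENNReal.rpow_zero, mul_one]
    calc A = (A ^ (1 / R)) ^ R := by
          rw [← ENNReal.rpow_mul, one_div, inv_mul_cancel₀ hR0.ne', ENNReal.rpow_one]
      _ ≤ D ^ R := ENNReal.rpow_le_rpow h2 hR0.le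
  have h3 : ∫⁻ x, ‖F x‖ₑ ^ R ≤ D ^ R := by
    have hu : (⋃ n : ℕ, Metric.closedBall (0 : KE d) n) = Set.univ := Metric.iUnion_closedBall_nat 0
    rw [← setLIntegral_univ, ← hu, setLIntegral_iUnion_of_directed]
    · exact iSup_le key
    · refine (monotone_nat_of_le_succ fun n => ?_).directed_le
      exact Metric.closedBall_subset_closedBall (by push_cast; linarith)
  rw [eLpNorm_eq_lintegral_rpow_enorm_toReal (by simpa using hR0) ENNReal.ofReal_ne_top,
    ENNReal.toReal_ofReal hR0.le]
  calc _ ≤ (D ^ R) ^ (1 / R) := ENNReal.rpow_le_rpow h3 (by positivity)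
    _ = D := by rw [← ENNReal.rpow_mul, one_div, mul_inv_cancel₀ hR0.ne', ENNReal.rpow_one]

lemma lam_zero {d : ℕ} (u : 𝓢(KE d, ℂ)) : lamPow 0 (⇑u) = ⇑u := by
  funext x
  rw [lam_eq, schwartz_inv u x]
  simp_rw [Real.rpow_zero, Complex.ofReal_one, one_mul]

lemma lam_zero_mul {d : ℕ} (u v : 𝓢(KE d, ℂ)) : lamPow 0 (fun x => u x * v x) = fun x => u x * v x := by
  funext x
  rw [lam_mul u v le_rfl, schwartz_inv u x, schwartz_inv v x, ← integral_prod_mul]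
  refine integral_congr_ae (Filter.Eventually.of_forall fun z => ?_)
  simp only [Real.rpow_zero, Complex.ofReal_one, one_mul]
  rw [inner_add_right, ee_add]; ring

theorem main (d : ℕ) (γ : ℝ) (hγ : 0 ≤ γ) (r p₁ p₂ q₁ q₂ : ℝ≥0∞)
    (hr : 1 < r) (hr' : r ≠ ∞) (hp₁ : 1 < p₁) (hp₂ : 1 < p₂) (hq₁ : 1 < q₁) (hq₂ : 1 < q₂)
    (h₁ : 1 / r = 1 / p₁ + 1 / q₁) (h₂ : 1 / r = 1 / p₂ + 1 / q₂) :
    ∃ C > (0 : ℝ), ∀ u v : 𝓢(KE d, ℂ),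
      eLpNorm (lamPow γ (fun x => u x * v x)) r volume ≤ ENNReal.ofReal C *
        (eLpNorm (lamPow γ ⇑u) p₁ volume * eLpNorm (⇑v) q₁ volume +
          eLpNorm (⇑u) p₂ volume * eLpNorm (lamPow γ ⇑v) q₂ volume) := by
  simp only [one_div] at h₁ h₂
  rcases eq_or_lt_of_le hγ with h0 | h0
  · subst h0
    refine ⟨1, one_pos, fun u v => ?_⟩
    rw [lam_zero, lam_zero, lam_zero_mul, ENNReal.ofReal_one, one_mul]
    have : ENNReal.HolderTriple p₁ q₁ r := ⟨h₁.symm⟩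
    refine le_trans ?_ le_self_add
    exact eLpNorm_smul_le_mul_eLpNorm (φ := ⇑u) (f := ⇑v) v.continuous.aestronglyMeasurable u.continuous.aestronglyMeasurable
  set R := r.toReal with hRd
  have hrR : r = ENNReal.ofReal R := (ENNReal.ofReal_toReal hr').symm
  have hR : 1 < R := by
    rw [hRd, ← ENNReal.toReal_one]; exact (ENNReal.toReal_lt_toReal ENNReal.one_ne_top hr').2 hr
  have hR1 : 0 < R - 1 := by linarith
  set S := R / (R - 1) with hS
  have hS0 : 0 < S := by positivity
  have hS1 : 1 < S := by rw [hS, lt_div_iff₀ hR1]; linarith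
  have hs : (1 : ℝ≥0∞) < ENNReal.ofReal S := by
    rw [← ENNReal.ofReal_one]; exact (ENNReal.ofReal_lt_ofReal_iff hS0).2 hS1
  have hconj : r⁻¹ + (ENNReal.ofReal S)⁻¹ = 1 := by
    rw [hrR, ← ENNReal.ofReal_inv_of_pos (by linarith), ← ENNReal.ofReal_inv_of_pos hS0,
      ← ENNReal.ofReal_add (by positivity) (by positivity), ← ENNReal.ofReal_one]
    congr 1
    rw [hS]; field_simp; ring
  obtain ⟨K, hK, hpair⟩ := pair_bd (d := d) hp₁ hq₁ hp₂ hq₂ hs (by rw [← h₁, hconj])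
    (by rw [add_comm q₂⁻¹, ← h₂, hconj]) h0
  refine ⟨K.toReal + 1, by positivity, fun u v => ?_⟩
  have hKC : K ≤ ENNReal.ofReal (K.toReal + 1) := by
    rw [← ENNReal.ofReal_toReal hK, ENNReal.toReal_ofReal ENNReal.toReal_nonneg]
    exact ENNReal.ofReal_le_ofReal (by linarith)
  refine le_trans ?_ (mul_le_mul' hKC le_rfl)
  obtain ⟨B0, hB0⟩ := lam_bdd γ (fun x : KE d => u x * v x)
  have hFm : Measurable (lamPow γ (fun x : KE d => u x * v x)) := by
    apply lam_meas
    have hm : Measurable fun x : KE d => u x * v x :=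
      u.continuous.measurable.mul v.continuous.measurable
    have h := (wh_meas hm).comp (f := fun ζ : KE d => -ζ) (by fun_prop)
    have e : 𝓕 (fun x : KE d => u x * v x) = fun ζ => ∫ x, ee ⟪x, -ζ⟫ * (u x * v x) := by
      funext ζ
      rw [four_ee]
      simp_rw [inner_neg_right]
    rw [e]; exact h
  rw [hrR]
  exact dual_bd hFm hB0 hR hS (hpair u v)

end KP

/-- fractional Leibniz rule (Kato–Ponce inequality). -/
theorem stmt7 (d : ℕ) (hd : 1 ≤ d) (γ : ℝ) (hγ : 0 ≤ γ)
    (r p₁ p₂ q₁ q₂ : ℝ≥0∞) (hr : 1 < r) (hr' : r ≠ ∞)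
    (hp₁ : 1 < p₁) (hp₂ : 1 < p₂) (hq₁ : 1 < q₁) (hq₂ : 1 < q₂)
    (h₁ : 1 / r = 1 / p₁ + 1 / q₁) (h₂ : 1 / r = 1 / p₂ + 1 / q₂) :
    ∃ C > (0 : ℝ), ∀ u v : 𝓢(EuclideanSpace ℝ (Fin d), ℂ),
      eLpNorm (lamPow γ (fun x => u x * v x)) r MeasureTheory.volume ≤
        ENNReal.ofReal C *
          (eLpNorm (lamPow γ ⇑u) p₁ MeasureTheory.volume *
              eLpNorm ⇑v q₁ MeasureTheory.volume +
            eLpNorm ⇑u p₂ MeasureTheory.volume *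
              eLpNorm (lamPow γ ⇑v) q₂ MeasureTheory.volume) := by
  exact KP.main d γ hγ r p₁ p₂ q₁ q₂ hr hr' hp₁ hp₂ hq₁ hq₂ h₁ h₂
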